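/- arXiv:2412.15096 — 2 statements merged into one kernel-verified Lean document; each statement's English description precedes it below -/
import Mathlib

section
/- Let Γ ⊂ P^n, n ≥ 2, be a finite subscheme of degree d in linearly general position over an algebraically closed field of characteristic 0 such that d ≥ 4n² + 6n + 1 and reg(Γ) ≥ ⌈(d−1)/(n + n/(2n+2))⌉ + 3. Then there is a unique rational normal curve C of degree n in P^n such that ρ(Γ) = |Γ ∩ C| and reg(Γ) = reg(Γ ∩ C). -/
open MvPolynomial Filter
open scoped Classical

attribute [local instance] MvPolynomial.gradedAlgebra

noncomputable section

variable {K : Type} [Field K] {n : ℕ}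

/-- The Hilbert function, in degree `m`, of the quotient of the homogeneous
coordinate ring of `ℙ^n_K` by the ideal `I`. -/
def hilbF (I : Ideal (MvPolynomial (Fin (n+1)) K)) (m : ℕ) : ℕ :=
  Module.finrank K
    ((MvPolynomial.homogeneousSubmodule (Fin (n+1)) K m).map
      (Ideal.Quotient.mkₐ K I).toLinearMap)

/-- The irrelevant maximal ideal `(x_0, …, x_n)`. -/
def irrelevantIdeal (K : Type) [Field K] (n : ℕ) : Ideal (MvPolynomial (Fin (n+1)) K) :=
  Ideal.span (Set.range MvPolynomial.X)

/-- Saturation of a homogeneous ideal with respect to the irrelevant ideal. -/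
def saturate (I : Ideal (MvPolynomial (Fin (n+1)) K)) : Ideal (MvPolynomial (Fin (n+1)) K) :=
  ⨆ k : ℕ, Submodule.colon I ((irrelevantIdeal K n ^ k : Ideal (MvPolynomial (Fin (n+1)) K)) : Submodule (MvPolynomial (Fin (n+1)) K) (MvPolynomial (Fin (n+1)) K))

/-- `I` is the (saturated, homogeneous) ideal of a nonempty finite closed subscheme of
`ℙ^n`, i.e. its Hilbert function is eventually a positive constant. -/
structure IsFiniteSubscheme (I : Ideal (MvPolynomial (Fin (n+1)) K)) : Prop where
  homog : Ideal.IsHomogeneous (MvPolynomial.homogeneousSubmodule (Fin (n+1)) K) I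
  saturated : saturate I = I
  finite : ∃ d : ℕ, 0 < d ∧ ∀ᶠ m : ℕ in atTop, hilbF I m = d

/-- The degree (length) of the finite scheme with ideal `I` : the eventual value of
its Hilbert function. -/
def schemeDeg (I : Ideal (MvPolynomial (Fin (n+1)) K)) : ℕ :=
  if h : ∃ d : ℕ, ∀ᶠ m : ℕ in atTop, hilbF I m = d then h.choose else 0

/-- The Castelnuovo–Mumford regularity of the finite scheme with ideal `I` : the least
`p ≥ 1` such that the scheme is `(p-1)`-normal (for a finite scheme, `p`-regularity is
equivalent to `(p-1)`-normality). -/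
def schemeReg (I : Ideal (MvPolynomial (Fin (n+1)) K)) : ℕ :=
  sInf {p : ℕ | 1 ≤ p ∧ ∀ m : ℕ, p - 1 ≤ m → hilbF I m = schemeDeg I}

/-- `h¹(ℙ^n, I_Γ(q))` for a finite scheme `Γ` and `q ≥ 0`: the failure of `q`-normality,
`deg Γ - h_Γ(q)`. -/
def h1F (I : Ideal (MvPolynomial (Fin (n+1)) K)) (q : ℕ) : ℕ :=
  schemeDeg I - hilbF I q

/-- `J` is the ideal of a `t`-dimensional linear subspace of `ℙ^n`: it is generated by a
space of linear forms of codimension... i.e. of `K`-dimension `n - t`. -/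
def IsLinearSubspace (J : Ideal (MvPolynomial (Fin (n+1)) K)) (t : ℕ) : Prop :=
  ∃ W : Submodule K (MvPolynomial (Fin (n+1)) K),
    W ≤ MvPolynomial.homogeneousSubmodule (Fin (n+1)) K 1 ∧
    Module.finrank K W + t = n ∧
    J = Ideal.span (W : Set (MvPolynomial (Fin (n+1)) K))

/-- The ideal of the scheme-theoretic intersection (defined by the sum of the ideal
sheaves): the saturation of `I + J`. -/
def interIdeal (I J : Ideal (MvPolynomial (Fin (n+1)) K)) : Ideal (MvPolynomial (Fin (n+1)) K) :=
  saturate (I ⊔ J)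

/-- The residual scheme `Γ : V`, where `V` is the hypersurface `{f = 0}`, is defined by
the colon ideal `(I_Γ : f)`. -/
def residualIdeal (I : Ideal (MvPolynomial (Fin (n+1)) K)) (f : MvPolynomial (Fin (n+1)) K) :
    Ideal (MvPolynomial (Fin (n+1)) K) :=
  Submodule.colon I (Ideal.span {f})

/-- `Γ` admits a `(t+2)`-secant `t`-plane. -/
def HasSecantPlane (I : Ideal (MvPolynomial (Fin (n+1)) K)) (t : ℕ) : Prop :=
  ∃ J : Ideal (MvPolynomial (Fin (n+1)) K),
    IsLinearSubspace J t ∧ t + 2 ≤ schemeDeg (interIdeal I J)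

/-- `t(Γ)`: the smallest `t` such that `Γ` admits a `(t+2)`-secant `t`-plane. -/
def tInv (I : Ideal (MvPolynomial (Fin (n+1)) K)) : ℕ :=
  sInf {t : ℕ | HasSecantPlane I t}

/-- `Γ` is in linearly general position if `t(Γ) = n`. -/
def InLinGenPos (I : Ideal (MvPolynomial (Fin (n+1)) K)) : Prop :=
  tInv I = n

/-- `Γ ⊆ ℙ^n` is nondegenerate: `I(Γ)` contains no nonzero linear form. -/
def NondegenerateScheme (I : Ideal (MvPolynomial (Fin (n+1)) K)) : Prop :=
  Submodule.restrictScalars K I ⊓ MvPolynomial.homogeneousSubmodule (Fin (n+1)) K 1 = ⊥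

/-- The (projective) dimension of the linear span `⟨Γ⟩` of the scheme with ideal `I`:
`n` minus the number of independent linear forms in `I`. -/
def spanDim (I : Ideal (MvPolynomial (Fin (n+1)) K)) : ℕ :=
  n - Module.finrank K
    ↥(Submodule.restrictScalars K I ⊓ MvPolynomial.homogeneousSubmodule (Fin (n+1)) K 1)

/-- `Γ ∩ Λ` is nondegenerate as a subscheme of the `t`-plane `Λ`: it is contained in no
`(t-1)`-dimensional linear subspace of `Λ`. -/
def NondegenerateIn (I Λ : Ideal (MvPolynomial (Fin (n+1)) K)) (t : ℕ) : Prop :=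
  ∀ J : Ideal (MvPolynomial (Fin (n+1)) K),
    IsLinearSubspace J (t - 1) → Λ ≤ J → ¬ J ≤ interIdeal I Λ

/-- `Γ ∩ Λ` is in linearly general position as a subscheme of the `t`-plane `Λ`: it has
no `(s+2)`-secant `s`-plane inside `Λ` for any `s < t`. -/
def InLinGenPosIn (I Λ : Ideal (MvPolynomial (Fin (n+1)) K)) (t : ℕ) : Prop :=
  ∀ s : ℕ, s < t → ∀ J : Ideal (MvPolynomial (Fin (n+1)) K),
    IsLinearSubspace J s → Λ ≤ J → schemeDeg (interIdeal I J) ≤ s + 1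

/-- `J` is the (saturated) homogeneous ideal of a rational normal curve of degree `t`
in `ℙ^n` : the curve is the image of `ℙ^1` under a parametrization by a basis-spanning
family of binary forms of degree `t`, and `J` is the vanishing ideal of (the affine cone
over) this image. -/
def IsRNC (t : ℕ) (J : Ideal (MvPolynomial (Fin (n+1)) K)) : Prop :=
  ∃ p : Fin (n+1) → MvPolynomial (Fin 2) K,
    (∀ i, (p i).IsHomogeneous t) ∧
    Submodule.span K (Set.range p) = MvPolynomial.homogeneousSubmodule (Fin 2) K t ∧
    J = ⨅ x : Fin 2 → K,
      RingHom.ker (MvPolynomial.eval (fun i => MvPolynomial.eval x (p i)) :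
        MvPolynomial (Fin (n+1)) K →+* K)

/-- `ρ(Γ)`: the maximal length of the intersection of `Γ` with a rational normal curve
(of degree `n`) in `ℙ^n`. -/
def rhoInv (I : Ideal (MvPolynomial (Fin (n+1)) K)) : ℕ :=
  sSup {e : ℕ | ∃ J : Ideal (MvPolynomial (Fin (n+1)) K),
    IsRNC n J ∧ e = schemeDeg (interIdeal I J)}

/-- The (saturated homogeneous) vanishing ideal of a point of `ℙ^n`. -/
def pointIdeal (P : Projectivization K (Fin (n+1) → K)) : Ideal (MvPolynomial (Fin (n+1)) K) :=
  ⨅ c : K, RingHom.ker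
    (MvPolynomial.eval (c • P.rep) : MvPolynomial (Fin (n+1)) K →+* K)

/-- The vanishing ideal of a finite set of points of `ℙ^n`. -/
def idealOfFinset (S : Finset (Projectivization K (Fin (n+1) → K))) :
    Ideal (MvPolynomial (Fin (n+1)) K) :=
  ⨅ P ∈ S, pointIdeal P

/-- A finite set of points of `ℙ^n` is in uniform position if every subset `Y` has
Hilbert function `h_Y(ℓ) = min {|Y|, h_Γ(ℓ)}`. -/
def UniformPosition (S : Finset (Projectivization K (Fin (n+1) → K))) : Prop :=
  ∀ Y ⊆ S, ∀ ℓ : ℕ, hilbF (idealOfFinset Y) ℓ = min Y.card (hilbF (idealOfFinset S) ℓ)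

end

section FiniteAlgebra

open Module

variable {K A : Type*} [Field K] [CommRing A] [Algebra K A] [FiniteDimensional K A]

lemma finrank_ideal_add_finrank_quotient (J : Ideal A) :
    finrank K (J.restrictScalars K) + finrank K (A ⧸ J) = finrank K A := by
  have h := (Ideal.Quotient.mkₐ K J).toLinearMap.finrank_range_add_finrank_ker
  have hk : (Ideal.Quotient.mkₐ K J).toLinearMap.ker = J.restrictScalars K := by
    ext x; simp [Ideal.Quotient.eq_zero_iff_mem]
  have hr : (Ideal.Quotient.mkₐ K J).toLinearMap.range = ⊤ :=
    LinearMap.range_eq_top.2 (Ideal.Quotient.mkₐ_surjective K J)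
  rw [hk, hr, finrank_top] at h
  omega

lemma finrank_quotient_anti {J J' : Ideal A} (h : J ≤ J') :
    finrank K (A ⧸ J') ≤ finrank K (A ⧸ J) := by
  have h1 := finrank_ideal_add_finrank_quotient (K := K) J
  have h2 := finrank_ideal_add_finrank_quotient (K := K) J'
  have : finrank K (J.restrictScalars K) ≤ finrank K (J'.restrictScalars K) :=
    Submodule.finrank_mono (Submodule.restrictScalars_mono K h)
  omega

lemma finrank_quotient_le_one_of_maximal [IsAlgClosed K] (m : Ideal A) [m.IsMaximal] :
    finrank K (A ⧸ m) = 1 := by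
  let := Ideal.Quotient.field m
  have hb : Function.Bijective (algebraMap K (A ⧸ m)) :=
    IsAlgClosed.algebraMap_bijective_of_isIntegral
  exact (LinearEquiv.ofBijective (Algebra.linearMap K (A ⧸ m)) hb).finrank_eq.symm.trans
    (finrank_self K)

/-- The colon ideal `(J : v)`. -/
def colonElem (J : Ideal A) (v : A) : Ideal A := Submodule.comap (LinearMap.mulLeft A v) J

lemma mem_colonElem {J : Ideal A} {v x : A} : x ∈ colonElem J v ↔ v * x ∈ J := Iff.rfl

/-- The residual exact sequence of `J` with respect to `v`. -/
lemma finrank_quotient_residual (J : Ideal A) (v : A) :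
    finrank K (A ⧸ J) = finrank K (A ⧸ colonElem J v) +
      finrank K (A ⧸ J ⊔ Ideal.span {v}) := by
  let f : A →ₗ[K] A ⧸ J := (Ideal.Quotient.mkₐ K J).toLinearMap ∘ₗ LinearMap.mulLeft K v
  let g : (A ⧸ J) →ₗ[K] (A ⧸ J ⊔ Ideal.span {v}) :=
    (Ideal.Quotient.factorₐ K (le_sup_left : J ≤ J ⊔ Ideal.span {v})).toLinearMap
  have hg : g.range = ⊤ := LinearMap.range_eq_top.2
    (Ideal.Quotient.factor_surjective (le_sup_left : J ≤ J ⊔ Ideal.span {v}))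
  have hfg : g.ker = f.range := by
    ext x
    obtain ⟨a, rfl⟩ := Ideal.Quotient.mk_surjective x
    have : g (Ideal.Quotient.mk J a) = Ideal.Quotient.mk _ a := rfl
    rw [LinearMap.mem_ker, this, Ideal.Quotient.eq_zero_iff_mem, sup_comm,
      Ideal.mem_span_singleton_sup]
    simp only [f, LinearMap.mem_range, LinearMap.comp_apply, LinearMap.mulLeft_apply,
      AlgHom.toLinearMap_apply, Ideal.Quotient.mkₐ_eq_mk, Ideal.Quotient.eq]
    constructor
    · rintro ⟨c, b, hb, rfl⟩
      exact ⟨c, by convert J.neg_mem hb using 1; ring⟩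
    · rintro ⟨c, hc⟩
      exact ⟨c, a - v * c, by convert J.neg_mem hc using 1; ring, by ring⟩
  have hf : f.ker = (colonElem J v).restrictScalars K := by
    ext x
    exact Ideal.Quotient.eq_zero_iff_mem (I := J) (a := v * x)
  have h1 := f.finrank_range_add_finrank_ker
  have h2 := g.finrank_range_add_finrank_ker
  have h3 := finrank_ideal_add_finrank_quotient (K := K)
    (colonElem J v)
  rw [hg, finrank_top, hfg] at h2
  rw [hf] at h1
  omega

lemma exists_ideal_between [IsAlgClosed K] {J₁ J₂ : Ideal A} (h : J₁ ≤ J₂) {m : ℕ}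
    (h2 : finrank K (A ⧸ J₂) ≤ m) (h1 : m ≤ finrank K (A ⧸ J₁)) :
    ∃ J, J₁ ≤ J ∧ J ≤ J₂ ∧ finrank K (A ⧸ J) = m := by
  induction m, h2 using Nat.le_induction with
  | base => exact ⟨J₂, h, le_rfl, rfl⟩
  | succ m hm ih =>
    obtain ⟨J, hJ1, hJ2, hJ⟩ := ih (by omega)
    have : IsNoetherianRing A := isNoetherian_of_tower K inferInstance
    have hlt : J₁ < J := lt_of_le_of_ne hJ1 (by rintro rfl; omega)
    obtain ⟨J', hJ', hcov⟩ := exists_le_covBy_of_lt hlt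
    refine ⟨J', hJ', hcov.le.trans hJ2, ?_⟩
    obtain ⟨v, hvJ, hv⟩ := Set.exists_of_ssubset hcov.lt
    have hsup : J' ⊔ Ideal.span {v} = J := by
      refine (hcov.eq_or_eq le_sup_left (sup_le hcov.le ?_)).resolve_left ?_
      · rwa [Ideal.span_singleton_le_iff_mem]
      · intro h
        exact hv (h ▸ (le_sup_right : _ ≤ J' ⊔ Ideal.span {v}) (Ideal.mem_span_singleton_self v))
    have hmax : (colonElem J' v).IsMaximal := by
      refine Ideal.isMaximal_iff.2 ⟨by rwa [mem_colonElem, mul_one], fun I x hI hx hxI => ?_⟩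
      have hvx : J' ⊔ Ideal.span {v * x} = J := by
        refine (hcov.eq_or_eq le_sup_left (sup_le hcov.le ?_)).resolve_left ?_
        · rw [Ideal.span_singleton_le_iff_mem]
          exact J.mul_mem_right x hvJ
        · intro h
          exact hx (h ▸ (le_sup_right : _ ≤ J' ⊔ Ideal.span {v * x})
            (Ideal.mem_span_singleton_self _))
      rw [← hvx, sup_comm] at hvJ
      obtain ⟨b, j, hj, hbj⟩ := Ideal.mem_span_singleton_sup.1 hvJ
      have h1 : 1 - b * x ∈ I := hI (mem_colonElem.2 (by
        convert hj using 1; linear_combination -hbj))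
      simpa using I.add_mem h1 (I.mul_mem_left b hxI)
    rw [finrank_quotient_residual (K := K) J' v, hsup, finrank_quotient_le_one_of_maximal, hJ]
    omega

/-- A filtration behaving like the polynomial functions of degree at most `m` on a finite
scheme in linearly general position in `ℙ^n`. -/
structure IsLinGenPosFiltration (n : ℕ) (U : ℕ → Submodule K A) : Prop where
  one_mem : 1 ∈ U 0
  mono : Monotone U
  mul_mem : ∀ {i j : ℕ} {a b : A}, a ∈ U i → b ∈ U j → a * b ∈ U (i + j)
  finrank_one : finrank K (U 1) = n + 1
  section_le : ∀ v ∈ U 1, v ≠ 0 → finrank K (A ⧸ Ideal.span {v}) ≤ n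

lemma exists_ne_zero_mem_of_finrank_lt (V : Submodule K A) (J : Ideal A)
    (h : finrank K (A ⧸ J) < finrank K V) : ∃ v ∈ V, v ∈ J ∧ v ≠ 0 := by
  have h1 := finrank_ideal_add_finrank_quotient (K := K) J
  have h2 := Submodule.finrank_sup_add_finrank_inf_eq V (J.restrictScalars K)
  have h3 := Submodule.finrank_le (V ⊔ J.restrictScalars K)
  have h4 : V ⊓ J.restrictScalars K ≠ ⊥ := by
    intro h0
    rw [h0, finrank_bot] at h2
    omega
  obtain ⟨v, hv, hv0⟩ := Submodule.exists_mem_ne_zero_of_ne_bot h4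
  exact ⟨v, hv.1, hv.2, hv0⟩

lemma exists_maximal_not_sup_eq_top {V : Submodule K A} {J : Ideal A}
    (h : V ⊔ J.restrictScalars K ≠ ⊤) :
    ∃ J', J ≤ J' ∧ V ⊔ J'.restrictScalars K ≠ ⊤ ∧
      ∀ v ∉ J', V ⊔ (J' ⊔ Ideal.span {v}).restrictScalars K = ⊤ := by
  have : IsNoetherianRing A := isNoetherian_of_tower K inferInstance
  obtain ⟨J', ⟨hJ, hJ'⟩, hmax⟩ := WellFounded.has_min (wellFounded_gt (α := Ideal A))
    {J' | J ≤ J' ∧ V ⊔ J'.restrictScalars K ≠ ⊤} ⟨J, le_rfl, h⟩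
  refine ⟨J', hJ, hJ', fun v hv => ?_⟩
  by_contra hne
  refine hmax _ ⟨hJ.trans le_sup_left, hne⟩ (lt_of_le_of_ne le_sup_left fun h => hv ?_)
  rw [h]
  exact (le_sup_right : _ ≤ J' ⊔ Ideal.span {v}) (Ideal.mem_span_singleton_self v)

/-- The ideal of the `2 × 2` minors of the matrix with rows `y₀, …, yₙ₋₁` and `y₁, …, yₙ`. -/
def minorIdeal {B : Type*} [CommRing B] {n : ℕ} (y : Fin (n + 1) → B) : Ideal B :=
  Ideal.span (Set.range fun p : Fin n × Fin n =>
    y p.1.succ * y p.2.castSucc - y p.1.castSucc * y p.2.succ)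

lemma minorIdeal_le_iff {B : Type*} [CommRing B] {n : ℕ} {y : Fin (n + 1) → B} {J : Ideal B} :
    minorIdeal y ≤ J ↔
      ∀ i j : Fin n, y i.succ * y j.castSucc - y i.castSucc * y j.succ ∈ J := by
  rw [minorIdeal, Ideal.span_le, Set.range_subset_iff, Prod.forall]
  rfl

lemma map_minorIdeal {B B' : Type*} [CommRing B] [CommRing B'] {n : ℕ} (f : B →+* B')
    (y : Fin (n + 1) → B) : (minorIdeal y).map f = minorIdeal (f ∘ y) := by
  rw [minorIdeal, minorIdeal, Ideal.map_span, ← Set.range_comp]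
  congr 2
  ext p
  simp

namespace IsLinGenPosFiltration

variable {n : ℕ} {U : ℕ → Submodule K A}

omit [FiniteDimensional K A] in
lemma colonElem_sup_ne_top (hU : IsLinGenPosFiltration n U) {s e : ℕ} {J : Ideal A} {v : A}
    (hv : v ∈ U e) (h : U (s + e) ⊔ J.restrictScalars K ≠ ⊤)
    (h' : U (s + e) ⊔ (J ⊔ Ideal.span {v}).restrictScalars K = ⊤) :
    U s ⊔ (colonElem J v).restrictScalars K ≠ ⊤ := by
  intro htop
  apply h
  rw [eq_top_iff, ← h']
  refine sup_le le_sup_left ?_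
  intro x hx
  rw [Submodule.restrictScalars_mem, sup_comm, Ideal.mem_span_singleton_sup] at hx
  obtain ⟨a, j, hj, rfl⟩ := hx
  have ha : a ∈ U s ⊔ (colonElem J v).restrictScalars K := htop ▸ Submodule.mem_top
  obtain ⟨u, hu, c, hc, rfl⟩ := Submodule.mem_sup.1 ha
  have hc' : v * c ∈ J := hc
  rw [show (u + c) * v + j = u * v + (v * c + j) by ring]
  exact Submodule.add_mem_sup (hU.mul_mem hu hv) (J.add_mem hc' hj)

variable [IsAlgClosed K]

lemma one_sup_eq_top (hU : IsLinGenPosFiltration n U) (hA : n + 1 ≤ finrank K A)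
    {J : Ideal A} (hJ : finrank K (A ⧸ J) ≤ n + 1) : U 1 ⊔ J.restrictScalars K = ⊤ := by
  have hbot : finrank K (A ⧸ (⊥ : Ideal A)) = finrank K A :=
    (AlgEquiv.quotientBot K A).toLinearEquiv.finrank_eq
  obtain ⟨J', -, hJ', hc⟩ := exists_ideal_between (K := K) (bot_le : ⊥ ≤ J) hJ (by omega)
  have hinf : U 1 ⊓ J'.restrictScalars K = ⊥ := by
    rw [Submodule.eq_bot_iff]
    rintro v ⟨hv1, hv2⟩
    by_contra hv0
    have h1 := hU.section_le v hv1 hv0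
    have h2 := finrank_quotient_anti (K := K) (J := Ideal.span {v}) (J' := J')
      (by rwa [Ideal.span_singleton_le_iff_mem])
    omega
  have h1 := Submodule.finrank_sup_add_finrank_inf_eq (U 1) (J'.restrictScalars K)
  have h2 := finrank_ideal_add_finrank_quotient (K := K) J'
  rw [hinf, finrank_bot, hU.finrank_one] at h1
  have h3 : U 1 ⊔ J'.restrictScalars K = ⊤ := Submodule.eq_top_of_finrank_eq (by omega)
  rw [eq_top_iff, ← h3]
  exact sup_le_sup_left (Submodule.restrictScalars_mono K hJ') _

/-- A scheme in linearly general position failing to impose independent conditions on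
forms of degree `k` has length at least `n * k + 2`. -/
lemma le_finrank_quotient (hU : IsLinGenPosFiltration n U) (hA : n + 1 ≤ finrank K A)
    {k : ℕ} {J : Ideal A} (h : U k ⊔ J.restrictScalars K ≠ ⊤) :
    n * k + 2 ≤ finrank K (A ⧸ J) := by
  induction k generalizing J with
  | zero =>
    by_contra hlt
    apply h
    have h1 := finrank_ideal_add_finrank_quotient (K := K) J
    by_cases hone : (1 : A) ∈ J
    · rw [(Ideal.eq_top_iff_one J).2 hone]
      simp
    · have hlt' : J.restrictScalars K < U 0 ⊔ J.restrictScalars K :=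
        lt_of_le_of_ne le_sup_right fun he => hone (by
          have : (1 : A) ∈ U 0 ⊔ J.restrictScalars K := Submodule.mem_sup_left hU.one_mem
          rwa [← he] at this)
      have h2 := Submodule.finrank_lt_finrank_of_lt hlt'
      have h3 := Submodule.finrank_le (U 0 ⊔ J.restrictScalars K)
      exact Submodule.eq_top_of_finrank_eq (by omega)
  | succ k ih =>
    obtain ⟨J', hJJ', hJ', hmax⟩ := exists_maximal_not_sup_eq_top h
    refine le_trans ?_ (finrank_quotient_anti hJJ')
    have hbig : n + 1 < finrank K (A ⧸ J') := by
      by_contra hle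
      apply hJ'
      rw [eq_top_iff, ← hU.one_sup_eq_top hA (not_lt.1 hle)]
      exact sup_le_sup_right (hU.mono (by omega)) _
    obtain ⟨L, hL, -, hLn⟩ := exists_ideal_between (K := K) (le_top : J' ≤ ⊤) (m := n)
      (by simp [finrank_zero_of_subsingleton]) (by omega)
    obtain ⟨v, hvU, hvL, hv0⟩ := exists_ne_zero_mem_of_finrank_lt (U 1) L
      (by rw [hLn, hU.finrank_one]; omega)
    have hvJ : v ∉ J' := fun hmem => by
      have h1 := hU.section_le v hvU hv0
      have h2 := finrank_quotient_anti (K := K) (J := Ideal.span {v}) (J' := J')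
        (by rwa [Ideal.span_singleton_le_iff_mem])
      omega
    have h1 := ih (hU.colonElem_sup_ne_top hvU hJ' (hmax v hvJ))
    have h2 := finrank_quotient_anti (K := K) (J := J' ⊔ Ideal.span {v}) (J' := L)
      (sup_le hL (by rwa [Ideal.span_singleton_le_iff_mem]))
    rw [finrank_quotient_residual J' v, mul_add]
    omega

omit [IsAlgClosed K] in
lemma eq_zero_of_mul_eq_zero (hU : IsLinGenPosFiltration n U) (hA : 2 * n + 1 ≤ finrank K A)
    {c v : A} (hc : c ∈ U 1) (hc0 : c ≠ 0) (hv : v ∈ U 1) (h : c * v = 0) : v = 0 := by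
  by_contra hv0
  have h0 : finrank K (A ⧸ (⊥ : Ideal A)) = finrank K A :=
    (AlgEquiv.quotientBot K A).toLinearEquiv.finrank_eq
  have h1 := finrank_quotient_residual (K := K) ⊥ c
  have h2 := hU.section_le c hc hc0
  have h3 := hU.section_le v hv hv0
  have h4 := finrank_quotient_anti (K := K) (J := Ideal.span {v}) (J' := colonElem ⊥ c)
    (by rw [Ideal.span_singleton_le_iff_mem, mem_colonElem, h]; exact zero_mem _)
  rw [bot_sup_eq] at h1
  omega

/-- A scheme in linearly general position of length at least `3 * n + 1` imposing at most
`2 * n + 1` conditions on quadrics lies on a rational normal curve: there are coordinates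
satisfying the minors of the catalecticant matrix. -/
lemma exists_catalecticant (hU : IsLinGenPosFiltration n U) (hn : 1 ≤ n)
    (hA : 3 * n + 1 ≤ finrank K A) (h2 : finrank K (U 2) ≤ 2 * n + 1) :
    ∃ y : Fin (n + 1) → A, (∀ i, y i ∈ U 1) ∧ LinearIndependent K y ∧
      ∀ i j : Fin n, y i.succ * y j.castSucc = y i.castSucc * y j.succ := by
  have hbot : finrank K (A ⧸ (⊥ : Ideal A)) = finrank K A :=
    (AlgEquiv.quotientBot K A).toLinearEquiv.finrank_eq
  obtain ⟨J, -, -, hJ⟩ := exists_ideal_between (K := K) (le_top : (⊥ : Ideal A) ≤ ⊤)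
    (m := n - 1) (by simp [finrank_zero_of_subsingleton]) (by omega)
  have hJd := finrank_ideal_add_finrank_quotient (K := K) J
  have hsup := hU.one_sup_eq_top (by omega) (J := J) (by omega)
  have hsup2 : U 2 ⊔ J.restrictScalars K = ⊤ := by
    rw [eq_top_iff, ← hsup]
    exact sup_le_sup_right (hU.mono (by omega)) _
  have hdim1 := Submodule.finrank_sup_add_finrank_inf_eq (U 1) (J.restrictScalars K)
  have hdim2 := Submodule.finrank_sup_add_finrank_inf_eq (U 2) (J.restrictScalars K)
  rw [hsup, finrank_top, hU.finrank_one] at hdim1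
  rw [hsup2, finrank_top] at hdim2
  set W := U 2 ⊓ J.restrictScalars K
  let B := finBasisOfFinrankEq K ↥(U 1 ⊓ J.restrictScalars K) (n := 2) (by omega)
  obtain ⟨a, ha⟩ : ∃ a, a = (B 0 : A) := ⟨_, rfl⟩
  obtain ⟨b, hb⟩ : ∃ b, b = (B 1 : A) := ⟨_, rfl⟩
  have haU : a ∈ U 1 := ha ▸ (B 0).2.1
  have hbU : b ∈ U 1 := hb ▸ (B 1).2.1
  have haJ : a ∈ J := ha ▸ (B 0).2.2
  have hbJ : b ∈ J := hb ▸ (B 1).2.2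
  have hb0 : b ≠ 0 := by
    rw [hb]
    exact fun h => B.ne_zero 1 (Subtype.ext h)
  have hab (c : K) : a - c • b ≠ 0 := by
    intro h
    have h1 : B 0 - c • B 1 = 0 := Subtype.ext (by simpa [ha, hb] using h)
    have h3 := congrArg (fun x => B.repr x 0) h1
    simp at h3
  have hmW {c : A} (hcU : c ∈ U 1) (hcJ : c ∈ J) : ∀ x ∈ U 1, LinearMap.mulLeft K c x ∈ W :=
    fun x hx => ⟨hU.mul_mem hcU hx, J.mul_mem_right x hcJ⟩
  let Φ : (Fin (n + 1) → U 1) →ₗ[K] (Fin n → W) := LinearMap.pi fun i =>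
    (LinearMap.mulLeft K a).restrict (hmW haU haJ) ∘ₗ LinearMap.proj i.castSucc -
      (LinearMap.mulLeft K b).restrict (hmW hbU hbJ) ∘ₗ LinearMap.proj i.succ
  have hΦ : Φ.ker ≠ ⊥ := by
    apply LinearMap.ker_ne_bot_of_finrank_lt
    rw [finrank_pi_fintype, finrank_pi_fintype]
    simp only [hU.finrank_one, Finset.sum_const, Finset.card_univ, Fintype.card_fin, smul_eq_mul]
    have : finrank K W ≤ n + 2 := by omega
    nlinarith
  obtain ⟨y, hy, hy0⟩ := Submodule.exists_mem_ne_zero_of_ne_bot hΦ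
  have hrec (i : Fin n) : a * y i.castSucc = b * y i.succ := by
    have h1 := congrArg (fun w : W => (w : A)) (congrFun (LinearMap.mem_ker.1 hy) i)
    simpa [Φ, sub_eq_zero] using h1
  have hcancel {c v : A} (hc : c ∈ U 1) (hc0 : c ≠ 0) (hv : v ∈ U 1) (h : c * v = 0) : v = 0 :=
    hU.eq_zero_of_mul_eq_zero (by omega) hc hc0 hv h
  have hy00 : (y 0 : A) ≠ 0 := by
    intro h
    apply hy0
    funext i
    refine Subtype.ext ?_
    induction i using Fin.induction with
    | zero => exact h
    | succ i ih =>
      refine hcancel hbU hb0 (y i.succ).2 ?_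
      rw [← hrec, ih]
      simp
  let E (P : Polynomial K) : A := ∑ i : Fin (n + 1), P.coeff i • (y i : A)
  have hEU (P : Polynomial K) : E P ∈ U 1 :=
    Submodule.sum_mem _ fun i _ => Submodule.smul_mem _ _ (y i).2
  have hE (m : ℕ) (hm : m ≤ n) (P : Polynomial K) (hP : P.natDegree ≤ m) (h : E P = 0) :
      P = 0 := by
    induction m generalizing P with
    | zero =>
      rw [Polynomial.eq_C_of_natDegree_le_zero hP] at h ⊢
      simp only [E, Fin.sum_univ_succ] at h
      simp only [Fin.val_zero, Polynomial.coeff_C_zero, Fin.val_succ,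
        Polynomial.coeff_C_succ, zero_smul, Finset.sum_const_zero, add_zero] at h
      rw [(smul_eq_zero.1 h).resolve_right hy00, map_zero]
    | succ m ih =>
      by_cases hdeg : P.natDegree ≤ m
      · exact ih (by omega) P hdeg h
      · have hne : P.degree ≠ 0 := fun h0 => hdeg (by
          have : P.natDegree = 0 := Polynomial.natDegree_eq_of_degree_eq_some h0
          omega)
        obtain ⟨c, hc⟩ := IsAlgClosed.exists_root P hne
        obtain ⟨Q, rfl⟩ := Polynomial.dvd_iff_isRoot.2 hc
        by_cases hQ : Q = 0
        · simp [hQ]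
        rw [Polynomial.natDegree_mul (Polynomial.X_sub_C_ne_zero c) hQ,
          Polynomial.natDegree_X_sub_C] at hP
        have hQn : Q.coeff n = 0 := Polynomial.coeff_eq_zero_of_natDegree_lt (by omega)
        have h3 : (a - c • b) * E Q = b * E ((Polynomial.X - Polynomial.C c) * Q) := by
          have e1 : E ((Polynomial.X - Polynomial.C c) * Q) =
              (∑ i : Fin n, Q.coeff i • (y i.succ : A)) - c • E Q := by
            simp only [E, sub_mul, Polynomial.coeff_sub, sub_smul, Finset.sum_sub_distrib,
              Polynomial.coeff_C_mul, Finset.smul_sum, mul_smul]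
            congr 1
            rw [Fin.sum_univ_succ]
            simp
          have e2 : a * E Q = b * ∑ i : Fin n, Q.coeff i • (y i.succ : A) := by
            simp only [E]
            rw [Fin.sum_univ_castSucc]
            simp only [Fin.val_last, hQn, zero_smul, add_zero, Finset.mul_sum,
              mul_smul_comm, hrec, Fin.val_castSucc]
          rw [e1, mul_sub, ← e2, sub_mul, smul_mul_assoc, mul_smul_comm]
        rw [h, mul_zero] at h3
        exact absurd (ih (by omega) Q (by omega) (hcancel
          (Submodule.sub_mem _ haU (Submodule.smul_mem _ c hbU)) (hab c) (hEU Q) h3)) hQ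
  refine ⟨fun i => y i, fun i => (y i).2, ?_, fun i j => ?_⟩
  · rw [Fintype.linearIndependent_iff]
    intro g hg i
    have h0 := hE n le_rfl (Polynomial.ofFn (n + 1) g)
      (Nat.lt_succ_iff.1 (Polynomial.ofFn_natDegree_lt (by omega) g))
      (by
        rw [← hg]
        exact Finset.sum_congr rfl fun j _ => by
          rw [Polynomial.ofFn_coeff_eq_val_of_lt g j.2])
    have h1 := Polynomial.ofFn_coeff_eq_val_of_lt g i.2
    rw [h0] at h1
    simpa using h1.symm
  · have hres := finrank_quotient_residual (K := K) ⊥ b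
    rw [bot_sup_eq] at hres
    have hbs := hU.section_le b hbU hb0
    obtain ⟨L, hL, -, hLd⟩ := exists_ideal_between (K := K)
      (le_top : colonElem ⊥ b ≤ ⊤) (m := 2 * n + 1)
      (by simp [finrank_zero_of_subsingleton]) (by omega)
    have hLtop : U 2 ⊔ L.restrictScalars K = ⊤ := by
      by_contra hne
      have := hU.le_finrank_quotient (by omega) hne
      omega
    have hd1 := Submodule.finrank_sup_add_finrank_inf_eq (U 2) (L.restrictScalars K)
    have hd2 := finrank_ideal_add_finrank_quotient (K := K) L
    rw [hLtop, finrank_top] at hd1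
    have hinf : U 2 ⊓ L.restrictScalars K = ⊥ := Submodule.finrank_eq_zero.1 (by omega)
    rw [← sub_eq_zero, ← Submodule.mem_bot K, ← hinf]
    refine ⟨Submodule.sub_mem _ (hU.mul_mem (y _).2 (y _).2) (hU.mul_mem (y _).2 (y _).2),
      hL (mem_colonElem.2 ?_)⟩
    rw [Ideal.mem_bot]
    linear_combination (-(y j.castSucc : A)) * hrec i + (y i.castSucc : A) * hrec j

omit [IsAlgClosed K] in
lemma quotient (hU : IsLinGenPosFiltration n U) {J : Ideal A}
    (hJ : n + 1 ≤ finrank K (A ⧸ J)) :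
    IsLinGenPosFiltration n fun i => (U i).map (Ideal.Quotient.mkₐ K J).toLinearMap where
  one_mem := ⟨1, hU.one_mem, map_one (Ideal.Quotient.mkₐ K J)⟩
  mono _ _ h := Submodule.map_mono (hU.mono h)
  mul_mem := by
    rintro i j _ _ ⟨a, ha, rfl⟩ ⟨b, hb, rfl⟩
    exact ⟨a * b, hU.mul_mem ha hb, map_mul (Ideal.Quotient.mkₐ K J) a b⟩
  finrank_one := by
    rw [← LinearMap.range_domRestrict, LinearMap.finrank_range_of_inj, hU.finrank_one]
    rw [← LinearMap.ker_eq_bot, LinearMap.ker_eq_bot']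
    intro v hv
    by_contra hv0
    have h1 := hU.section_le v v.2 (fun h => hv0 (Subtype.ext h))
    have h2 := finrank_quotient_anti (K := K) (J := Ideal.span {(v : A)}) (J' := J)
      (by rw [Ideal.span_singleton_le_iff_mem]; exact Ideal.Quotient.eq_zero_iff_mem.1 hv)
    omega
  section_le := by
    rintro _ ⟨v, hv, rfl⟩ hv0
    refine le_trans ?_ (hU.section_le v hv (by rintro rfl; exact hv0 (map_zero _)))
    let g : A →ₐ[K] (A ⧸ J) ⧸ Ideal.span {Ideal.Quotient.mk J v} :=
      (Ideal.Quotient.mkₐ K _).comp (Ideal.Quotient.mkₐ K J)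
    have hg : Function.Surjective g :=
      (Ideal.Quotient.mkₐ_surjective K _).comp (Ideal.Quotient.mkₐ_surjective K J)
    have hker : ∀ a ∈ Ideal.span {v}, g a = 0 := by
      intro a ha
      obtain ⟨c, rfl⟩ := Ideal.mem_span_singleton.1 ha
      have : g v = 0 := Ideal.Quotient.eq_zero_iff_mem.2 (Ideal.mem_span_singleton_self _)
      rw [map_mul, this, zero_mul]
    exact LinearMap.finrank_le_finrank_of_surjective
      (f := (Ideal.Quotient.liftₐ (Ideal.span {v}) g hker).toLinearMap)
      (Ideal.Quotient.lift_surjective_of_surjective _ hker hg)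

lemma exists_minorIdeal_le (hU : IsLinGenPosFiltration n U) (hn : 1 ≤ n) {J : Ideal A}
    (hJ : 3 * n + 1 ≤ finrank K (A ⧸ J))
    (h2 : finrank K ((U 2).map (Ideal.Quotient.mkₐ K J).toLinearMap) ≤ 2 * n + 1) :
    ∃ y : Fin (n + 1) → A, (∀ i, y i ∈ U 1) ∧ LinearIndependent K y ∧ minorIdeal y ≤ J := by
  obtain ⟨z, hz, hzi, hzm⟩ := (hU.quotient (by omega)).exists_catalecticant hn hJ h2
  choose y hy hyz using hz
  obtain rfl : z = (Ideal.Quotient.mkₐ K J).toLinearMap ∘ y := funext fun i => (hyz i).symm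
  refine ⟨y, hy, hzi.of_comp _, minorIdeal_le_iff.2 fun i j => ?_⟩
  rw [← Ideal.Quotient.eq_zero_iff_mem, map_sub, map_mul, map_mul, sub_eq_zero]
  exact hzm i j

omit [IsAlgClosed K] in
lemma exists_mem_notMem_of_finrank_lt (V : Submodule K A) {J L : Ideal A} (hJL : J ≤ L)
    (h : finrank K (A ⧸ L) < finrank K (V.map (Ideal.Quotient.mkₐ K J).toLinearMap)) :
    ∃ q ∈ V, q ∈ L ∧ q ∉ J := by
  have e := (DoubleQuot.quotQuotEquivQuotOfLEₐ K hJL).toLinearEquiv.finrank_eq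
  obtain ⟨_, ⟨q, hq, rfl⟩, hqL, hq0⟩ := exists_ne_zero_mem_of_finrank_lt
    (V.map (Ideal.Quotient.mkₐ K J).toLinearMap) (L.map (Ideal.Quotient.mkₐ K J))
    (by rwa [e])
  refine ⟨q, hq, ?_, fun h => hq0 (Ideal.Quotient.eq_zero_iff_mem.2 h)⟩
  exact (Ideal.mem_quotient_iff_mem hJL).1 hqL

lemma exists_secant_minorIdeal (hU : IsLinGenPosFiltration n U) (hn : 1 ≤ n)
    (hA : n + 1 ≤ finrank K A) {s : ℕ} {J : Ideal A} (h : U s ⊔ J.restrictScalars K ≠ ⊤) :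
    ∃ j, 2 * j ≤ s ∧ n * s + j + 2 ≤ finrank K (A ⧸ J) ∧
      (s ≤ 2 * j + 3 ∨ ∃ y : Fin (n + 1) → A, (∀ i, y i ∈ U 1) ∧ LinearIndependent K y ∧
        n * (s - 2 * j) + 2 ≤ finrank K (A ⧸ J ⊔ minorIdeal y)) := by
  induction s using Nat.strong_induction_on generalizing J with
  | _ s ih =>
  by_cases hs : s ≤ 3
  · exact ⟨0, by omega, by simpa using hU.le_finrank_quotient hA h, Or.inl (by omega)⟩
  obtain ⟨J', hJJ', hJ', hmax⟩ := exists_maximal_not_sup_eq_top h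
  have hanti := finrank_quotient_anti (K := K) hJJ'
  have hlow := hU.le_finrank_quotient hA hJ'
  have hs4 : n * 4 ≤ n * s := Nat.mul_le_mul_left n (by omega)
  by_cases h2 : finrank K ((U 2).map (Ideal.Quotient.mkₐ K J').toLinearMap) ≤ 2 * n + 1
  · obtain ⟨y, hyU, hyi, hy⟩ := hU.exists_minorIdeal_le hn (by omega) h2
    refine ⟨0, by omega, by omega, Or.inr ⟨y, hyU, hyi, ?_⟩⟩
    refine le_trans ?_ (finrank_quotient_anti (sup_le hJJ' hy))
    simpa using hlow
  · obtain ⟨L, hL, -, hLd⟩ := exists_ideal_between (K := K) (le_top : J' ≤ ⊤)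
      (m := 2 * n + 1) (by simp [finrank_zero_of_subsingleton]) (by omega)
    obtain ⟨q, hqU, hqL, hqJ⟩ := exists_mem_notMem_of_finrank_lt (U 2) hL (by omega)
    obtain ⟨t, rfl⟩ : ∃ t, s = t + 2 := ⟨s - 2, by omega⟩
    obtain ⟨j, hj, hjd, hjC⟩ := ih t (by omega)
      (hU.colonElem_sup_ne_top hqU hJ' (hmax q hqJ))
    have hle : J' ≤ colonElem J' q := fun x hx => J'.mul_mem_left q hx
    have hres := finrank_quotient_residual (K := K) J' q
    have hq := finrank_quotient_anti (K := K) (J := J' ⊔ Ideal.span {q}) (J' := L)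
      (sup_le hL (by rwa [Ideal.span_singleton_le_iff_mem]))
    refine ⟨j + 1, by omega, by rw [mul_add]; omega, ?_⟩
    rcases hjC with hjC | ⟨y, hyU, hyi, hy⟩
    · exact Or.inl (by omega)
    · refine Or.inr ⟨y, hyU, hyi, ?_⟩
      rw [show t + 2 - 2 * (j + 1) = t - 2 * j by omega]
      exact hy.trans (finrank_quotient_anti (sup_le_sup_right (hJJ'.trans hle) _))

/-- If a scheme in linearly general position of small length fails to impose independent
conditions on forms of degree `s`, then so does its intersection with some rational normal
curve. -/
lemma exists_minorIdeal_sup_ne_top (hU : IsLinGenPosFiltration n U) (hn : 1 ≤ n)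
    (hA : n + 1 ≤ finrank K A) {s : ℕ} (h : U s ≠ ⊤)
    (hd : (2 * n + 2) * finrank K A + n * (2 * n + 3) ≤ n * (2 * n + 3) * s + (2 * n + 2)) :
    ∃ y : Fin (n + 1) → A, (∀ i, y i ∈ U 1) ∧ LinearIndependent K y ∧
      U s ⊔ (minorIdeal y).restrictScalars K ≠ ⊤ := by
  obtain ⟨J, -, hJ, hmax⟩ := exists_maximal_not_sup_eq_top (V := U s) (J := (⊥ : Ideal A))
    (by simpa using h)
  have hJA : finrank K (A ⧸ J) ≤ finrank K A := by
    have := finrank_ideal_add_finrank_quotient (K := K) J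
    omega
  obtain ⟨j, hj, hjd, hjC⟩ := hU.exists_secant_minorIdeal hn hA hJ
  rcases hjC with hjC | ⟨y, hyU, hyi, hy⟩
  · nlinarith
  refine ⟨y, hyU, hyi, fun htop => ?_⟩
  have hyJ : ¬ minorIdeal y ≤ J := fun hle => hJ (by
    rw [eq_top_iff, ← htop]
    exact sup_le_sup_left (Submodule.restrictScalars_mono K hle) _)
  have hyJ' := hyJ
  rw [minorIdeal_le_iff] at hyJ'
  push Not at hyJ'
  obtain ⟨i, k, hq⟩ := hyJ'
  set q := y i.succ * y k.castSucc - y i.castSucc * y k.succ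
  have hqU : q ∈ U 2 :=
    Submodule.sub_mem _ (hU.mul_mem (hyU _) (hyU _)) (hU.mul_mem (hyU _) (hyU _))
  have hs : 2 ≤ s := by
    by_contra hlt
    have : s = 0 ∨ s = 1 := by omega
    rcases this with rfl | rfl <;> nlinarith
  obtain ⟨t, rfl⟩ : ∃ t, s = t + 2 := ⟨s - 2, by omega⟩
  have h1 := hU.le_finrank_quotient hA (hU.colonElem_sup_ne_top hqU hJ (hmax q hq))
  have h2 := finrank_quotient_residual (K := K) J q
  have h3 := finrank_quotient_anti (K := K) (J := J ⊔ Ideal.span {q}) (J' := J ⊔ minorIdeal y)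
    (sup_le_sup_left (by
      rw [Ideal.span_singleton_le_iff_mem]
      exact minorIdeal_le_iff.1 le_rfl i k) _)
  obtain ⟨u, hu⟩ : ∃ u, t + 2 - 2 * j = u := ⟨_, rfl⟩
  rw [hu] at hy
  have hu' : t + 2 = u + 2 * j := by omega
  have h4 : n * t + 2 + (n * u + 2) ≤ finrank K A := by omega
  have h5 : n * (t + 2) + j + 2 ≤ finrank K A := by omega
  generalize finrank K A = d at *
  have h6 : (2 * n + 1) * d ≥ (n * t + 2 + (n * u + 2)) + 2 * n * (n * (t + 2) + j + 2) := by
    nlinarith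
  have hs' : n * t + n * u + 2 * n * j = 2 * n * t + 2 * n := by
    calc n * t + n * u + 2 * n * j = n * t + n * (u + 2 * j) := by ring
      _ = 2 * n * t + 2 * n := by rw [← hu']; ring
  have h7 := Nat.mul_le_mul_left (2 * n + 2) h6
  have h8 := Nat.mul_le_mul_left (2 * n + 1) hd
  zify at *
  nlinarith

/-- Two subschemes that are large compared with the ambient scheme have a subscheme of
length `2 * n + 1` in common, which imposes independent conditions on quadrics. -/
lemma exists_common_overideal (hU : IsLinGenPosFiltration n U)
    (hA : n + 1 ≤ finrank K A) {s : ℕ}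
    (hd : (2 * n + 2) * finrank K A + n * (2 * n + 3) ≤ n * (2 * n + 3) * s + (2 * n + 2))
    (hs : 5 ≤ s) {J₁ J₂ : Ideal A} (h1 : n * s + 2 ≤ finrank K (A ⧸ J₁))
    (h2 : n * s + 2 ≤ finrank K (A ⧸ J₂)) :
    ∃ L, J₁ ≤ L ∧ J₂ ≤ L ∧ finrank K (A ⧸ L) = 2 * n + 1 ∧
      U 2 ⊔ L.restrictScalars K = ⊤ := by
  have hadd := Submodule.finrank_sup_add_finrank_inf_eq (J₁.restrictScalars K)
    (J₂.restrictScalars K)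
  have e : J₁.restrictScalars K ⊔ J₂.restrictScalars K = (J₁ ⊔ J₂).restrictScalars K :=
    (Submodule.restrictScalars_sup K J₁ J₂).symm
  rw [e] at hadd
  have hd1 := finrank_ideal_add_finrank_quotient (K := K) J₁
  have hd2 := finrank_ideal_add_finrank_quotient (K := K) J₂
  have hd3 := finrank_ideal_add_finrank_quotient (K := K) (J₁ ⊔ J₂)
  have hbig : 2 * n + 1 ≤ finrank K (A ⧸ J₁ ⊔ J₂) := by
    have h3 : 2 * (n * s + 2) ≤ finrank K (A ⧸ J₁ ⊔ J₂) + finrank K A := by omega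
    generalize finrank K A = d at *
    generalize finrank K (A ⧸ J₁ ⊔ J₂) = c at *
    have h4 := Nat.mul_le_mul_left (2 * n + 2) h3
    have h5 : n * 5 ≤ n * s := Nat.mul_le_mul_left n hs
    have h6 : (2 * n + 2) * (2 * n + 1) ≤ (2 * n + 2) * c := by nlinarith
    exact Nat.le_of_mul_le_mul_left h6 (by omega)
  obtain ⟨L, hL, -, hLd⟩ := exists_ideal_between (K := K) (le_top : J₁ ⊔ J₂ ≤ ⊤)
    (m := 2 * n + 1) (by simp [finrank_zero_of_subsingleton]) hbig
  refine ⟨L, le_sup_left.trans hL, le_sup_right.trans hL, hLd, ?_⟩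
  by_contra hne
  have := hU.le_finrank_quotient hA hne
  omega

end IsLinGenPosFiltration

end FiniteAlgebra

section RationalNormalCurve

/-- The common value of the monomials of degree `m` and weight `w` in a sequence `y₀, …, yₙ`
satisfying the minors of the catalecticant matrix. -/
def weightMonomial {B : Type*} [CommRing B] (n : ℕ) (y : ℕ → B) (m w : ℕ) : B :=
  if m = 0 then 1
  else y 0 ^ (m - 1 - min (w / n) (m - 1)) * y (w - n * min (w / n) (m - 1)) *
    y n ^ min (w / n) (m - 1)

section

variable {B : Type*} [CommRing B] {n : ℕ} {y : ℕ → B}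

lemma weightMonomial_eq (hn : 0 < n) (a b r : ℕ) (hr : r ≤ n) :
    weightMonomial n y (a + b + 1) (n * b + r) = y 0 ^ a * y r * y n ^ b := by
  rw [weightMonomial, if_neg (by omega)]
  rcases hr.lt_or_eq with hr | rfl
  · have h1 : (n * b + r) / n = b := by
      rw [Nat.mul_add_div hn, Nat.div_eq_of_lt hr, add_zero]
    rw [h1, show min b (a + b + 1 - 1) = b by omega, show a + b + 1 - 1 - b = a by omega,
      Nat.add_sub_cancel_left]
  · have h1 : (r * b + r) / r = b + 1 := by
      rw [Nat.mul_add_div hn, Nat.div_self hn]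
    rw [h1]
    rcases a with _ | a
    · rw [show min (b + 1) (0 + b + 1 - 1) = b by omega, Nat.add_sub_cancel_left]
      simp
    · rw [show min (b + 1) (a + 1 + b + 1 - 1) = b + 1 by omega,
        show a + 1 + b + 1 - 1 - (b + 1) = a by omega, mul_add_one, Nat.sub_self]
      ring

lemma mul_eq_mul_of_minors (hy : ∀ i < n, ∀ j < n, y (i + 1) * y j = y i * y (j + 1))
    (e : ℕ) {i j : ℕ} (hi : i + e ≤ n) (hj : j + e ≤ n) :
    y (i + e) * y j = y i * y (j + e) := by
  induction e generalizing j with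
  | zero => rfl
  | succ e ih =>
    rw [← add_assoc, hy (i + e) (by omega) j (by omega), ih (by omega) (by omega)]
    congr 2
    omega

lemma mul_weightMonomial (hn : 0 < n)
    (hy : ∀ i < n, ∀ j < n, y (i + 1) * y j = y i * y (j + 1)) {m w i : ℕ} (hi : i ≤ n)
    (hw : w ≤ n * m) : y i * weightMonomial n y m w = weightMonomial n y (m + 1) (w + i) := by
  rcases m with _ | m
  · obtain rfl : w = 0 := by simpa using hw
    simp [weightMonomial]
  · obtain ⟨a, b, r, rfl, rfl, hr⟩ : ∃ a b r, m = a + b ∧ w = n * b + r ∧ r ≤ n := by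
      by_cases hwm : w / n ≤ m
      · exact ⟨m - w / n, w / n, w % n, by omega, (Nat.div_add_mod w n).symm,
          (Nat.mod_lt w hn).le⟩
      · have h1 : n * (m + 1) ≤ w :=
          (Nat.mul_le_mul_left n (by omega)).trans (Nat.mul_div_le w n)
        exact ⟨0, m, n, by omega, by rw [← mul_add_one]; omega, le_rfl⟩
    rw [weightMonomial_eq hn a b r hr]
    by_cases hir : i + r ≤ n
    · have h1 := mul_eq_mul_of_minors hy i (i := 0) (j := r) (by omega) (by omega)
      rw [zero_add] at h1
      rw [show a + b + 1 + 1 = (a + 1) + b + 1 by omega, add_assoc (n * b),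
        weightMonomial_eq hn (a + 1) b (r + i) (by omega)]
      linear_combination (y 0 ^ a * y n ^ b) * h1
    · have h1 := mul_eq_mul_of_minors hy (n - r) (i := i - (n - r)) (j := r)
        (by omega) (by omega)
      rw [show i - (n - r) + (n - r) = i by omega, show r + (n - r) = n by omega] at h1
      have h2 : n * b + r + i = n * (b + 1) + (i - (n - r)) := by
        rw [mul_add_one]; omega
      rw [show a + b + 1 + 1 = a + (b + 1) + 1 by omega, h2,
        weightMonomial_eq hn a (b + 1) _ (by omega)]
      linear_combination (y 0 ^ a * y n ^ b) * h1

end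

variable {K : Type*} [Field K] {n : ℕ}

/-- The binary form `s ^ (n - j) * t ^ j`. -/
noncomputable def binaryMonomial (K : Type*) [Field K] (n j : ℕ) : MvPolynomial (Fin 2) K :=
  X 0 ^ (n - j) * X 1 ^ j

lemma binaryMonomial_mem (j : ℕ) (hj : j ≤ n) :
    binaryMonomial K n j ∈ homogeneousSubmodule (Fin 2) K n := by
  have h := (isHomogeneous_X_pow (R := K) (0 : Fin 2) (n - j)).mul
    (isHomogeneous_X_pow (R := K) (1 : Fin 2) j)
  rwa [Nat.sub_add_cancel hj] at h

lemma span_binaryMonomial (K : Type*) [Field K] (n : ℕ) :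
    Submodule.span K (Set.range fun j : Fin (n + 1) => binaryMonomial K n j) =
      homogeneousSubmodule (Fin 2) K n := by
  apply le_antisymm
  · rw [Submodule.span_le, Set.range_subset_iff]
    exact fun j => binaryMonomial_mem _ (by omega)
  · intro f hf
    rw [f.as_sum]
    refine Submodule.sum_mem _ fun e he => ?_
    have hdeg : e 0 + e 1 = n := by
      have := hf (mem_support_iff.1 he)
      rwa [Finsupp.weight_apply, Finsupp.sum_fintype _ _ (by simp), Fin.sum_univ_two,
        Pi.one_apply, smul_eq_mul, Pi.one_apply, smul_eq_mul, mul_one, mul_one] at this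
    have h1 : monomial e (coeff e f) = coeff e f • binaryMonomial K n (e 1) := by
      rw [binaryMonomial, monomial_eq, Finsupp.prod_fintype _ _ (by simp), Fin.prod_univ_two,
        smul_eq_C_mul, show n - e 1 = e 0 by omega]
    rw [h1]
    exact Submodule.smul_mem _ _ (Submodule.subset_span ⟨⟨e 1, by omega⟩, rfl⟩)

lemma finrank_binaryForms_le (K : Type*) [Field K] (n : ℕ) :
    Module.finrank K (homogeneousSubmodule (Fin 2) K n) ≤ n + 1 := by
  rw [← span_binaryMonomial]
  exact (finrank_range_le_card _).trans (by simp)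

lemma linearIndependent_binaryMonomial (K : Type*) [Field K] (n : ℕ) :
    LinearIndependent K fun j : Fin (n + 1) => binaryMonomial K n j := by
  have h : (fun j : Fin (n + 1) => binaryMonomial K n j) = basisMonomials (Fin 2) K ∘
      fun j : Fin (n + 1) => Finsupp.single 0 (n - j : ℕ) + Finsupp.single 1 (j : ℕ) := by
    ext1 j
    simp [binaryMonomial, X_pow_eq_monomial, monomial_mul]
  rw [h]
  refine (basisMonomials (Fin 2) K).linearIndependent.comp _ fun i j hij => ?_
  have := DFunLike.congr_fun hij 1
  simp at this
  exact Fin.ext this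

/-- Substituting a parametrisation of the rational normal curve factors evaluation at any
sequence satisfying the minors of the catalecticant matrix. -/
lemma aeval_eq_zero_of_minors {B : Type*} [CommRing B] [Algebra K B] (hn : 0 < n)
    {y : Fin (n + 1) → B}
    (hy : ∀ i j : Fin n, y i.succ * y j.castSucc = y i.castSucc * y j.succ)
    {G : MvPolynomial (Fin (n + 1)) K}
    (hG : aeval (fun j : Fin (n + 1) => binaryMonomial K n j) G = 0) : aeval y G = 0 := by
  let Y : ℕ → B := fun i => if h : i < n + 1 then y ⟨i, h⟩ else 0
  have hYy (i : Fin (n + 1)) : Y i = y i := dif_pos i.2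
  have hY : ∀ i < n, ∀ j < n, Y (i + 1) * Y j = Y i * Y (j + 1) := by
    intro i hi j hj
    have h := hy ⟨i, hi⟩ ⟨j, hj⟩
    simp only [← hYy] at h
    exact h
  let κ : MvPolynomial (Fin 2) K →ₗ[K] B := (basisMonomials (Fin 2) K).constr K
    fun e => weightMonomial n Y ((e 0 + e 1) / n) (e 1)
  have hκ (e : Fin 2 →₀ ℕ) (c : K) :
      κ (monomial e c) = c • weightMonomial n Y ((e 0 + e 1) / n) (e 1) := by
    rw [← mul_one c, ← smul_eq_mul, ← smul_monomial, map_smul, smul_eq_mul, mul_one]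
    congr 1
    have := (basisMonomials (Fin 2) K).constr_basis K
      (fun e => weightMonomial n Y ((e 0 + e 1) / n) (e 1)) e
    rwa [coe_basisMonomials] at this
  have key (e : Fin (n + 1) →₀ ℕ) (a : K) :
      ∃ (e' : Fin 2 →₀ ℕ) (m : ℕ) (c : K),
        aeval (fun j : Fin (n + 1) => binaryMonomial K n j) (monomial e a) = monomial e' c ∧
        e' 0 + e' 1 = n * m ∧ aeval y (monomial e a) = c • weightMonomial n Y m (e' 1) := by
    refine induction_on_monomial (motive := fun p => ∃ (e' : Fin 2 →₀ ℕ) (m : ℕ) (c : K),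
        aeval (fun j : Fin (n + 1) => binaryMonomial K n j) p = monomial e' c ∧
        e' 0 + e' 1 = n * m ∧ aeval y p = c • weightMonomial n Y m (e' 1)) ?_ ?_ e a
    · exact fun a => ⟨0, 0, a, by simp [algebraMap_eq], by simp,
        by simp [weightMonomial, Algebra.smul_def]⟩
    · intro p i ih
      obtain ⟨e', m, c, h1, h2, h3⟩ := ih
      refine ⟨e' + (Finsupp.single 0 (n - i : ℕ) + Finsupp.single 1 (i : ℕ)), m + 1, c, ?_, ?_, ?_⟩
      · rw [map_mul, h1, aeval_X, binaryMonomial, X_pow_eq_monomial, X_pow_eq_monomial,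
          monomial_mul, monomial_mul, mul_one, mul_one]
      · simp [mul_add]
        omega
      · rw [map_mul, h3, aeval_X, ← hYy, smul_mul_assoc, mul_comm _ (Y i),
          mul_weightMonomial hn hY (by omega) (by omega)]
        simp
  have hfac (F : MvPolynomial (Fin (n + 1)) K) :
      aeval y F = κ (aeval (fun j : Fin (n + 1) => binaryMonomial K n j) F) := by
    induction F using MvPolynomial.induction_on' with
    | monomial e a =>
      obtain ⟨e', m, c, h1, h2, h3⟩ := key e a
      rw [h1, h3, hκ, h2, Nat.mul_div_cancel_left m hn]
    | add p q hp hq => rw [map_add, map_add, map_add, hp, hq]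
  rw [hfac, hG, map_zero]

/-- The vanishing ideal of the cone over the image of the curve parametrised by `p`. -/
lemma mem_iInf_ker_eval_iff {K : Type*} [Field K] [Infinite K] {n : ℕ}
    {p : Fin (n + 1) → MvPolynomial (Fin 2) K} {F : MvPolynomial (Fin (n + 1)) K} :
    F ∈ (⨅ x : Fin 2 → K, RingHom.ker (MvPolynomial.eval (fun i => MvPolynomial.eval x (p i)) :
        MvPolynomial (Fin (n + 1)) K →+* K)) ↔ aeval p F = 0 := by
  have h (x : Fin 2 → K) : MvPolynomial.eval (fun i => MvPolynomial.eval x (p i)) F =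
      MvPolynomial.eval x (aeval p F) := by
    induction F using MvPolynomial.induction_on with
    | C a => simp [algebraMap_eq]
    | add f g hf hg => simp [hf, hg]
    | mul_X f i hf => simp [hf]
  simp only [Ideal.mem_iInf, RingHom.mem_ker, h]
  refine ⟨fun h => MvPolynomial.funext fun x => by rw [h x, map_zero], fun h x => by
    rw [h, map_zero]⟩

/-- The vanishing ideal of a rational normal curve is generated by the minors of a catalecticant
matrix of linear forms. -/
lemma iInf_ker_eval_eq_minorIdeal {K : Type*} [Field K] [Infinite K] {n : ℕ} (hn : 0 < n)
    {M N : Matrix (Fin (n + 1)) (Fin (n + 1)) K} (h : M * N = 1) :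
    (⨅ x : Fin 2 → K, RingHom.ker (MvPolynomial.eval (fun i => MvPolynomial.eval x
      (∑ j, M i j • binaryMonomial K n j)) : MvPolynomial (Fin (n + 1)) K →+* K)) =
    minorIdeal fun j => ∑ i, N j i • (X i : MvPolynomial (Fin (n + 1)) K) := by
  have h' := mul_eq_one_comm.1 h
  set p := fun i => ∑ j : Fin (n + 1), M i j • binaryMonomial K n j with hp
  set y := fun j => ∑ i, N j i • (X i : MvPolynomial (Fin (n + 1)) K) with hy
  have hyp (j) : aeval p (y j) = binaryMonomial K n j := by
    simp only [hy, hp, map_sum, map_smul, aeval_X, Finset.smul_sum, smul_smul]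
    rw [Finset.sum_comm]
    simp only [← Finset.sum_smul, ← Matrix.mul_apply, h', Matrix.one_apply, ite_smul, one_smul,
      zero_smul, Finset.sum_ite_eq, Finset.mem_univ, if_true]
  have hpy (i) : ∑ j, M i j • y j = X i := by
    simp only [hy, Finset.smul_sum, smul_smul]
    rw [Finset.sum_comm]
    simp only [← Finset.sum_smul, ← Matrix.mul_apply, h, Matrix.one_apply, ite_smul, one_smul,
      zero_smul, Finset.sum_ite_eq, Finset.mem_univ, if_true]
  apply le_antisymm
  · intro F hF
    replace hF := mem_iInf_ker_eval_iff.1 hF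
    set G := aeval (fun i => ∑ j, M i j • (X j : MvPolynomial (Fin (n + 1)) K)) F with hG
    have hG1 : aeval (fun j : Fin (n + 1) => binaryMonomial K n j) G = 0 := by
      rw [hG, ← AlgHom.comp_apply, comp_aeval, ← hF]
      simp
    have hG2 : aeval y G = F := by
      rw [hG, ← AlgHom.comp_apply, comp_aeval]
      simp [hpy]
    let π := Ideal.Quotient.mkₐ K (minorIdeal y)
    have hG3 : aeval (fun i => π (y i)) G = 0 := by
      refine aeval_eq_zero_of_minors hn (fun i j => ?_) hG1
      rw [← map_mul, ← map_mul, ← sub_eq_zero, ← map_sub]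
      exact Ideal.Quotient.eq_zero_iff_mem.2 (minorIdeal_le_iff.1 le_rfl i j)
    rw [← hG2]
    refine Ideal.Quotient.eq_zero_iff_mem.1 (Eq.trans ?_ hG3)
    change π _ = _
    rw [← AlgHom.comp_apply, comp_aeval]
  · rw [minorIdeal_le_iff]
    intro i j
    rw [mem_iInf_ker_eval_iff, map_sub, map_mul, map_mul, hyp, hyp, hyp, hyp]
    simp only [binaryMonomial, Fin.val_succ, Fin.val_castSucc]
    rw [show n - (i : ℕ) = n - (i + 1) + 1 by omega, show n - (j : ℕ) = n - (j + 1) + 1 by omega]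
    ring

lemma finrank_map_eq_of_ker {K V W W' : Type*} [Field K] [AddCommGroup V] [Module K V]
    [AddCommGroup W] [Module K W] [AddCommGroup W'] [Module K W'] (P : Submodule K V)
    (f : V →ₗ[K] W) (g : V →ₗ[K] W') (h : ∀ x ∈ P, f x = 0 ↔ g x = 0) :
    Module.finrank K (P.map f) = Module.finrank K (P.map g) := by
  have hk : (f ∘ₗ P.subtype).ker = (g ∘ₗ P.subtype).ker := by
    ext x
    exact h x x.2
  have e := (f ∘ₗ P.subtype).quotKerEquivRange.symm.trans
    ((Submodule.quotEquivOfEq _ _ hk).trans (g ∘ₗ P.subtype).quotKerEquivRange)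
  rw [LinearMap.range_comp, LinearMap.range_comp, Submodule.range_subtype] at e
  exact e.finrank_eq

instance {σ : Type*} [Finite σ] {K : Type*} [Field K] (m : ℕ) :
    FiniteDimensional K (homogeneousSubmodule σ K m) :=
  Module.Finite.iff_fg.2 (homogeneousSubmodule_fg σ K m)

section

variable {K : Type} [Field K] {n : ℕ} {C : Ideal (MvPolynomial (Fin (n + 1)) K)}

lemma IsRNC.exists_eq_minorIdeal [Infinite K] (hn : 0 < n) (hC : IsRNC n C) :
    ∃ y : Fin (n + 1) → MvPolynomial (Fin (n + 1)) K,
      (∀ i, y i ∈ homogeneousSubmodule (Fin (n + 1)) K 1) ∧ C = minorIdeal y := by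
  obtain ⟨p, hp, hspan, hC⟩ := hC
  have h1 (i) : ∃ c : Fin (n + 1) → K, ∑ j, c j • binaryMonomial K n j = p i := by
    rw [← Submodule.mem_span_range_iff_exists_fun, span_binaryMonomial]
    exact hp i
  have h2 (j : Fin (n + 1)) : ∃ c : Fin (n + 1) → K, ∑ i, c i • p i = binaryMonomial K n j := by
    rw [← Submodule.mem_span_range_iff_exists_fun, hspan]
    exact binaryMonomial_mem _ (by omega)
  choose M hM using h1
  choose N hN using h2
  have hNM : Matrix.of N * Matrix.of M = 1 := by
    ext j k
    have h3 : ∑ k : Fin (n + 1), ((Matrix.of N * Matrix.of M) j k - (1 : Matrix _ _ K) j k) •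
        binaryMonomial K n k = 0 := by
      simp only [sub_smul, Finset.sum_sub_distrib, Matrix.mul_apply, Finset.sum_smul, Matrix.of_apply]
      rw [Finset.sum_comm]
      simp only [← smul_smul, ← Finset.smul_sum, hM, hN, Matrix.one_apply, ite_smul, one_smul,
        zero_smul, Finset.sum_ite_eq, Finset.mem_univ, if_true, sub_self]
    exact sub_eq_zero.1
      (Fintype.linearIndependent_iff.1 (linearIndependent_binaryMonomial K n) _ h3 k)
  refine ⟨fun j => ∑ i, Matrix.of N j i • X i, fun j => ?_, ?_⟩
  · exact Submodule.sum_mem _ fun i _ => Submodule.smul_mem _ _ (isHomogeneous_X K i)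
  · rw [← iInf_ker_eval_eq_minorIdeal hn (mul_eq_one_comm.1 hNM), hC]
    simp only [Matrix.of_apply, hM]

lemma isRNC_minorIdeal [Infinite K] (hn : 0 < n)
    {y : Fin (n + 1) → MvPolynomial (Fin (n + 1)) K}
    (hy : ∀ i, y i ∈ homogeneousSubmodule (Fin (n + 1)) K 1) (hli : LinearIndependent K y) :
    IsRNC n (minorIdeal y) := by
  have h1 (j) : ∃ c : Fin (n + 1) → K, ∑ i, c i • X i = y j := by
    rw [← Submodule.mem_span_range_iff_exists_fun, ← homogeneousSubmodule_one_eq_span_X]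
    exact hy j
  choose N hN using h1
  have hunit : IsUnit (Matrix.of N) := by
    rw [← Matrix.linearIndependent_rows_iff_isUnit, Fintype.linearIndependent_iff]
    intro g hg
    refine Fintype.linearIndependent_iff.1 hli g ?_
    simp only [← hN, Finset.smul_sum, smul_smul]
    rw [Finset.sum_comm]
    refine Finset.sum_eq_zero fun i _ => ?_
    rw [← Finset.sum_smul]
    have := congr_fun hg i
    simp [Matrix.row] at this
    rw [this, zero_smul]
  obtain ⟨M, hM⟩ := hunit.exists_right_inv
  have hM' := mul_eq_one_comm.1 hM
  refine ⟨fun i => ∑ j, M i j • binaryMonomial K n j, fun i => ?_, ?_, ?_⟩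
  · exact Submodule.sum_mem (homogeneousSubmodule (Fin 2) K n) fun j _ =>
      Submodule.smul_mem _ _ (binaryMonomial_mem _ (by omega))
  · apply le_antisymm
    · rw [Submodule.span_le, Set.range_subset_iff]
      exact fun i => Submodule.sum_mem _ fun j _ =>
        Submodule.smul_mem _ _ (binaryMonomial_mem _ (by omega))
    · rw [← span_binaryMonomial, Submodule.span_le, Set.range_subset_iff]
      intro j
      have h2 : ∑ i, N j i • ∑ j, M i j • binaryMonomial K n j = binaryMonomial K n j := by
        simp only [Finset.smul_sum, smul_smul]
        rw [Finset.sum_comm]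
        have h3 (k) : ∑ i, N j i * M i k = (1 : Matrix _ _ K) j k := by
          rw [← hM, Matrix.mul_apply]; rfl
        simp only [← Finset.sum_smul, h3, Matrix.one_apply, ite_smul, one_smul,
          zero_smul, Finset.sum_ite_eq, Finset.mem_univ, if_true]
      change binaryMonomial K n j ∈ _
      rw [← h2]
      exact Submodule.sum_mem _ fun i _ => Submodule.smul_mem _ _
        (Submodule.subset_span ⟨i, rfl⟩)
  · rw [iInf_ker_eval_eq_minorIdeal hn hM']
    simp only [Matrix.of_apply, hN]

lemma IsRNC.hilbF_two_le [Infinite K] (hC : IsRNC n C) : hilbF C 2 ≤ 2 * n + 1 := by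
  obtain ⟨p, hp, hspan, rfl⟩ := hC
  rw [hilbF, finrank_map_eq_of_ker _ _ (aeval p).toLinearMap]
  · refine le_trans (Submodule.finrank_mono (t := homogeneousSubmodule (Fin 2) K (2 * n)) ?_)
      (finrank_binaryForms_le K (2 * n))
    rw [Submodule.map_le_iff_le_comap, mul_comm]
    intro F hF
    exact hF.aeval p hp
  · intro F hF
    exact Ideal.Quotient.eq_zero_iff_mem.trans mem_iInf_ker_eval_iff

end

end RationalNormalCurve

section Chart

open DirectSum

variable {K : Type} [Field K] {n : ℕ} {I J : Ideal (MvPolynomial (Fin (n + 1)) K)}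
  {ℓ : MvPolynomial (Fin (n + 1)) K}

lemma mem_saturate_iff {F : MvPolynomial (Fin (n + 1)) K} :
    F ∈ saturate I ↔ ∃ k, ∀ G ∈ irrelevantIdeal K n ^ k, F * G ∈ I := by
  rw [saturate, Submodule.mem_iSup_of_directed]
  · simp only [Submodule.mem_colon, smul_eq_mul]
    rfl
  · refine Monotone.directed_le fun k l hkl => ?_
    exact Submodule.colon_mono le_rfl (Ideal.pow_le_pow_right hkl)

lemma homogeneousSubmodule_one_le_irrelevantIdeal :
    homogeneousSubmodule (Fin (n + 1)) K 1 ≤ (irrelevantIdeal K n).restrictScalars K := by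
  rw [homogeneousSubmodule_one_eq_span_X, Submodule.span_le, Set.range_subset_iff]
  exact fun i => Ideal.subset_span ⟨i, rfl⟩

open scoped Pointwise in
lemma irrelevantIdeal_pow_le {m : ℕ}
    (h : ∀ F ∈ homogeneousSubmodule (Fin (n + 1)) K m, F ∈ J) : irrelevantIdeal K n ^ m ≤ J := by
  have h1 : irrelevantIdeal K n ^ m = Ideal.span (Set.range X ^ m) := Submodule.span_pow _ m
  rw [h1, Ideal.span_le]
  intro F hF
  refine h F ?_
  rw [← homogeneousSubmodule_one_pow, homogeneousSubmodule_one_eq_span_X]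
  exact Submodule.pow_subset_pow _ (Set.pow_subset_pow_left Submodule.subset_span hF)

/-- A linear form avoiding the points of the scheme with saturated ideal `I`. -/
lemma exists_linearForm_nonzerodivisor [Infinite K] (hI : saturate I = I) :
    ∃ ℓ ∈ homogeneousSubmodule (Fin (n + 1)) K 1, ∀ F, ℓ * F ∈ I → F ∈ I := by
  set S := MvPolynomial (Fin (n + 1)) K
  set H := homogeneousSubmodule (Fin (n + 1)) K 1
  have hfin := associatedPrimes.finite S (S ⧸ I)
  let g : Ideal S → Submodule K H := fun P => (P.restrictScalars K).comap H.subtype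
  have htop : ⊤ ∉ hfin.toFinset.image g := by
    rw [Finset.mem_image]
    rintro ⟨P, hP, hg⟩
    rw [Set.Finite.mem_toFinset, AssociatedPrimes.mem_iff, isAssociatedPrime_iff] at hP
    obtain ⟨hprime, x, hx⟩ := hP
    obtain ⟨F, rfl⟩ := Ideal.Quotient.mk_surjective x
    refine hprime.ne_top ?_
    have hF : F ∈ saturate I := by
      refine mem_saturate_iff.2 ⟨1, fun G hG => ?_⟩
      have h1 : irrelevantIdeal K n ^ 1 ≤ P := irrelevantIdeal_pow_le fun L hL => by
        have : (⟨L, hL⟩ : H) ∈ g P := hg ▸ Submodule.mem_top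
        exact this
      have h2 := h1 hG
      rw [hx, Submodule.mem_colon_singleton, Submodule.mem_bot] at h2
      rw [mul_comm]
      exact Ideal.Quotient.eq_zero_iff_mem.1 h2
    rw [hI] at hF
    rw [hx, Ideal.eq_top_iff_one, Submodule.mem_colon_singleton,
      Ideal.Quotient.eq_zero_iff_mem.2 hF]
    simp
  obtain ⟨ℓ, hℓ⟩ := (Set.ne_univ_iff_exists_notMem _).1
    (Subspace.biUnion_ne_univ_of_top_notMem htop)
  refine ⟨ℓ, ℓ.2, fun F hF => ?_⟩
  by_contra hFI
  have h1 : (ℓ : S) ∈ ⋃ p ∈ associatedPrimes S (S ⧸ I), (p : Set S) := by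
    rw [biUnion_associatedPrimes_eq_zero_divisors]
    exact ⟨Ideal.Quotient.mk I F, fun h => hFI (Ideal.Quotient.eq_zero_iff_mem.1 h),
      Ideal.Quotient.eq_zero_iff_mem.2 hF⟩
  simp only [Set.mem_iUnion] at h1 hℓ
  obtain ⟨P, hP, hℓP⟩ := h1
  exact hℓ ⟨g P, Finset.mem_image_of_mem _ (hfin.mem_toFinset.2 hP), hℓP⟩

/-- Dehomogenising with respect to `ℓ` amounts to inverting `ℓ`. -/
lemma exists_pow_mul_mem_of_mem_sup
    (hJ : J.IsHomogeneous (homogeneousSubmodule (Fin (n + 1)) K))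
    (hℓ : ℓ ∈ homogeneousSubmodule (Fin (n + 1)) K 1) {m : ℕ}
    {F : MvPolynomial (Fin (n + 1)) K} (hF : F ∈ homogeneousSubmodule (Fin (n + 1)) K m)
    (h : F ∈ J ⊔ Ideal.span {ℓ - 1}) : ∃ k, ℓ ^ k * F ∈ J := by
  obtain ⟨G, hG, E, hE, rfl⟩ := Submodule.mem_sup.1 h
  obtain ⟨D, rfl⟩ := Ideal.mem_span_singleton'.1 hE
  set F := G + D * (ℓ - 1) with hFdef
  have hFD : F = G + ℓ * D - D := by rw [hFdef]; ring
  let c (P : MvPolynomial (Fin (n + 1)) K) (i : ℕ) : MvPolynomial (Fin (n + 1)) K :=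
    decompose (homogeneousSubmodule (Fin (n + 1)) K) P i
  have hc (i) : c F i = c G i + c (ℓ * D) i - c D i := by
    simp only [c]
    conv_lhs => rw [hFD]
    simp
  have hcG (i) : c G i ∈ J := hJ i hG
  have hlow (i) (hi : i < m) : c D i ∈ J := by
    induction i with
    | zero =>
      have h1 := hc 0
      have h2 : c F 0 = 0 := decompose_of_mem_ne _ hF hi.ne'
      have h3 : c (ℓ * D) 0 = 0 := coe_decompose_mul_of_left_mem_of_not_le _ hℓ (by simp)
      rw [h2, h3, add_zero, eq_comm, sub_eq_zero] at h1
      exact h1 ▸ hcG 0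
    | succ i ih =>
      have h1 := hc (1 + i)
      have h2 : c F (1 + i) = 0 := decompose_of_mem_ne _ hF (by omega)
      have h3 : c (ℓ * D) (1 + i) = ℓ * c D i := coe_decompose_mul_add_of_left_mem _ hℓ
      rw [h2, h3, eq_comm, sub_eq_zero] at h1
      rw [add_comm i 1, ← h1]
      exact J.add_mem (hcG _) (J.mul_mem_left _ (ih (by omega)))
  have hhigh (k) : c D (m + k) + ℓ ^ k * F ∈ J := by
    induction k with
    | zero =>
      have h1 := hc m
      have h2 : c F m = F := decompose_of_mem_same _ hF
      have h3 : c (ℓ * D) m ∈ J := by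
        rcases m with _ | m
        · have h3 : c (ℓ * D) 0 = 0 := coe_decompose_mul_of_left_mem_of_not_le _ hℓ (by simp)
          rw [h3]
          exact J.zero_mem
        · have h3 : c (ℓ * D) (1 + m) = ℓ * c D m := coe_decompose_mul_add_of_left_mem _ hℓ
          rw [add_comm m 1, h3]
          exact J.mul_mem_left _ (hlow m (by omega))
      have h4 : c D (m + 0) + ℓ ^ 0 * F = c G m + c (ℓ * D) m := by
        rw [h2] at h1
        rw [add_zero]
        linear_combination h1
      rw [h4]
      exact J.add_mem (hcG _) h3
    | succ k ih =>
      have h1 := hc (1 + (m + k))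
      have h2 : c F (1 + (m + k)) = 0 := decompose_of_mem_ne _ hF (by omega)
      have h3 : c (ℓ * D) (1 + (m + k)) = ℓ * c D (m + k) :=
        coe_decompose_mul_add_of_left_mem _ hℓ
      have h4 : c D (m + (k + 1)) + ℓ ^ (k + 1) * F =
          c G (1 + (m + k)) + ℓ * (c D (m + k) + ℓ ^ k * F) := by
        rw [show m + (k + 1) = 1 + (m + k) by ring]
        rw [h2, h3] at h1
        linear_combination h1
      rw [h4]
      exact J.add_mem (hcG _) (J.mul_mem_left _ ih)
  obtain ⟨k, hk⟩ : ∃ k, c D (m + k) = 0 := by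
    refine ⟨D.totalDegree + 1, ?_⟩
    have h1 := homogeneousComponent_eq_zero (m + (D.totalDegree + 1)) D (by omega)
    rw [← h1]
    exact decomposition.decompose'_apply D _
  exact ⟨k, by simpa [hk] using hhigh k⟩

/-- The linear form `ℓ` vanishes at no point of the finite scheme with ideal `I`. -/
structure IsChart (I : Ideal (MvPolynomial (Fin (n + 1)) K))
    (ℓ : MvPolynomial (Fin (n + 1)) K) : Prop where
  scheme : IsFiniteSubscheme I
  mem : ℓ ∈ homogeneousSubmodule (Fin (n + 1)) K 1
  mem_of_mul_mem : ∀ F, ℓ * F ∈ I → F ∈ I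

/-- The coordinate ring of the scheme with ideal `I` minus the hyperplane `ℓ = 0`. -/
noncomputable abbrev ChartRing (I : Ideal (MvPolynomial (Fin (n + 1)) K))
    (ℓ : MvPolynomial (Fin (n + 1)) K) : Type :=
  MvPolynomial (Fin (n + 1)) K ⧸ (I ⊔ Ideal.span {ℓ - 1})

/-- Dehomogenisation with respect to `ℓ`. -/
noncomputable abbrev toChart (I : Ideal (MvPolynomial (Fin (n + 1)) K)) (ℓ : MvPolynomial (Fin (n + 1)) K) :
    MvPolynomial (Fin (n + 1)) K →ₐ[K] ChartRing I ℓ :=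
  Ideal.Quotient.mkₐ K (I ⊔ Ideal.span {ℓ - 1})

/-- The functions on the chart given by forms of degree `m`. -/
noncomputable def chartFiltration (I : Ideal (MvPolynomial (Fin (n + 1)) K))
    (ℓ : MvPolynomial (Fin (n + 1)) K) (m : ℕ) : Submodule K (ChartRing I ℓ) :=
  (homogeneousSubmodule (Fin (n + 1)) K m).map (toChart I ℓ).toLinearMap

/-- The ideal cut out on the chart by `J`. -/
noncomputable abbrev chartIdeal (I : Ideal (MvPolynomial (Fin (n + 1)) K))
    (ℓ : MvPolynomial (Fin (n + 1)) K) (J : Ideal (MvPolynomial (Fin (n + 1)) K)) :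
    Ideal (ChartRing I ℓ) :=
  J.map (Ideal.Quotient.mk (I ⊔ Ideal.span {ℓ - 1}))

lemma toChart_linearForm : toChart I ℓ ℓ = 1 := by
  rw [← sub_eq_zero, ← map_one (toChart I ℓ), ← map_sub]
  exact Ideal.Quotient.eq_zero_iff_mem.2
    ((le_sup_right : _ ≤ I ⊔ _) (Ideal.mem_span_singleton_self _))

lemma toChart_mem_chartFiltration {m : ℕ} {F : MvPolynomial (Fin (n + 1)) K}
    (hF : F ∈ homogeneousSubmodule (Fin (n + 1)) K m) : toChart I ℓ F ∈ chartFiltration I ℓ m :=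
  ⟨F, hF, rfl⟩

lemma toChart_mem_chartIdeal_iff_mem_sup {F : MvPolynomial (Fin (n + 1)) K} :
    toChart I ℓ F ∈ chartIdeal I ℓ J ↔ F ∈ (I ⊔ J) ⊔ Ideal.span {ℓ - 1} := by
  have h := Ideal.comap_map_of_surjective (Ideal.Quotient.mk (I ⊔ Ideal.span {ℓ - 1}))
    Ideal.Quotient.mk_surjective J
  rw [← RingHom.ker_eq_comap_bot, Ideal.mk_ker, ← sup_assoc, sup_comm J] at h
  rw [← h]
  rfl

lemma schemeDeg_eq {d : ℕ} (h : ∀ᶠ m in atTop, hilbF I m = d) : schemeDeg I = d := by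
  have h' : ∃ d : ℕ, ∀ᶠ m : ℕ in atTop, hilbF I m = d := ⟨d, h⟩
  rw [schemeDeg, dif_pos h']
  obtain ⟨m, h1, h2⟩ := (h'.choose_spec.and h).exists
  exact h1.symm.trans h2

lemma mul_mem_chartFiltration {i j : ℕ} {a b : ChartRing I ℓ} (ha : a ∈ chartFiltration I ℓ i)
    (hb : b ∈ chartFiltration I ℓ j) : a * b ∈ chartFiltration I ℓ (i + j) := by
  obtain ⟨F, hF, rfl⟩ := ha
  obtain ⟨G, hG, rfl⟩ := hb
  exact ⟨F * G, hF.mul hG, map_mul (toChart I ℓ) F G⟩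

lemma one_mem_chartFiltration : 1 ∈ chartFiltration I ℓ 0 :=
  ⟨1, isHomogeneous_one _ _, map_one (toChart I ℓ)⟩

namespace IsChart

variable (h : IsChart I ℓ)

include h

lemma toChart_mem_iff (hJ : J.IsHomogeneous (homogeneousSubmodule (Fin (n + 1)) K)) {m : ℕ}
    {F : MvPolynomial (Fin (n + 1)) K} (hF : F ∈ homogeneousSubmodule (Fin (n + 1)) K m) :
    toChart I ℓ F ∈ chartIdeal I ℓ J ↔ ∃ k, ℓ ^ k * F ∈ I ⊔ J := by
  constructor
  · rw [toChart_mem_chartIdeal_iff_mem_sup]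
    exact exists_pow_mul_mem_of_mem_sup (h.scheme.homog.sup hJ) h.mem hF
  · rintro ⟨k, hk⟩
    have h1 : toChart I ℓ (ℓ ^ k * F) ∈ chartIdeal I ℓ J :=
      toChart_mem_chartIdeal_iff_mem_sup.2 ((le_sup_left : I ⊔ J ≤ _) hk)
    rwa [map_mul, map_pow, toChart_linearForm, one_pow, one_mul] at h1

lemma toChart_eq_zero_iff {m : ℕ} {F : MvPolynomial (Fin (n + 1)) K}
    (hF : F ∈ homogeneousSubmodule (Fin (n + 1)) K m) : toChart I ℓ F = 0 ↔ F ∈ I := by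
  have h1 := h.toChart_mem_iff (Ideal.IsHomogeneous.bot _) hF
  rw [chartIdeal, Ideal.map_bot, Ideal.mem_bot, sup_bot_eq] at h1
  rw [h1]
  refine ⟨fun ⟨k, hk⟩ => ?_, fun hF => ⟨0, by simpa⟩⟩
  induction k with
  | zero => simpa using hk
  | succ k ih => exact ih (h.mem_of_mul_mem _ (by rwa [← mul_assoc, ← pow_succ']))

lemma finrank_chartFiltration (m : ℕ) :
    Module.finrank K (chartFiltration I ℓ m) = hilbF I m :=
  finrank_map_eq_of_ker _ _ _ fun _ hF =>
    (h.toChart_eq_zero_iff hF).trans Ideal.Quotient.eq_zero_iff_mem.symm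

lemma monotone : Monotone (chartFiltration I ℓ) := by
  refine monotone_nat_of_le_succ fun m a ha => ?_
  have h1 := mul_mem_chartFiltration ha (toChart_mem_chartFiltration h.mem)
  rwa [toChart_linearForm, mul_one] at h1

lemma exists_mem (a : ChartRing I ℓ) : ∃ m, a ∈ chartFiltration I ℓ m := by
  obtain ⟨F, rfl⟩ := Ideal.Quotient.mk_surjective a
  refine ⟨F.totalDegree, ?_⟩
  change toChart I ℓ F ∈ _
  have h1 : toChart I ℓ F = ∑ i ∈ Finset.range (F.totalDegree + 1),
      toChart I ℓ (homogeneousComponent i F) := by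
    rw [← map_sum, sum_homogeneousComponent]
  rw [h1]
  exact Submodule.sum_mem _ fun i hi => h.monotone (by simpa [Nat.lt_succ_iff] using hi)
    (toChart_mem_chartFiltration (homogeneousComponent_isHomogeneous i F))

lemma exists_chartFiltration_eq_top : ∃ m, chartFiltration I ℓ m = ⊤ := by
  obtain ⟨d, -, hd⟩ := h.scheme.finite
  obtain ⟨m₀, hm₀⟩ := eventually_atTop.1 hd
  refine ⟨m₀, Submodule.eq_top_iff'.2 fun a => ?_⟩
  obtain ⟨m, ha⟩ := h.exists_mem a
  have hle : chartFiltration I ℓ m₀ ≤ chartFiltration I ℓ (max m m₀) :=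
    h.monotone (le_max_right _ _)
  have : FiniteDimensional K (chartFiltration I ℓ (max m m₀)) := by
    unfold chartFiltration; infer_instance
  rw [Submodule.eq_of_le_of_finrank_eq hle]
  · exact h.monotone (le_max_left _ _) ha
  · rw [h.finrank_chartFiltration, h.finrank_chartFiltration, hm₀ _ le_rfl,
      hm₀ _ (le_max_right _ _)]

lemma finiteDimensional : FiniteDimensional K (ChartRing I ℓ) := by
  obtain ⟨m, hm⟩ := h.exists_chartFiltration_eq_top
  rw [FiniteDimensional, Module.finite_def, ← hm]
  exact (homogeneousSubmodule_fg _ _ m).map _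

lemma eventually_chartFiltration_eq_top : ∀ᶠ m in atTop, chartFiltration I ℓ m = ⊤ := by
  obtain ⟨m, hm⟩ := h.exists_chartFiltration_eq_top
  exact eventually_atTop.2 ⟨m, fun k hk => top_le_iff.1 (hm ▸ h.monotone hk)⟩

lemma exists_irrelevantIdeal_pow_le (k : ℕ) :
    ∃ N, irrelevantIdeal K n ^ N ≤ I ⊔ Ideal.span {ℓ ^ k} := by
  obtain ⟨m, hm⟩ := h.exists_chartFiltration_eq_top
  refine ⟨k + m, irrelevantIdeal_pow_le fun F hF => ?_⟩
  obtain ⟨G, hG, hGF⟩ : toChart I ℓ F ∈ chartFiltration I ℓ m := hm ▸ Submodule.mem_top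
  have hmem : ℓ ^ k * G ∈ homogeneousSubmodule (Fin (n + 1)) K (k + m) := by
    have h1 := (h.mem.pow k).mul hG
    rwa [one_mul] at h1
  have h0 : toChart I ℓ (F - ℓ ^ k * G) = 0 := by
    rw [map_sub, map_mul, map_pow, toChart_linearForm, one_pow, one_mul, sub_eq_zero]
    exact hGF.symm
  have h1 := (h.toChart_eq_zero_iff (Submodule.sub_mem _ hF hmem)).1 h0
  rw [← sub_add_cancel F (ℓ ^ k * G)]
  exact Ideal.add_mem _ ((le_sup_left : I ≤ _) h1) ((le_sup_right : _ ≤ I ⊔ _)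
    (Ideal.mul_mem_right _ _ (Ideal.mem_span_singleton_self _)))

lemma mem_interIdeal_iff (hJ : J.IsHomogeneous (homogeneousSubmodule (Fin (n + 1)) K)) {m : ℕ}
    {F : MvPolynomial (Fin (n + 1)) K} (hF : F ∈ homogeneousSubmodule (Fin (n + 1)) K m) :
    F ∈ interIdeal I J ↔ toChart I ℓ F ∈ chartIdeal I ℓ J := by
  rw [h.toChart_mem_iff hJ hF, interIdeal, mem_saturate_iff]
  constructor
  · rintro ⟨k, hk⟩
    refine ⟨k, ?_⟩
    rw [mul_comm]
    exact hk _ (Ideal.pow_mem_pow (homogeneousSubmodule_one_le_irrelevantIdeal h.mem) k)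
  · rintro ⟨k, hk⟩
    obtain ⟨N, hN⟩ := h.exists_irrelevantIdeal_pow_le k
    refine ⟨N, fun G hG => ?_⟩
    obtain ⟨E, hE, D, hD, rfl⟩ := Submodule.mem_sup.1 (hN hG)
    obtain ⟨D, rfl⟩ := Ideal.mem_span_singleton'.1 hD
    rw [mul_add]
    refine Ideal.add_mem _ (Ideal.mul_mem_left _ _ ((le_sup_left : I ≤ _) hE)) ?_
    rw [show F * (D * ℓ ^ k) = D * (ℓ ^ k * F) by ring]
    exact Ideal.mul_mem_left _ _ hk

lemma hilbF_interIdeal (hJ : J.IsHomogeneous (homogeneousSubmodule (Fin (n + 1)) K)) (m : ℕ) :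
    hilbF (interIdeal I J) m = Module.finrank K
      ((chartFiltration I ℓ m).map (Ideal.Quotient.mkₐ K (chartIdeal I ℓ J)).toLinearMap) := by
  rw [chartFiltration, ← Submodule.map_comp]
  refine finrank_map_eq_of_ker _ _ _ fun F hF => ?_
  exact Ideal.Quotient.eq_zero_iff_mem.trans
    ((h.mem_interIdeal_iff hJ hF).trans Ideal.Quotient.eq_zero_iff_mem.symm)

lemma schemeDeg_interIdeal (hJ : J.IsHomogeneous (homogeneousSubmodule (Fin (n + 1)) K)) :
    schemeDeg (interIdeal I J) = Module.finrank K (ChartRing I ℓ ⧸ chartIdeal I ℓ J) := by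
  refine schemeDeg_eq (h.eventually_chartFiltration_eq_top.mono fun m hm => ?_)
  rw [h.hilbF_interIdeal hJ, hm, Submodule.map_top,
    LinearMap.range_eq_top.2 (Ideal.Quotient.mkₐ_surjective K _), finrank_top]

lemma hilbF_interIdeal_eq_schemeDeg_iff
    (hJ : J.IsHomogeneous (homogeneousSubmodule (Fin (n + 1)) K)) {m : ℕ} :
    hilbF (interIdeal I J) m = schemeDeg (interIdeal I J) ↔
      chartFiltration I ℓ m ⊔ (chartIdeal I ℓ J).restrictScalars K = ⊤ := by
  have := h.finiteDimensional
  set π := (Ideal.Quotient.mkₐ K (chartIdeal I ℓ J)).toLinearMap with hπ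
  have hk : (chartIdeal I ℓ J).restrictScalars K = π.ker := by
    ext x
    exact Ideal.Quotient.eq_zero_iff_mem.symm
  have hs : π.range = ⊤ := LinearMap.range_eq_top.2 (Ideal.Quotient.mkₐ_surjective K _)
  rw [h.hilbF_interIdeal hJ, h.schemeDeg_interIdeal hJ, hk, ← Submodule.comap_map_eq,
    ← LinearMap.range_le_iff_comap, hs, top_le_iff]
  exact ⟨Submodule.eq_top_of_finrank_eq, fun h1 => by rw [h1, finrank_top]⟩

lemma interIdeal_bot : interIdeal I ⊥ = I := by
  rw [interIdeal, sup_bot_eq, h.scheme.saturated]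

lemma schemeDeg_eq_finrank : schemeDeg I = Module.finrank K (ChartRing I ℓ) := by
  refine schemeDeg_eq (h.eventually_chartFiltration_eq_top.mono fun m hm => ?_)
  rw [← h.finrank_chartFiltration, hm, finrank_top]

end IsChart

lemma finrank_homogeneousSubmodule_one (K : Type*) [Field K] (n : ℕ) :
    Module.finrank K (homogeneousSubmodule (Fin (n + 1)) K 1) = n + 1 := by
  rw [homogeneousSubmodule_one_eq_span_X, finrank_span_eq_card (linearIndependent_X _ K),
    Fintype.card_fin]

lemma isHomogeneous_minorIdeal {y : Fin (n + 1) → MvPolynomial (Fin (n + 1)) K}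
    (hy : ∀ i, y i ∈ homogeneousSubmodule (Fin (n + 1)) K 1) :
    (minorIdeal y).IsHomogeneous (homogeneousSubmodule (Fin (n + 1)) K) := by
  refine Ideal.homogeneous_span _ _ ?_
  rintro _ ⟨p, rfl⟩
  exact ⟨2, Submodule.sub_mem _ ((hy _).mul (hy _)) ((hy _).mul (hy _))⟩

lemma IsRNC.isHomogeneous [Infinite K] (hn : 0 < n) (hJ : IsRNC n J) :
    J.IsHomogeneous (homogeneousSubmodule (Fin (n + 1)) K) := by
  obtain ⟨y, hy, rfl⟩ := hJ.exists_eq_minorIdeal hn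
  exact isHomogeneous_minorIdeal hy

lemma eq_zero_of_finrank_map_le {V W W' : Type*} [AddCommGroup V] [Module K V]
    [AddCommGroup W] [Module K W] [AddCommGroup W'] [Module K W'] (P : Submodule K V)
    [FiniteDimensional K P] (f : V →ₗ[K] W) (g : V →ₗ[K] W') (h : ∀ x ∈ P, f x = 0 → g x = 0)
    (hfg : Module.finrank K (P.map f) ≤ Module.finrank K (P.map g)) {x : V} (hx : x ∈ P)
    (hgx : g x = 0) : f x = 0 := by
  have h1 := (f ∘ₗ P.subtype).finrank_range_add_finrank_ker
  have h2 := (g ∘ₗ P.subtype).finrank_range_add_finrank_ker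
  rw [LinearMap.range_comp, Submodule.range_subtype] at h1 h2
  have h3 : (f ∘ₗ P.subtype).ker = (g ∘ₗ P.subtype).ker :=
    Submodule.eq_of_le_of_finrank_le (fun z hz => h z z.2 hz) (by omega)
  have h4 : (⟨x, hx⟩ : P) ∈ (g ∘ₗ P.subtype).ker := hgx
  rw [← h3] at h4
  exact h4

namespace IsChart

variable (h : IsChart I ℓ)

include h

lemma finrank_quotient_span_le (hn : 1 ≤ n) (hI : InLinGenPos I)
    {L : MvPolynomial (Fin (n + 1)) K} (hL : L ∈ homogeneousSubmodule (Fin (n + 1)) K 1)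
    (hL0 : L ≠ 0) :
    Module.finrank K (ChartRing I ℓ ⧸ Ideal.span {toChart I ℓ L}) ≤ n := by
  have h1 : n - 1 ∉ {t | HasSecantPlane I t} :=
    Nat.notMem_of_lt_sInf (lt_of_lt_of_eq (by omega) hI.symm)
  by_contra! h2
  refine h1 ⟨Ideal.span {L}, ⟨Submodule.span K {L}, ?_, ?_, ?_⟩, ?_⟩
  · rwa [Submodule.span_singleton_le_iff_mem]
  · rw [finrank_span_singleton hL0]
    omega
  · exact (Submodule.span_span_of_tower K _ _).symm
  · have hh : (Ideal.span {L}).IsHomogeneous (homogeneousSubmodule (Fin (n + 1)) K) :=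
      Ideal.homogeneous_span _ _ (by rintro _ rfl; exact ⟨1, hL⟩)
    rw [h.schemeDeg_interIdeal hh, chartIdeal, Ideal.map_span, Set.image_singleton]
    exact le_trans (by omega) h2

lemma isLinGenPosFiltration (hn : 1 ≤ n) (hI : InLinGenPos I) (hd : n + 1 ≤ schemeDeg I) :
    IsLinGenPosFiltration n (chartFiltration I ℓ) where
  one_mem := one_mem_chartFiltration
  mono := h.monotone
  mul_mem := mul_mem_chartFiltration
  finrank_one := by
    refine Eq.trans ?_ (finrank_homogeneousSubmodule_one K n)
    rw [chartFiltration, finrank_map_eq_of_ker _ _ LinearMap.id, Submodule.map_id]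
    refine fun L hL => ⟨fun hL0 => ?_, fun hL0 => ?_⟩
    · by_contra hne
      have h1 := h.finrank_quotient_span_le hn hI hL hne
      have h2 : Ideal.span {toChart I ℓ L} = ⊥ := Ideal.span_singleton_eq_bot.2 hL0
      rw [h2, (AlgEquiv.quotientBot K _).toLinearEquiv.finrank_eq, ← h.schemeDeg_eq_finrank] at h1
      omega
    · rw [show L = 0 from hL0, map_zero]
  section_le := by
    rintro _ ⟨L, hL, rfl⟩ hL0
    refine h.finrank_quotient_span_le hn hI hL fun h0 => hL0 ?_
    rw [h0, map_zero]

lemma schemeReg_interIdeal_le_iff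
    (hJ : J.IsHomogeneous (homogeneousSubmodule (Fin (n + 1)) K)) {m : ℕ} :
    schemeReg (interIdeal I J) ≤ m + 1 ↔
      chartFiltration I ℓ m ⊔ (chartIdeal I ℓ J).restrictScalars K = ⊤ := by
  rw [schemeReg]
  simp only [h.hilbF_interIdeal_eq_schemeDeg_iff hJ]
  constructor
  · intro hle
    obtain ⟨m₀, hm₀⟩ := h.exists_chartFiltration_eq_top
    refine (Nat.sInf_mem (s := {p : ℕ | 1 ≤ p ∧ ∀ m : ℕ, p - 1 ≤ m →
      chartFiltration I ℓ m ⊔ (chartIdeal I ℓ J).restrictScalars K = ⊤})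
      ⟨m₀ + 1, by omega, fun m hm => ?_⟩).2 m (by omega)
    rw [eq_top_iff, ← hm₀]
    exact le_sup_of_le_left (h.monotone (by simpa using hm))
  · intro htop
    refine Nat.sInf_le ⟨by omega, fun k hk => ?_⟩
    rw [eq_top_iff, ← htop]
    exact sup_le_sup_right (h.monotone (by simpa using hk)) _

lemma schemeReg_le_iff {m : ℕ} : schemeReg I ≤ m + 1 ↔ chartFiltration I ℓ m = ⊤ := by
  have h1 := h.schemeReg_interIdeal_le_iff (Ideal.IsHomogeneous.bot _) (m := m)
  rwa [h.interIdeal_bot, chartIdeal, Ideal.map_bot, Submodule.restrictScalars_bot,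
    sup_bot_eq] at h1

end IsChart

/-- A rational normal curve is determined by a long enough intersection with the scheme. -/
lemma IsRNC.le_of_chartIdeal_le [Infinite K] (hn : 0 < n)
    {C C' : Ideal (MvPolynomial (Fin (n + 1)) K)}
    (hC : IsRNC n C) (hC' : IsRNC n C') {L : Ideal (ChartRing I ℓ)}
    (h1 : chartIdeal I ℓ C ≤ L) (h2 : chartIdeal I ℓ C' ≤ L)
    (hL : Module.finrank K (ChartRing I ℓ ⧸ L) = 2 * n + 1)
    (htop : chartFiltration I ℓ 2 ⊔ L.restrictScalars K = ⊤) : C' ≤ C := by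
  obtain ⟨y, hy, rfl⟩ := hC'.exists_eq_minorIdeal hn
  rw [minorIdeal_le_iff]
  intro i j
  set G := y i.succ * y j.castSucc - y i.castSucc * y j.succ
  have hG : G ∈ homogeneousSubmodule (Fin (n + 1)) K 2 :=
    Submodule.sub_mem _ ((hy _).mul (hy _)) ((hy _).mul (hy _))
  have hG' : G ∈ minorIdeal y := minorIdeal_le_iff.1 le_rfl i j
  set π := (Ideal.Quotient.mkₐ K L).toLinearMap with hπ
  have hπ0 (a : ChartRing I ℓ) : π a = 0 ↔ a ∈ L := Ideal.Quotient.eq_zero_iff_mem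
  have hk : L.restrictScalars K = π.ker := by
    ext x
    exact (hπ0 x).symm
  have hs : π.range = ⊤ := LinearMap.range_eq_top.2 (Ideal.Quotient.mkₐ_surjective K _)
  have hmap : (homogeneousSubmodule (Fin (n + 1)) K 2).map (π ∘ₗ (toChart I ℓ).toLinearMap) =
      ⊤ := by
    rwa [hk, chartFiltration, ← Submodule.comap_map_eq, ← LinearMap.range_le_iff_comap, hs,
      top_le_iff, ← Submodule.map_comp] at htop
  have hle := hC.hilbF_two_le
  refine Ideal.Quotient.eq_zero_iff_mem.1 (eq_zero_of_finrank_map_le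
    (homogeneousSubmodule (Fin (n + 1)) K 2) (Ideal.Quotient.mkₐ K C).toLinearMap
    (π ∘ₗ (toChart I ℓ).toLinearMap) (fun F _ hF => ?_) ?_ hG ?_)
  · exact (hπ0 _).2 (h1 (Ideal.mem_map_of_mem _ (Ideal.Quotient.eq_zero_iff_mem.1 hF)))
  · rw [hmap, finrank_top, hL]
    exact hle
  · exact (hπ0 _).2 (h2 (Ideal.mem_map_of_mem _ hG'))

lemma IsFiniteSubscheme.exists_isChart [Infinite K] (hI : IsFiniteSubscheme I) :
    ∃ ℓ, IsChart I ℓ := by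
  obtain ⟨ℓ, h1, h2⟩ := exists_linearForm_nonzerodivisor hI.saturated
  exact ⟨ℓ, hI, h1, h2⟩

end Chart

/-- The numerical content of the lower bound on the regularity. -/
lemma regularity_bound {n d r : ℕ} (hn : 2 ≤ n) (hd : 4 * n ^ 2 + 6 * n + 1 ≤ d)
    (hr : ⌈((d : ℚ) - 1) / ((n : ℚ) + (n : ℚ) / (2 * (n : ℚ) + 2))⌉ + 3 ≤ (r : ℤ)) :
    ∃ s, r = s + 2 ∧ 5 ≤ s ∧
      (2 * n + 2) * d + n * (2 * n + 3) ≤ n * (2 * n + 3) * s + (2 * n + 2) := by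
  have hn' : (2 : ℚ) ≤ n := by exact_mod_cast hn
  have hd' : 4 * (n : ℚ) ^ 2 + 6 * n + 1 ≤ d := by exact_mod_cast hd
  have h1 : ((d : ℚ) - 1) / ((n : ℚ) + (n : ℚ) / (2 * (n : ℚ) + 2)) ≤ (r : ℚ) - 3 := by
    refine (Int.le_ceil _).trans ?_
    have : ((⌈((d : ℚ) - 1) / ((n : ℚ) + (n : ℚ) / (2 * (n : ℚ) + 2))⌉ + 3 : ℤ) : ℚ) ≤ (r : ℤ) := by
      exact_mod_cast hr
    push_cast at this
    linarith
  have h2 : (n : ℚ) + (n : ℚ) / (2 * (n : ℚ) + 2) = n * (2 * n + 3) / (2 * n + 2) := by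
    field_simp
    ring
  rw [h2, div_div_eq_mul_div, div_le_iff₀ (by positivity)] at h1
  have h3 : (8 : ℚ) ≤ r := by
    by_contra! h3
    nlinarith
  have h4 : 8 ≤ r := by exact_mod_cast h3
  obtain ⟨s, rfl⟩ : ∃ s, r = s + 2 := ⟨r - 2, by omega⟩
  refine ⟨s, rfl, by omega, ?_⟩
  have h5 : ((2 * n + 2) * d + n * (2 * n + 3) : ℚ) ≤ n * (2 * n + 3) * s + (2 * n + 2) := by
    push_cast at h1
    linarith
  exact_mod_cast h5

/-- part of Theorem 1.4. -/
theorem stmt2 (K : Type) [Field K] [IsAlgClosed K] [CharZero K] (n d : ℕ) (hn : 2 ≤ n)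
    (I : Ideal (MvPolynomial (Fin (n+1)) K))
    (hfin : IsFiniteSubscheme I) (hlgp : InLinGenPos I) (hdeg : schemeDeg I = d)
    (hd : 4*n^2 + 6*n + 1 ≤ d)
    (hreg : ⌈((d : ℚ) - 1) / ((n : ℚ) + (n : ℚ) / (2*(n : ℚ) + 2))⌉ + 3 ≤ (schemeReg I : ℤ)) :
    ∃! C : Ideal (MvPolynomial (Fin (n+1)) K),
      IsRNC n C ∧
      rhoInv I = schemeDeg (interIdeal I C) ∧
      schemeReg I = schemeReg (interIdeal I C) := by
  obtain ⟨ℓ, h⟩ := hfin.exists_isChart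
  have := h.finiteDimensional
  obtain ⟨s, hrs, hs, hds⟩ := regularity_bound hn hd hreg
  have hd' : n + 1 ≤ d := by nlinarith
  have hU := h.isLinGenPosFiltration (by omega) hlgp (by omega)
  have hA : Module.finrank K (ChartRing I ℓ) = d := by rw [← h.schemeDeg_eq_finrank, hdeg]
  have hne : chartFiltration I ℓ s ≠ ⊤ := fun htop => by
    have := h.schemeReg_le_iff.2 htop
    omega
  have hlarge {C : Ideal (MvPolynomial (Fin (n + 1)) K)} (hC : IsRNC n C)
      (hCreg : schemeReg I = schemeReg (interIdeal I C)) :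
      n * s + 2 ≤ schemeDeg (interIdeal I C) := by
    have hCh := hC.isHomogeneous (by omega)
    rw [h.schemeDeg_interIdeal hCh]
    refine hU.le_finrank_quotient (by omega) fun htop => ?_
    have := (h.schemeReg_interIdeal_le_iff hCh).2 htop
    omega
  have hunique {C C' : Ideal (MvPolynomial (Fin (n + 1)) K)} (hC : IsRNC n C) (hC' : IsRNC n C')
      (hCdeg : n * s + 2 ≤ schemeDeg (interIdeal I C))
      (hCdeg' : n * s + 2 ≤ schemeDeg (interIdeal I C')) : C = C' := by
    rw [h.schemeDeg_interIdeal (hC.isHomogeneous (by omega))] at hCdeg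
    rw [h.schemeDeg_interIdeal (hC'.isHomogeneous (by omega))] at hCdeg'
    obtain ⟨L, h1, h2, hL, htop⟩ := hU.exists_common_overideal (by omega) (by rwa [hA]) hs
      hCdeg hCdeg'
    exact le_antisymm (hC'.le_of_chartIdeal_le (by omega) hC h2 h1 hL htop)
      (hC.le_of_chartIdeal_le (by omega) hC' h1 h2 hL htop)
  obtain ⟨y, hy, hyli, hytop⟩ := hU.exists_minorIdeal_sup_ne_top (by omega) (by omega) hne
    (by rwa [hA])
  choose Y hY hYy using hy
  have hYy' : toChart I ℓ ∘ Y = y := funext hYy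
  have hYli : LinearIndependent K Y :=
    LinearIndependent.of_comp (toChart I ℓ).toLinearMap (by exact hYy' ▸ hyli)
  have hC : IsRNC n (minorIdeal Y) := isRNC_minorIdeal (by omega) hY hYli
  have hCh := isHomogeneous_minorIdeal hY
  have hCreg : schemeReg I = schemeReg (interIdeal I (minorIdeal Y)) := by
    have hmap : chartIdeal I ℓ (minorIdeal Y) = minorIdeal y := by
      rw [← hYy']
      exact map_minorIdeal _ Y
    apply le_antisymm
    · rw [← hmap] at hytop
      by_contra! hlt
      exact hytop ((h.schemeReg_interIdeal_le_iff hCh).1 (by omega))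
    · have htop : chartFiltration I ℓ (s + 1) = ⊤ := h.schemeReg_le_iff.1 (by omega)
      rw [hrs]
      exact (h.schemeReg_interIdeal_le_iff hCh).2 (by rw [htop, top_sup_eq])
  refine ⟨minorIdeal Y, ⟨hC, ?_, hCreg⟩, ?_⟩
  · refine IsGreatest.csSup_eq ⟨⟨_, hC, rfl⟩, ?_⟩
    rintro _ ⟨C', hC', rfl⟩
    by_contra! hlt
    have hl := hlarge hC hCreg
    rw [hunique hC hC' hl (by omega)] at hlt
    exact lt_irrefl _ hlt
  · rintro C' ⟨hC', -, hCreg'⟩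
    exact hunique hC' hC (hlarge hC' hCreg') (hlarge hC hCreg)
end

section
/- Let Γ ⊂ P^n, n ≥ 2, be a finite subscheme of degree d ≥ 4n² + 6n + 1 in linearly general position over an algebraically closed field of characteristic 0, and write d = nq + r + 2 with 0 ≤ r ≤ n−1. Then reg(Γ) = ⌈(d−1)/n⌉ + 1 if and only if ρ(Γ) ≥ d − r. -/
open MvPolynomial Filter
open scoped Classical

attribute [local instance] MvPolynomial.gradedAlgebra

namespace FiniteScheme

theorem finrank_map_eq {K E F : Type*} [Field K] [AddCommGroup E] [Module K E] [AddCommGroup F]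
    [Module K F] {W : Submodule K E} {f : E →ₗ[K] F} (hf : ∀ g ∈ W, f g = 0 → g = 0) :
    Module.finrank K (W.map f) = Module.finrank K W := by
  rw [← LinearMap.range_domRestrict]
  apply LinearMap.finrank_range_of_inj
  rw [← LinearMap.ker_eq_bot, LinearMap.ker_eq_bot']
  intro g hg
  exact Subtype.ext (hf g g.2 hg)

section Algebra

variable {K : Type*} [Field K] {O : Type*} [CommRing O] [Algebra K O]

section Artinian

variable [FiniteDimensional K O]

theorem finrank_quotient_add (𝔞 : Ideal O) :
    Module.finrank K (O ⧸ 𝔞) + Module.finrank K (𝔞.restrictScalars K) = Module.finrank K O := by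
  rw [← (Submodule.Quotient.restrictScalarsEquiv K 𝔞).finrank_eq]
  exact Submodule.finrank_quotient_add_finrank _

theorem finrank_quotient_le_of_le {𝔞 𝔟 : Ideal O} (h : 𝔞 ≤ 𝔟) :
    Module.finrank K (O ⧸ 𝔟) ≤ Module.finrank K (O ⧸ 𝔞) :=
  LinearMap.finrank_le_finrank_of_surjective
    (f := (Ideal.Quotient.factorₐ K h).toLinearMap) (Ideal.Quotient.factor_surjective h)

/-- Between an ideal and the unit ideal there are ideals of every intermediate colength. -/
theorem exists_ideal_colength [IsAlgClosed K] (J : Ideal O) (k : ℕ)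
    (hk : k ≤ Module.finrank K (O ⧸ J)) :
    ∃ 𝔞 : Ideal O, J ≤ 𝔞 ∧ Module.finrank K (O ⧸ 𝔞) = k := by
  induction hm : Module.finrank K (O ⧸ J) - k generalizing J with
  | zero => exact ⟨J, le_rfl, by omega⟩
  | succ m ih =>
    have hart : IsArtinianRing (O ⧸ J) := IsArtinianRing.of_finite K (O ⧸ J)
    have hnt : Nontrivial (O ⧸ J) := Module.nontrivial_of_finrank_pos (R := K) (by omega)
    obtain ⟨S, hS, -⟩ := (eq_bot_or_exists_atom_le (⊤ : Ideal (O ⧸ J))).resolve_left top_ne_bot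
    have hsimple : IsSimpleModule (O ⧸ J) S := isSimpleModule_iff_isAtom.2 hS
    obtain ⟨𝔪, h𝔪, ⟨e⟩⟩ := isSimpleModule_iff_quot_maximal.1 hsimple
    have hfield : IsDomain ((O ⧸ J) ⧸ 𝔪) := Ideal.Quotient.isDomain 𝔪
    have hone : Module.finrank K ((O ⧸ J) ⧸ 𝔪) = 1 := by
      have hb := IsAlgClosed.algebraMap_bijective_of_isIntegral (k := K) (K := (O ⧸ J) ⧸ 𝔪)
      rw [← (LinearEquiv.ofBijective (Algebra.linearMap K ((O ⧸ J) ⧸ 𝔪)) hb).finrank_eq,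
        Module.finrank_self]
    have hS1 : Module.finrank K (S.restrictScalars K) = 1 := by
      rw [← hone]
      exact (e.restrictScalars K).finrank_eq
    have hq := finrank_quotient_add (K := K) S
    have hc : Module.finrank K (O ⧸ S.comap (Ideal.Quotient.mk J)) =
        Module.finrank K ((O ⧸ J) ⧸ S) := by
      have hsurj : Function.Surjective
          ((Ideal.Quotient.mkₐ K S).comp (Ideal.Quotient.mkₐ K J)) :=
        (Ideal.Quotient.mkₐ_surjective K S).comp (Ideal.Quotient.mkₐ_surjective K J)
      have hker : RingHom.ker ((Ideal.Quotient.mkₐ K S).comp (Ideal.Quotient.mkₐ K J)) =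
          S.comap (Ideal.Quotient.mk J) := by
        ext x
        simp [RingHom.mem_ker, Ideal.Quotient.eq_zero_iff_mem]
      rw [← hker]
      exact (Ideal.quotientKerAlgEquivOfSurjective hsurj).toLinearEquiv.finrank_eq
    have hJ : J ≤ S.comap (Ideal.Quotient.mk J) := by
      intro x hx
      rw [Ideal.mem_comap, Ideal.Quotient.eq_zero_iff_mem.2 hx]
      exact S.zero_mem
    obtain ⟨𝔞, h1, h2⟩ := ih (S.comap (Ideal.Quotient.mk J)) (by omega) (by omega)
    exact ⟨𝔞, hJ.trans h1, h2⟩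

theorem finrank_sup_of_ideal (V : Submodule K O) (𝔞 : Ideal O) :
    Module.finrank K (V ⊔ 𝔞.restrictScalars K : Submodule K O) + Module.finrank K (O ⧸ 𝔞) +
      Module.finrank K (V ⊓ 𝔞.restrictScalars K : Submodule K O) =
    Module.finrank K V + Module.finrank K O := by
  have h1 := Submodule.finrank_sup_add_finrank_inf_eq V (𝔞.restrictScalars K)
  have h2 := finrank_quotient_add (K := K) 𝔞
  omega

theorem finrank_le_inf_add_colength (V : Submodule K O) (𝔞 : Ideal O) :
    Module.finrank K V ≤ Module.finrank K (V ⊓ 𝔞.restrictScalars K : Submodule K O) +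
      Module.finrank K (O ⧸ 𝔞) := by
  have h1 := finrank_sup_of_ideal V 𝔞
  have h2 := Submodule.finrank_le (V ⊔ 𝔞.restrictScalars K : Submodule K O)
  omega

theorem finrank_eq_inf_add_colength {V : Submodule K O} {𝔞 : Ideal O}
    (h : V ⊔ 𝔞.restrictScalars K = ⊤) :
    Module.finrank K V = Module.finrank K (V ⊓ 𝔞.restrictScalars K : Submodule K O) +
      Module.finrank K (O ⧸ 𝔞) := by
  have h1 := finrank_sup_of_ideal V 𝔞
  rw [h, finrank_top] at h1
  omega

theorem exists_ne_zero_mem_inf {V : Submodule K O} {𝔞 : Ideal O}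
    (h : Module.finrank K (O ⧸ 𝔞) < Module.finrank K V) : ∃ f ∈ V, f ∈ 𝔞 ∧ f ≠ 0 := by
  have h1 := finrank_le_inf_add_colength V 𝔞
  have h2 : (V ⊓ 𝔞.restrictScalars K : Submodule K O) ≠ ⊥ := by
    intro h0
    rw [h0, finrank_bot] at h1
    omega
  obtain ⟨f, hf, hf0⟩ := Submodule.exists_mem_ne_zero_of_ne_bot h2
  exact ⟨f, hf.1, hf.2, hf0⟩

end Artinian

/-- The largest ideal contained in the kernel of a linear functional. -/
def annIdeal (φ : O →ₗ[K] K) : Ideal O where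
  carrier := {a | ∀ b, φ (a * b) = 0}
  add_mem' ha hb c := by rw [add_mul, map_add, ha c, hb c, add_zero]
  zero_mem' b := by simp
  smul_mem' c a ha b := by
    have := ha (c * b)
    rwa [smul_eq_mul, mul_comm c a, mul_assoc]

theorem mem_annIdeal {φ : O →ₗ[K] K} {a : O} : a ∈ annIdeal φ ↔ ∀ b, φ (a * b) = 0 := Iff.rfl

theorem apply_eq_zero_of_mem_annIdeal {φ : O →ₗ[K] K} {a : O} (h : a ∈ annIdeal φ) : φ a = 0 := by
  simpa using h 1

theorem sup_annIdeal_ne_top {φ : O →ₗ[K] K} (hφ : φ ≠ 0) {W : Submodule K O}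
    (hW : ∀ a ∈ W, φ a = 0) : W ⊔ (annIdeal φ).restrictScalars K ≠ ⊤ := by
  intro htop
  apply hφ
  ext x
  obtain ⟨a, ha, b, hb, rfl⟩ := Submodule.mem_sup.1 (htop ▸ Submodule.mem_top (x := x))
  rw [map_add, hW a ha, apply_eq_zero_of_mem_annIdeal hb, add_zero, LinearMap.zero_apply]

/-- The functional `b ↦ φ (f * b)`. -/
def mulFunctional (f : O) (φ : O →ₗ[K] K) : O →ₗ[K] K := φ.comp (LinearMap.mulLeft K f)

@[simp] theorem mulFunctional_apply (f : O) (φ : O →ₗ[K] K) (b : O) :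
    mulFunctional f φ b = φ (f * b) := rfl

theorem mem_annIdeal_mulFunctional {φ : O →ₗ[K] K} {f a : O} :
    a ∈ annIdeal (mulFunctional f φ) ↔ f * a ∈ annIdeal φ := by
  simp [mem_annIdeal, mul_assoc]

theorem mulFunctional_ne_zero {φ : O →ₗ[K] K} {f : O} (h : f ∉ annIdeal φ) :
    mulFunctional f φ ≠ 0 := by
  contrapose! h
  intro b
  simpa using LinearMap.congr_fun h b

theorem mulFunctional_pow_eq_zero {φ : O →ₗ[K] K} {V : Submodule K O} {i j q : ℕ}
    (hφ : ∀ a ∈ V ^ q, φ a = 0) (hij : i + j = q) {f : O} (hf : f ∈ V ^ i) :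
    ∀ a ∈ V ^ j, mulFunctional f φ a = 0 := by
  intro a ha
  subst hij
  exact hφ _ (pow_add V i j ▸ Submodule.mul_mem_mul hf ha)

theorem finrank_pow_add_finrank_pow_le [FiniteDimensional K O] {φ : O →ₗ[K] K} {q : ℕ}
    {V : Submodule K O} (hφ : annIdeal φ = ⊥)
    (hV : ∀ a ∈ V ^ q, φ a = 0) {i j : ℕ} (hij : i + j = q) :
    Module.finrank K (V ^ i : Submodule K O) + Module.finrank K (V ^ j : Submodule K O) ≤
      Module.finrank K O := by
  let B : O →ₗ[K] Module.Dual K O := (LinearMap.mul K O).compr₂ φ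
  have hB : ∀ x, B x = 0 → x = 0 := by
    intro x hx
    have : x ∈ annIdeal φ := fun b => LinearMap.congr_fun hx b
    simpa [hφ] using this
  have hle : (V ^ j).map B ≤ (V ^ i).dualAnnihilator := by
    rintro _ ⟨x, hx, rfl⟩
    rw [Submodule.mem_dualAnnihilator]
    intro y hy
    exact hV (x * y) (by rw [← hij, pow_add, mul_comm x y]; exact Submodule.mul_mem_mul hy hx)
  have h1 := Submodule.finrank_mono hle
  have h2 := Subspace.finrank_add_finrank_dualAnnihilator_eq (V ^ i)
  have h3 : Module.finrank K ((V ^ j).map B) = Module.finrank K (V ^ j : Submodule K O) :=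
    finrank_map_eq fun x _ => hB x
  omega

theorem pow_le_pow_of_one_mem {V : Submodule K O} (h1 : (1 : O) ∈ V) {i j : ℕ} (hij : i ≤ j) :
    V ^ i ≤ V ^ j :=
  pow_le_pow_right' (Submodule.one_le.2 h1) hij

/-- `V` is the space of linear forms, in a finite scheme with coordinate ring `O`, of an
embedding in `ℙⁿ` in linearly general position. -/
structure IsLGP (V : Submodule K O) (n : ℕ) : Prop where
  one_mem : (1 : O) ∈ V
  finrank_eq : Module.finrank K V = n + 1
  colength_le : ∀ W ≤ V, W ≠ ⊥ →
    Module.finrank K (O ⧸ Ideal.span (W : Set O)) + Module.finrank K W ≤ n + 1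

namespace IsLGP

variable [FiniteDimensional K O] {V : Submodule K O} {n : ℕ}

theorem colength_span_singleton_le (h : IsLGP V n) {f : O} (hf : f ∈ V) (hf0 : f ≠ 0) :
    Module.finrank K (O ⧸ Ideal.span {f}) ≤ n := by
  have h1 := h.colength_le (K ∙ f) (by simpa using hf) (by simpa using hf0)
  rw [finrank_span_singleton hf0] at h1
  have h2 : Ideal.span ((K ∙ f : Submodule K O) : Set O) ≤ Ideal.span {f} := by
    rw [Ideal.span_le]
    intro x hx
    obtain ⟨c, rfl⟩ := Submodule.mem_span_singleton.1 hx
    rw [Algebra.smul_def]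
    exact Ideal.mul_mem_left _ _ (Ideal.mem_span_singleton_self f)
  have h3 := finrank_quotient_le_of_le (K := K) h2
  omega

theorem sup_eq_top (h : IsLGP V n) {𝔞 : Ideal O} (h𝔞 : Module.finrank K (O ⧸ 𝔞) ≤ n + 1) :
    V ⊔ 𝔞.restrictScalars K = ⊤ := by
  have hinf : Module.finrank K (V ⊓ 𝔞.restrictScalars K : Submodule K O) +
      Module.finrank K (O ⧸ 𝔞) ≤ n + 1 := by
    by_cases hb : V ⊓ 𝔞.restrictScalars K = ⊥
    · rw [hb, finrank_bot]; omega
    · have h1 := h.colength_le _ inf_le_left hb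
      have h2 : Ideal.span ((V ⊓ 𝔞.restrictScalars K : Submodule K O) : Set O) ≤ 𝔞 :=
        Ideal.span_le.2 fun x hx => hx.2
      have h3 := finrank_quotient_le_of_le (K := K) h2
      omega
  have h1 := finrank_sup_of_ideal V 𝔞
  have h2 := h.finrank_eq
  apply Submodule.eq_top_of_finrank_eq
  have h3 := Submodule.finrank_le (V ⊔ 𝔞.restrictScalars K : Submodule K O)
  omega

variable [IsAlgClosed K]

/-- Castelnuovo's bound: a finite scheme in linearly general position all of whose proper
subschemes have larger span in degree `m` has length at least `n * m + 2`. -/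
theorem le_colength_annIdeal (h : IsLGP V n) (m : ℕ) (φ : O →ₗ[K] K) (hφ : φ ≠ 0)
    (hV : ∀ a ∈ V ^ m, φ a = 0) : n * m + 2 ≤ Module.finrank K (O ⧸ annIdeal φ) := by
  induction m generalizing φ with
  | zero =>
    by_contra! hlt
    apply sup_annIdeal_ne_top hφ (W := 1) (by simpa using hV)
    apply Submodule.eq_top_of_finrank_eq
    have h1 := finrank_sup_of_ideal (1 : Submodule K O) (annIdeal φ)
    have h2 := Submodule.finrank_le
      ((1 : Submodule K O) ⊔ (annIdeal φ).restrictScalars K : Submodule K O)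
    have h3 : (1 : Submodule K O) ⊓ (annIdeal φ).restrictScalars K = ⊥ := by
      rw [eq_bot_iff]
      rintro x ⟨hx1, hx2⟩
      obtain ⟨c, rfl⟩ := Submodule.mem_one.1 hx1
      by_cases hc : c = 0
      · simp [hc]
      · exfalso
        apply hφ
        ext y
        have := hx2 y
        rw [← Algebra.smul_def, map_smul, smul_eq_mul] at this
        simpa [hc] using this
    have hnt : Nontrivial O := by
      by_contra hs
      rw [not_nontrivial_iff_subsingleton] at hs
      exact hφ (by ext x; rw [Subsingleton.elim x 0]; simp)
    have h4 : Module.finrank K (1 : Submodule K O) = 1 := by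
      rw [Submodule.one_eq_span]
      exact finrank_span_singleton one_ne_zero
    rw [h3, finrank_bot, h4] at h1
    omega
  | succ m ih =>
    have hbig : n + 1 < Module.finrank K (O ⧸ annIdeal φ) := by
      by_contra! hle
      refine sup_annIdeal_ne_top hφ (fun a ha => hV a ?_) (h.sup_eq_top hle)
      exact pow_le_pow_of_one_mem h.one_mem (Nat.le_add_left 1 m) (by simpa using ha)
    obtain ⟨𝔞, hJ𝔞, h𝔞⟩ := exists_ideal_colength (K := K) (annIdeal φ) n (by omega)
    obtain ⟨f, hfV, hf𝔞, hf0⟩ := exists_ne_zero_mem_inf (K := K) (V := V) (𝔞 := 𝔞)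
      (by rw [h.finrank_eq]; omega)
    have hfJ : f ∉ annIdeal φ := by
      intro hf
      have h1 := h.colength_span_singleton_le hfV hf0
      have h2 := finrank_quotient_le_of_le (K := K)
        ((Ideal.span_singleton_le_iff_mem (I := annIdeal φ)).2 hf)
      omega
    have hf1 : f ∈ V ^ 1 := by simpa using hfV
    have hV' := mulFunctional_pow_eq_zero hV (Nat.add_comm 1 m) hf1
    have hih := ih (mulFunctional f φ) (mulFunctional_ne_zero hfJ) hV'
    have hdim : Module.finrank K (O ⧸ annIdeal (mulFunctional f φ)) + n ≤
        Module.finrank K (O ⧸ annIdeal φ) := by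
      let T : O →ₗ[K] O ⧸ annIdeal φ :=
        (Ideal.Quotient.mkₐ K (annIdeal φ)).toLinearMap.comp (LinearMap.mulLeft K f)
      let T' : O ⧸ annIdeal φ →ₗ[K] O ⧸ 𝔞 := (Ideal.Quotient.factorₐ K hJ𝔞).toLinearMap
      have hT' : Function.Surjective T' := Ideal.Quotient.factor_surjective hJ𝔞
      have hrange : LinearMap.range T ≤ LinearMap.ker T' := by
        rintro _ ⟨x, rfl⟩
        rw [LinearMap.mem_ker]
        change Ideal.Quotient.factor hJ𝔞 (Ideal.Quotient.mk _ (f * x)) = 0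
        rw [Ideal.Quotient.factor_mk, Ideal.Quotient.eq_zero_iff_mem]
        exact Ideal.mul_mem_right _ _ hf𝔞
      have hker : LinearMap.ker T = (annIdeal (mulFunctional f φ)).restrictScalars K := by
        ext x
        rw [LinearMap.mem_ker, Submodule.restrictScalars_mem, mem_annIdeal_mulFunctional]
        exact Ideal.Quotient.eq_zero_iff_mem
      have h1 := LinearMap.finrank_range_add_finrank_ker T
      have h2 := LinearMap.finrank_range_add_finrank_ker T'
      rw [LinearMap.range_eq_top.2 hT', finrank_top, h𝔞] at h2
      have h3 := Submodule.finrank_mono hrange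
      have h4 := finrank_quotient_add (K := K) (annIdeal (mulFunctional f φ))
      rw [hker] at h1
      omega
    rw [Nat.mul_succ]
    omega

theorem pow_sup_eq_top (h : IsLGP V n) {m : ℕ} {𝔞 : Ideal O}
    (h𝔞 : Module.finrank K (O ⧸ 𝔞) ≤ n * m + 1) : V ^ m ⊔ 𝔞.restrictScalars K = ⊤ := by
  by_contra hne
  obtain ⟨φ, hφ, hle⟩ := Submodule.exists_le_ker_of_lt_top _ (lt_top_iff_ne_top.2 hne)
  have h1 := h.le_colength_annIdeal m φ hφ fun a ha => hle (Submodule.mem_sup_left ha)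
  have h2 : 𝔞 ≤ annIdeal φ := fun a ha b =>
    hle (Submodule.mem_sup_right (Ideal.mul_mem_right b 𝔞 ha))
  have h3 := finrank_quotient_le_of_le (K := K) h2
  omega

section Nondegenerate

variable {φ : O →ₗ[K] K} {q : ℕ}

theorem le_finrank_range_mulLeft (h : IsLGP V n) (hφ : annIdeal φ = ⊥)
    (hV : ∀ a ∈ V ^ q, φ a = 0) {i j : ℕ} (hij : i + j = q) {f : O} (hf : f ∈ V ^ i)
    (hf0 : f ≠ 0) : n * j + 2 ≤ Module.finrank K (LinearMap.range (LinearMap.mulLeft K f)) := by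
  have hfJ : f ∉ annIdeal φ := by simpa [hφ] using hf0
  have h1 := h.le_colength_annIdeal j (mulFunctional f φ) (mulFunctional_ne_zero hfJ)
    (mulFunctional_pow_eq_zero hV hij hf)
  have hker : LinearMap.ker (LinearMap.mulLeft K f) =
      (annIdeal (mulFunctional f φ)).restrictScalars K := by
    ext x
    rw [LinearMap.mem_ker, Submodule.restrictScalars_mem, mem_annIdeal_mulFunctional, hφ]
    simp
  have h2 := LinearMap.finrank_range_add_finrank_ker (LinearMap.mulLeft K f)
  have h3 := finrank_quotient_add (K := K) (annIdeal (mulFunctional f φ))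
  rw [hker] at h2
  omega

/-- The multiplication `V ^ i × V ^ j → O` has no zero divisors for small `i + j`. -/
theorem eq_zero_or_eq_zero (h : IsLGP V n) (hφ : annIdeal φ = ⊥)
    (hV : ∀ a ∈ V ^ q, φ a = 0) (hd : Module.finrank K O ≤ n * q + n + 1) {i j : ℕ}
    (hij : i + j + 1 ≤ q) {f g : O} (hf : f ∈ V ^ i) (hg : g ∈ V ^ j) (hfg : f * g = 0) :
    f = 0 ∨ g = 0 := by
  by_contra! hne
  obtain ⟨i', hi'⟩ := Nat.exists_eq_add_of_le (show i ≤ q by omega)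
  obtain ⟨j', hj'⟩ := Nat.exists_eq_add_of_le (show j ≤ q by omega)
  have h1 := h.le_finrank_range_mulLeft hφ hV hi'.symm hf hne.1
  have h2 := h.le_finrank_range_mulLeft hφ hV hj'.symm hg hne.2
  have h3 := LinearMap.finrank_range_add_finrank_ker (LinearMap.mulLeft K f)
  have h4 : LinearMap.range (LinearMap.mulLeft K g) ≤ LinearMap.ker (LinearMap.mulLeft K f) := by
    rintro _ ⟨x, rfl⟩
    simp [← mul_assoc, hfg]
  have h5 := Submodule.finrank_mono h4
  have h6 : n * (q + 1) ≤ n * (i' + j') := Nat.mul_le_mul_left n (by omega)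
  rw [Nat.mul_add, Nat.mul_add] at h6
  omega

theorem finrank_pow_add_le_of_lt_finrank_sq (h : IsLGP V n) (hφ : annIdeal φ = ⊥)
    (hV : ∀ a ∈ V ^ q, φ a = 0) (hd : Module.finrank K O ≤ n * q + n + 1)
    (h2 : 2 * n + 1 < Module.finrank K (V ^ 2 : Submodule K O)) {i : ℕ} (hi : i + 3 ≤ q) :
    Module.finrank K (V ^ i : Submodule K O) + (2 * n + 1) ≤
      Module.finrank K (V ^ (i + 2) : Submodule K O) := by
  obtain ⟨𝔞, -, h𝔞⟩ := exists_ideal_colength (K := K) (⊥ : Ideal O) (2 * n + 1) (by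
    have h1 := Submodule.finrank_le (V ^ 2 : Submodule K O)
    have h2 := finrank_quotient_add (K := K) (⊥ : Ideal O)
    rw [Submodule.restrictScalars_bot, finrank_bot] at h2
    omega)
  obtain ⟨f, hfV, hf𝔞, hf0⟩ := exists_ne_zero_mem_inf (K := K) (V := V ^ 2) (𝔞 := 𝔞) (by omega)
  have htop : V ^ (i + 2) ⊔ 𝔞.restrictScalars K = ⊤ := by
    rw [eq_top_iff, ← h.pow_sup_eq_top (m := 2) (𝔞 := 𝔞) (by omega)]
    exact sup_le_sup_right (pow_le_pow_of_one_mem h.one_mem (by omega)) _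
  have h3 := finrank_eq_inf_add_colength htop
  have h4 : (V ^ i).map (LinearMap.mulLeft K f) ≤ V ^ (i + 2) ⊓ 𝔞.restrictScalars K := by
    rintro _ ⟨g, hg, rfl⟩
    refine ⟨?_, Ideal.mul_mem_right _ _ hf𝔞⟩
    rw [add_comm, pow_add]
    exact Submodule.mul_mem_mul hfV hg
  have h5 := Submodule.finrank_mono h4
  rw [finrank_map_eq fun g hg hfg =>
    (h.eq_zero_or_eq_zero hφ hV hd (by omega) hfV hg hfg).resolve_left hf0] at h5
  omega

theorem finrank_sq_le (h : IsLGP V n) (hφ : annIdeal φ = ⊥)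
    (hV : ∀ a ∈ V ^ q, φ a = 0) (hd : Module.finrank K O ≤ n * q + n + 1) (hn : 1 ≤ n)
    (hq : 2 * n + 1 ≤ q) :
    Module.finrank K (V ^ 2 : Submodule K O) ≤ 2 * n + 1 := by
  by_contra! h2
  have hnt : Nontrivial O := by
    by_contra hs
    rw [not_nontrivial_iff_subsingleton] at hs
    rw [Module.finrank_zero_of_subsingleton] at h2
    omega
  have step : ∀ ε k, 2 * k + ε + 1 ≤ q →
      Module.finrank K (V ^ ε : Submodule K O) + k * (2 * n + 1) ≤
        Module.finrank K (V ^ (2 * k + ε) : Submodule K O) := by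
    intro ε k
    induction k with
    | zero =>
      intro _
      rw [show 2 * 0 + ε = ε by omega]
      omega
    | succ k ih =>
      intro hk
      have h1 := ih (by omega)
      have h3 := h.finrank_pow_add_le_of_lt_finrank_sq hφ hV hd h2 (i := 2 * k + ε) (by omega)
      rw [show 2 * (k + 1) + ε = 2 * k + ε + 2 by ring, Nat.succ_mul]
      omega
  have hpair := finrank_pow_add_finrank_pow_le hφ hV (show (q - 2) + 2 = q by omega)
  obtain ⟨k, hk | hk⟩ := Nat.even_or_odd' (q - 2)
  · have h1 := step 0 k (by omega)
    rw [pow_zero, Submodule.one_eq_span, finrank_span_singleton one_ne_zero, add_zero, ← hk] at h1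
    obtain rfl : q = 2 * k + 2 := by omega
    nlinarith
  · have h1 := step 1 k (by omega)
    rw [pow_one, h.finrank_eq, ← hk] at h1
    obtain rfl : q = 2 * k + 3 := by omega
    nlinarith

end Nondegenerate

section Chain

/-- Elements `x₀, …, xₖ` in geometric progression of ratio `a / b` are linearly independent. -/
theorem eq_zero_of_sum_chain_eq_zero {a b : O} (hab : ∀ (c : K) (y : O), y ∈ V →
      (a - c • b) * y = 0 → y = 0) (k : ℕ) (x : ℕ → O) (hxV : ∀ j ≤ k, x j ∈ V) (hx0 : x 0 ≠ 0)
    (hx : ∀ j < k, a * x j = b * x (j + 1)) (P : Polynomial K) (hP : P.natDegree ≤ k)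
    (hsum : ∑ j ∈ Finset.range (k + 1), P.coeff j • x j = 0) : P = 0 := by
  induction k generalizing x P with
  | zero =>
    rw [Polynomial.eq_C_of_natDegree_le_zero hP] at hsum ⊢
    simpa [hx0] using hsum
  | succ k ih =>
    by_contra hne
    by_cases hdeg : P.natDegree ≤ k
    · refine hne (ih x (fun j hj => hxV j (by omega)) hx0 (fun j hj => hx j (by omega)) P hdeg ?_)
      rw [Finset.sum_range_succ, Polynomial.coeff_eq_zero_of_natDegree_lt (by omega), zero_smul,
        add_zero] at hsum
      exact hsum
    · obtain ⟨c, hc⟩ := IsAlgClosed.exists_root P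
        (by rw [Polynomial.degree_eq_natDegree hne]; exact_mod_cast (by omega))
      obtain ⟨Q, rfl⟩ := Polynomial.dvd_iff_isRoot.2 hc
      have hQ0 : Q ≠ 0 := right_ne_zero_of_mul hne
      rw [Polynomial.natDegree_mul (Polynomial.X_sub_C_ne_zero c) hQ0,
        Polynomial.natDegree_X_sub_C] at hP
      refine hQ0 (ih (fun j => x (j + 1) - c • x j) ?_ ?_ ?_ Q (by omega) ?_)
      · exact fun j hj => V.sub_mem (hxV _ (by omega)) (V.smul_mem _ (hxV _ (by omega)))
      · intro h0
        refine hx0 (hab c _ (hxV 0 (by omega)) ?_)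
        rw [sub_mul, hx 0 (by omega), sub_eq_zero.1 h0, smul_mul_assoc, mul_smul_comm, sub_self]
      · intro j hj
        simp only [mul_sub, mul_smul_comm, hx j (by omega), hx (j + 1) (by omega)]
      · rw [← hsum, Finset.sum_range_succ' _ (k + 1)]
        have hcoeff : ∀ j, ((Polynomial.X - Polynomial.C c) * Q).coeff (j + 1) =
            Q.coeff j - c * Q.coeff (j + 1) := by
          intro j
          rw [sub_mul, Polynomial.coeff_sub, Polynomial.coeff_X_mul, Polynomial.coeff_C_mul]
        have hcoeff0 : ((Polynomial.X - Polynomial.C c) * Q).coeff 0 = - (c * Q.coeff 0) := by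
          rw [sub_mul, Polynomial.coeff_sub, Polynomial.coeff_X_mul_zero, Polynomial.coeff_C_mul,
            zero_sub]
        simp only [hcoeff, hcoeff0, sub_smul, smul_sub, Finset.sum_sub_distrib, mul_smul, neg_smul,
          smul_comm _ c]
        have htel := Finset.sum_range_succ' (fun j => c • Q.coeff j • x j) (k + 1)
        rw [Finset.sum_range_succ, Polynomial.coeff_eq_zero_of_natDegree_lt (by omega : _ < k + 1),
          zero_smul, smul_zero, add_zero] at htel
        rw [htel, Finset.sum_range_succ (fun j => c • Q.coeff (j + 1) • x (j + 1)) k]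
        abel

theorem linearIndependent_chain {a b : O} (hab : ∀ (c : K) (y : O), y ∈ V →
      (a - c • b) * y = 0 → y = 0) (k : ℕ) (x : ℕ → O) (hxV : ∀ j ≤ k, x j ∈ V) (hx0 : x 0 ≠ 0)
    (hx : ∀ j < k, a * x j = b * x (j + 1)) :
    LinearIndependent K fun j : Fin (k + 1) => x j := by
  rw [Fintype.linearIndependent_iff]
  intro g hg i
  have hP := eq_zero_of_sum_chain_eq_zero hab k x hxV hx0 hx (Polynomial.ofFn (k + 1) g)
    (Nat.le_of_lt_succ (Polynomial.ofFn_natDegree_lt (by omega) g)) (by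
      rw [← hg, Finset.sum_range]
      refine Finset.sum_congr rfl fun j _ => ?_
      rw [Polynomial.ofFn_coeff_eq_val_of_lt g j.2])
  rw [← Polynomial.ofFn_coeff_eq_val_of_lt g i.2, hP, Polynomial.coeff_zero]

/-- The `v ∈ V` that start a geometric progression `v, v₁, …, vₖ` of ratio `a / b` in `V`. -/
def chainSubmodule (V : Submodule K O) (a b : O) : ℕ → Submodule K O
  | 0 => V
  | k + 1 => ((chainSubmodule V a b k).map (LinearMap.mulLeft K b)).comap (LinearMap.mulLeft K a) ⊓ V

variable {φ : O →ₗ[K] K} {q : ℕ}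

theorem exists_chain (h : IsLGP V n) (hφ : annIdeal φ = ⊥)
    (hV : ∀ a ∈ V ^ q, φ a = 0) (hd : Module.finrank K O ≤ n * q + n + 1) (hn : 1 ≤ n)
    (hq : 3 ≤ q) (h2 : Module.finrank K (V ^ 2 : Submodule K O) ≤ 2 * n + 1) :
    ∃ (a b : O) (x : ℕ → O), a ∈ V ∧ b ∈ V ∧ LinearIndependent K ![a, b] ∧
      (∀ j ≤ n, x j ∈ V) ∧ x 0 ≠ 0 ∧ ∀ j < n, a * x j = b * x (j + 1) := by
  obtain ⟨𝔞, -, h𝔞⟩ := exists_ideal_colength (K := K) (⊥ : Ideal O) (n - 1) (by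
    have h1 := Submodule.finrank_le V
    have h2 := finrank_quotient_add (K := K) (⊥ : Ideal O)
    have h3 := h.finrank_eq
    rw [Submodule.restrictScalars_bot, finrank_bot] at h2
    omega)
  have hinf := finrank_le_inf_add_colength V 𝔞
  rw [h.finrank_eq] at hinf
  have hpos : 0 < Module.finrank K (V ⊓ 𝔞.restrictScalars K : Submodule K O) := by omega
  obtain ⟨⟨a, haV, ha𝔞⟩, ha0⟩ := @exists_ne _ (Module.nontrivial_of_finrank_pos hpos) 0
  obtain ⟨⟨b, hbV, hb𝔞⟩, hind⟩ := exists_linearIndependent_pair_of_one_lt_finrank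
    (R := K) (M := (V ⊓ 𝔞.restrictScalars K : Submodule K O)) (by omega) ha0
  have hind' : LinearIndependent K ![a, b] := by
    rw [LinearIndependent.pair_iff] at hind ⊢
    exact fun s t hst => hind s t (Subtype.ext hst)
  have ha0' : a ≠ 0 := hind'.ne_zero 0
  have hb0' : b ≠ 0 := hind'.ne_zero 1
  have hzero : ∀ f ∈ V, f ≠ 0 → ∀ g ∈ V, f * g = 0 → g = 0 := fun f hf hf0 g hg hfg =>
    (h.eq_zero_or_eq_zero hφ hV hd (i := 1) (j := 1) (by omega) (by simpa using hf)
      (by simpa using hg) hfg).resolve_left hf0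
  have hsq : Module.finrank K (V ^ 2 ⊓ 𝔞.restrictScalars K : Submodule K O) ≤ n + 2 := by
    have htop : V ^ 2 ⊔ 𝔞.restrictScalars K = ⊤ := by
      rw [eq_top_iff, ← h.sup_eq_top (𝔞 := 𝔞) (by omega)]
      exact sup_le_sup_right (by simpa using pow_le_pow_of_one_mem h.one_mem one_le_two) _
    have := finrank_eq_inf_add_colength htop
    omega
  have hmul : ∀ f ∈ V, f ∈ 𝔞 → ∀ W ≤ V, W.map (LinearMap.mulLeft K f) ≤
      V ^ 2 ⊓ 𝔞.restrictScalars K := by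
    rintro f hf hf𝔞 W hW _ ⟨g, hg, rfl⟩
    exact ⟨by rw [pow_two]; exact Submodule.mul_mem_mul hf (hW hg), Ideal.mul_mem_right _ _ hf𝔞⟩
  set S := chainSubmodule V a b
  have hSV : ∀ k : ℕ, S k ≤ V := fun k => by
    cases k with
    | zero => exact le_rfl
    | succ k => exact inf_le_right
  have hSdim : ∀ k : ℕ, n + 1 ≤ Module.finrank K ↥(S k) + k := by
    intro k
    induction k with
    | zero => exact h.finrank_eq.ge
    | succ k ih =>
      have h3 := Submodule.finrank_sup_add_finrank_inf_eq (V.map (LinearMap.mulLeft K a))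
        ((S k).map (LinearMap.mulLeft K b))
      rw [finrank_map_eq (hzero a haV ha0'),
        finrank_map_eq fun g hg => hzero b hbV hb0' g (hSV k hg), h.finrank_eq] at h3
      have h4 := Submodule.finrank_mono
        (sup_le (hmul a haV ha𝔞 V le_rfl) (hmul b hbV hb𝔞 (S k) (hSV k)))
      have h5 : V.map (LinearMap.mulLeft K a) ⊓ (S k).map (LinearMap.mulLeft K b) ≤
          (S (k + 1)).map (LinearMap.mulLeft K a) := by
        rintro _ ⟨⟨g, hg, rfl⟩, hg'⟩
        exact ⟨g, ⟨hg', hg⟩, rfl⟩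
      have h6 := Submodule.finrank_mono h5
      rw [finrank_map_eq fun g hg => hzero a haV ha0' g (hSV (k + 1) hg)] at h6
      omega
  have hunfold : ∀ k : ℕ, ∀ v ∈ S k, ∃ x : ℕ → O, x 0 = v ∧ (∀ j ≤ k, x j ∈ V) ∧
      ∀ j < k, a * x j = b * x (j + 1) := by
    intro k
    induction k with
    | zero =>
      intro v hv
      refine ⟨fun _ => v, rfl, fun _ _ => hv, fun j hj => absurd hj (Nat.not_lt_zero j)⟩
    | succ k ih =>
      rintro v ⟨⟨w, hw, hwv⟩, hv⟩
      obtain ⟨x, hx0, hxV, hx⟩ := ih w hw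
      refine ⟨fun j => Nat.casesOn j v x, rfl, ?_, ?_⟩
      · rintro (_ | j) hj
        · exact hv
        · exact hxV j (by omega)
      · rintro (_ | j) hj
        · change a * v = b * x 0
          rw [hx0]
          exact hwv.symm
        · exact hx j (by omega)
  have hSn : S n ≠ ⊥ := by
    intro h0
    have := hSdim n
    rw [h0, finrank_bot] at this
    omega
  obtain ⟨v, hv, hv0⟩ := Submodule.exists_mem_ne_zero_of_ne_bot hSn
  obtain ⟨x, rfl, hxV, hx⟩ := hunfold n v hv
  exact ⟨a, b, x, haV, hbV, hind', hxV, hv0, hx⟩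

/-- The linear forms on the scheme have a basis `x₀, …, xₙ` satisfying the equations of a
rational normal curve. -/
theorem exists_basis_quadrics (h : IsLGP V n) (hφ : annIdeal φ = ⊥)
    (hV : ∀ a ∈ V ^ q, φ a = 0) (hd : Module.finrank K O ≤ n * q + n + 1) (hn : 1 ≤ n)
    (hq : 2 * n + 2 ≤ q) :
    ∃ x : ℕ → O, (∀ j ≤ n, x j ∈ V) ∧ LinearIndependent K (fun j : Fin (n + 1) => x j) ∧
      ∀ i < n, ∀ j < n, x i * x (j + 1) = x (i + 1) * x j := by
  obtain ⟨a, b, x, haV, hbV, hind, hxV, hx0, hx⟩ := h.exists_chain hφ hV hd hn (by omega)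
    (h.finrank_sq_le hφ hV hd hn (by omega))
  have hpow1 : ∀ {f}, f ∈ V → f ∈ V ^ 1 := fun hf => by simpa using hf
  refine ⟨x, hxV, linearIndependent_chain ?_ n x hxV hx0 hx, fun i hi j hj => ?_⟩
  · intro c y hy hcy
    refine (h.eq_zero_or_eq_zero hφ hV hd (i := 1) (j := 1) (by omega)
      (hpow1 (V.sub_mem haV (V.smul_mem c hbV))) (hpow1 hy) hcy).resolve_left fun h0 => ?_
    have := LinearIndependent.pair_iff.1 hind 1 (-c) (by rw [← h0]; module)
    exact one_ne_zero this.1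
  · have hb : b * (x i * x (j + 1) - x (i + 1) * x j) = 0 := by
      linear_combination (x j) * hx i hi - (x i) * hx j hj
    have hmem : x i * x (j + 1) - x (i + 1) * x j ∈ V ^ 2 := by
      rw [pow_two]
      exact Submodule.sub_mem _
        (Submodule.mul_mem_mul (hxV i (by omega)) (hxV (j + 1) (by omega)))
        (Submodule.mul_mem_mul (hxV (i + 1) (by omega)) (hxV j (by omega)))
    exact sub_eq_zero.1 ((h.eq_zero_or_eq_zero hφ hV hd (i := 1) (j := 2) (by omega) (hpow1 hbV)
      hmem hb).resolve_left (hind.ne_zero 1))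

end Chain

end IsLGP

/-- `L` is the restriction of linear forms to a finite scheme with coordinate ring `O`, embedded
in `ℙⁿ` in linearly general position. -/
structure IsLGPMap {n : ℕ} (L : (Fin (n + 1) → K) →ₗ[K] O) : Prop where
  one_mem : (1 : O) ∈ LinearMap.range L
  colength_le : ∀ W : Submodule K (Fin (n + 1) → K), W ≠ ⊥ →
    Module.finrank K (O ⧸ Ideal.span (W.map L : Set O)) + Module.finrank K W ≤ n + 1

namespace IsLGPMap

variable [FiniteDimensional K O] {n : ℕ} {L : (Fin (n + 1) → K) →ₗ[K] O}

theorem ker_eq_bot (h : IsLGPMap L) (hO : n < Module.finrank K O) : LinearMap.ker L = ⊥ := by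
  by_contra hne
  have h1 := h.colength_le _ hne
  have h2 : Ideal.span (((LinearMap.ker L).map L : Submodule K O) : Set O) = ⊥ := by
    rw [Ideal.span_eq_bot]
    rintro _ ⟨f, hf, rfl⟩
    exact hf
  have h3 := finrank_quotient_add (K := K) (⊥ : Ideal O)
  have h4 := Submodule.one_le_finrank_iff.2 hne
  rw [h2] at h1
  rw [Submodule.restrictScalars_bot, finrank_bot] at h3
  omega

theorem isLGP_range (h : IsLGPMap L) (hO : n < Module.finrank K O) :
    IsLGP (LinearMap.range L) n := by
  have hker := h.ker_eq_bot hO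
  refine ⟨h.one_mem, ?_, fun W hW hW0 => ?_⟩
  · rw [LinearMap.finrank_range_of_inj (LinearMap.ker_eq_bot.1 hker), Module.finrank_fin_fun]
  · have hmap : (W.comap L).map L = W := by rwa [Submodule.map_comap_eq, inf_eq_right]
    have h1 := h.colength_le (W.comap L) (by
      rintro h0
      rw [h0, Submodule.map_bot] at hmap
      exact hW0 hmap.symm)
    have h2 : Module.finrank K ((W.comap L).map L) = Module.finrank K (W.comap L) :=
      finrank_map_eq fun g _ hg => (LinearMap.ker_eq_bot'.1 hker) g hg
    rw [hmap] at h1 h2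
    rwa [h2]

theorem quotient (h : IsLGPMap L) (J : Ideal O) :
    IsLGPMap ((Ideal.Quotient.mkₐ K J).toLinearMap.comp L) := by
  refine ⟨?_, fun W hW => ?_⟩
  · obtain ⟨v, hv⟩ := h.one_mem
    exact ⟨v, by simp [hv]⟩
  · refine (Nat.add_le_add_right ?_ _).trans (h.colength_le W hW)
    have hle : Ideal.span (W.map L : Set O) ≤ (Ideal.span (W.map
        ((Ideal.Quotient.mkₐ K J).toLinearMap.comp L) : Set (O ⧸ J))).comap
          (Ideal.Quotient.mkₐ K J) := by
      rw [Ideal.span_le]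
      rintro _ ⟨v, hv, rfl⟩
      exact Ideal.subset_span ⟨v, hv, rfl⟩
    exact LinearMap.finrank_le_finrank_of_surjective
      (f := (Ideal.quotientMapₐ _ (Ideal.Quotient.mkₐ K J) hle).toLinearMap)
      (Ideal.quotientMap_surjective (H := hle) (Ideal.Quotient.mkₐ_surjective K J))

variable [IsAlgClosed K]

/-- A long scheme in linearly general position failing to be `q`-normal contains a large
subscheme whose linear forms satisfy the equations of a rational normal curve. -/
theorem exists_quotient_quadrics (h : IsLGPMap L) (hn : 1 ≤ n) {q : ℕ} (hq : 2 * n + 2 ≤ q)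
    (hd : Module.finrank K O ≤ n * q + n + 1) (hO : n < Module.finrank K O)
    (hne : (LinearMap.range L) ^ q ≠ ⊤) :
    ∃ J : Ideal O, n * q + 2 ≤ Module.finrank K (O ⧸ J) ∧ ∃ x : ℕ → O ⧸ J,
      Submodule.span K (Set.range fun j : Fin (n + 1) => x j) =
        LinearMap.range ((Ideal.Quotient.mkₐ K J).toLinearMap.comp L) ∧
      LinearIndependent K (fun j : Fin (n + 1) => x j) ∧
      ∀ i < n, ∀ j < n, x i * x (j + 1) = x (i + 1) * x j := by
  obtain ⟨φ, hφ, hle⟩ := Submodule.exists_le_ker_of_lt_top _ (lt_top_iff_ne_top.2 hne)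
  have hJ := (h.isLGP_range hO).le_colength_annIdeal q φ hφ fun a ha => hle ha
  set J := annIdeal φ
  have hnq : n ≤ n * q := Nat.le_mul_of_pos_right n (by omega)
  have hlgp := (h.quotient J).isLGP_range (by omega)
  let φ' : O ⧸ J →ₗ[K] K := ((J.restrictScalars K).liftQ φ fun a ha =>
    apply_eq_zero_of_mem_annIdeal ha).comp
      (Submodule.Quotient.restrictScalarsEquiv K J).symm.toLinearMap
  have hφ' : ∀ a, φ' (Ideal.Quotient.mk J a) = φ a := fun a => rfl
  have hann : annIdeal φ' = ⊥ := by
    rw [eq_bot_iff]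
    intro y hy
    obtain ⟨a, rfl⟩ := Ideal.Quotient.mk_surjective y
    rw [Ideal.mem_bot, Ideal.Quotient.eq_zero_iff_mem]
    intro b
    rw [← hφ', map_mul]
    exact hy _
  have hV : ∀ a ∈ (LinearMap.range ((Ideal.Quotient.mkₐ K J).toLinearMap.comp L)) ^ q,
      φ' a = 0 := by
    rw [LinearMap.range_comp, ← Submodule.map_pow]
    rintro _ ⟨a, ha, rfl⟩
    exact hle ha
  have hdJ := finrank_quotient_add (K := K) J
  obtain ⟨x, hxV, hind, hx⟩ := hlgp.exists_basis_quadrics hann hV (by omega) hn hq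
  refine ⟨J, hJ, x, ?_, hind, hx⟩
  apply Submodule.eq_of_le_of_finrank_eq
  · rw [Submodule.span_le]
    rintro _ ⟨j, rfl⟩
    exact hxV j (by omega)
  · rw [finrank_span_eq_card hind, hlgp.finrank_eq, Fintype.card_fin]

/-- The regularity bound for schemes in linearly general position. -/
theorem range_pow_eq_top (h : IsLGPMap L) (hO : n < Module.finrank K O) {m : ℕ}
    (hm : Module.finrank K O ≤ n * m + 1) : (LinearMap.range L) ^ m = ⊤ := by
  have h1 := (h.isLGP_range hO).pow_sup_eq_top (m := m) (𝔞 := ⊥) (by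
    have := finrank_quotient_add (K := K) (⊥ : Ideal O)
    omega)
  simpa using h1

end IsLGPMap

end Algebra

section RationalNormalCurve

section Quadrics

variable {A : Type*} [CommRing A] {n : ℕ} {x : ℕ → A}

theorem mul_shift_eq_of_quadrics (hx : ∀ i < n, ∀ j < n, x i * x (j + 1) = x (i + 1) * x j)
    (k : ℕ) {i j : ℕ} (hi : i + k ≤ n) (hj : j + k ≤ n) : x i * x (j + k) = x (i + k) * x j := by
  induction k generalizing i j with
  | zero => rfl
  | succ k ih =>
    rw [← add_assoc, hx i (by omega) (j + k) (by omega), ih (by omega) (by omega)]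
    congr 2
    omega

/-- The common value of the monomials of degree `m` and weight `w` in elements `x₀, …, xₙ`
satisfying the equations of a rational normal curve. -/
def weightMonomial (n : ℕ) (x : ℕ → A) (m w : ℕ) : A :=
  if w = n * m then x n ^ m else x n ^ (w / n) * x (w % n) * x 0 ^ (m - 1 - w / n)

theorem weightMonomial_mul (hn : 1 ≤ n)
    (hx : ∀ i < n, ∀ j < n, x i * x (j + 1) = x (i + 1) * x j) {m w j : ℕ} (hw : w ≤ n * m)
    (hj : j ≤ n) : weightMonomial n x m w * x j = weightMonomial n x (m + 1) (w + j) := by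
  unfold weightMonomial
  rw [Nat.mul_succ]
  by_cases hwm : w = n * m
  · subst hwm
    rcases hj.lt_or_eq with hj | rfl
    · rw [if_pos rfl, if_neg (by omega), Nat.mul_add_div (by omega), Nat.div_eq_of_lt hj,
        Nat.mul_add_mod, Nat.mod_eq_of_lt hj]
      simp
    · rw [if_pos rfl, if_pos rfl, pow_succ]
  · rw [if_neg hwm, if_neg (by omega)]
    have hdm := Nat.div_add_mod w n
    have hr := Nat.mod_lt w (show 0 < n by omega)
    have hk : w / n < m := Nat.div_lt_of_lt_mul (by omega)
    generalize w / n = k at *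
    generalize w % n = r at *
    subst hdm
    rw [add_assoc]
    by_cases hrj : r + j < n
    · rw [Nat.mul_add_div (by omega), Nat.div_eq_of_lt hrj, Nat.mul_add_mod,
        Nat.mod_eq_of_lt hrj, add_zero, show m + 1 - 1 - k = (m - 1 - k) + 1 by omega, pow_succ]
      have := mul_shift_eq_of_quadrics hx j (i := 0) (j := r) (by omega) (by omega)
      rw [zero_add] at this
      linear_combination (-(x n ^ k * x 0 ^ (m - 1 - k))) * this
    · obtain ⟨s, hs⟩ := Nat.exists_eq_add_of_le (not_lt.1 hrj)
      rw [hs, Nat.mul_add_div (by omega), Nat.mul_add_mod, Nat.add_div_left _ (by omega),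
        Nat.div_eq_of_lt (by omega), Nat.add_mod_left, Nat.mod_eq_of_lt (by omega),
        show m + 1 - 1 - (k + (0 + 1)) = m - 1 - k by omega, zero_add, pow_succ]
      obtain ⟨t, rfl⟩ := Nat.exists_eq_add_of_le hj
      obtain rfl : r = s + t := by omega
      have := mul_shift_eq_of_quadrics hx t (i := j) (j := s) (by omega) (by omega)
      linear_combination (x (j + t) ^ k * x 0 ^ (m - 1 - k)) * this

end Quadrics

variable {K : Type} [Field K] {n : ℕ}

/-- The monomial basis of the binary forms of degree `n`. -/
noncomputable def binaryMonomial (K : Type) [Field K] (n : ℕ) (j : ℕ) : MvPolynomial (Fin 2) K :=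
  X 0 ^ (n - j) * X 1 ^ j

theorem span_binaryMonomial :
    Submodule.span K (Set.range fun j : Fin (n + 1) => binaryMonomial K n j) =
      homogeneousSubmodule (Fin 2) K n := by
  apply le_antisymm
  · rw [Submodule.span_le]
    rintro _ ⟨j, rfl⟩
    have h := (isHomogeneous_X_pow (R := K) (0 : Fin 2) (n - j)).mul
      (isHomogeneous_X_pow (R := K) (1 : Fin 2) (j : ℕ))
    rwa [Nat.sub_add_cancel (Nat.le_of_lt_succ j.2)] at h
  · intro p hp
    rw [p.as_sum]
    refine Submodule.sum_mem _ fun β hβ => ?_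
    have hdeg : n = β 0 + β 1 := by
      rw [hp.degree_eq_sum_deg_support hβ, ← Fin.sum_univ_two]
      exact Finset.sum_subset (Finset.subset_univ _) (by simp)
    have hmon : monomial β (coeff β p) =
        coeff β p • binaryMonomial K n (⟨β 1, by omega⟩ : Fin (n + 1)) := by
      rw [binaryMonomial, monomial_eq, smul_eq_C_mul, Finsupp.prod_fintype _ _ (by simp),
        Fin.prod_univ_two]
      congr 3
      simp only
      omega
    rw [hmon]
    exact Submodule.smul_mem _ _ (Submodule.subset_span ⟨_, rfl⟩)

theorem finrank_homogeneousSubmodule_le (m : ℕ) :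
    Module.finrank K (homogeneousSubmodule (Fin 2) K m) ≤ m + 1 := by
  rw [← span_binaryMonomial]
  exact (finrank_range_le_card _).trans (by simp)

variable {A : Type*} [CommRing A] [Algebra K A]

theorem aeval_eq_zero_of_quadrics {x : ℕ → A} (hn : 1 ≤ n)
    (hx : ∀ i < n, ∀ j < n, x i * x (j + 1) = x (i + 1) * x j)
    {F : MvPolynomial (Fin (n + 1)) K}
    (hF : aeval (fun j : Fin (n + 1) => binaryMonomial K n j) F = 0) :
    aeval (fun j : Fin (n + 1) => x j) F = 0 := by
  have hmon : ∀ (α : Fin (n + 1) →₀ ℕ) (c : K), ∃ m w : ℕ, ∃ c' : K, w ≤ n * m ∧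
      aeval (fun j : Fin (n + 1) => binaryMonomial K n j) (monomial α c) =
        c' • (X 0 ^ (n * m - w) * X 1 ^ w) ∧
      aeval (fun j : Fin (n + 1) => x j) (monomial α c) = c' • weightMonomial n x m w := by
    refine induction_on_monomial (fun a => ⟨0, 0, a, le_rfl, by simp [Algebra.smul_def], by
      simp [Algebra.smul_def, weightMonomial]⟩) ?_
    rintro p j ⟨m, w, c', hw, h1, h2⟩
    have hj : (j : ℕ) ≤ n := Nat.le_of_lt_succ j.2
    refine ⟨m + 1, w + j, c', by rw [Nat.mul_succ]; omega, ?_, ?_⟩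
    · rw [map_mul, h1, aeval_X, smul_mul_assoc, binaryMonomial,
        show n * (m + 1) - (w + j) = (n * m - w) + (n - j) by rw [Nat.mul_succ]; omega]
      ring_nf
    · rw [map_mul, h2, aeval_X, smul_mul_assoc, weightMonomial_mul hn hx hw hj]
  let Ψ : MvPolynomial (Fin 2) K →ₗ[K] A := (basisMonomials (Fin 2) K).constr K fun β =>
    weightMonomial n x ((β 0 + β 1) / n) (β 1)
  have hΨ : ∀ m w : ℕ, w ≤ n * m → Ψ (X 0 ^ (n * m - w) * X 1 ^ w) = weightMonomial n x m w := by
    intro m w hw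
    have h1 : (X 0 ^ (n * m - w) * X 1 ^ w : MvPolynomial (Fin 2) K) =
        basisMonomials (Fin 2) K (Finsupp.single 0 (n * m - w) + Finsupp.single 1 w) := by
      rw [coe_basisMonomials, X_pow_eq_monomial, X_pow_eq_monomial, monomial_mul, one_mul]
    rw [h1, Module.Basis.constr_basis]
    simp [Nat.sub_add_cancel hw, Nat.mul_div_cancel_left m (show 0 < n by omega)]
  have hcomp : ∀ G : MvPolynomial (Fin (n + 1)) K,
      Ψ (aeval (fun j : Fin (n + 1) => binaryMonomial K n j) G) =
        aeval (fun j : Fin (n + 1) => x j) G := by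
    intro G
    induction G using MvPolynomial.induction_on' with
    | monomial α c =>
      obtain ⟨m, w, c', hw, h1, h2⟩ := hmon α c
      rw [h1, h2, map_smul, hΨ m w hw]
    | add p q hp hq => rw [map_add, map_add, map_add, hp, hq]
  rw [← hcomp F, hF, map_zero]

theorem mem_iInf_ker_eval [Infinite K] {p : Fin (n + 1) → MvPolynomial (Fin 2) K}
    {F : MvPolynomial (Fin (n + 1)) K} :
    F ∈ (⨅ x : Fin 2 → K, RingHom.ker (MvPolynomial.eval (fun i => MvPolynomial.eval x (p i)) :
        MvPolynomial (Fin (n+1)) K →+* K)) ↔ aeval p F = 0 := by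
  have key : ∀ y : Fin 2 → K, eval y (aeval p F) = eval (fun i => eval y (p i)) F := by
    intro y
    have h := MvPolynomial.comp_aeval_apply p (aeval y : MvPolynomial (Fin 2) K →ₐ[K] K) F
    simpa [coe_aeval_eq_eval] using h
  rw [Ideal.mem_iInf]
  simp only [RingHom.mem_ker, ← key]
  refine ⟨fun h => MvPolynomial.funext fun y => by rw [h y, map_zero], fun h y => by rw [h, map_zero]⟩

/-- A linear embedding whose linear forms have a basis satisfying the equations of the standard
rational normal curve factors through a rational normal curve. -/
theorem exists_isRNC [Infinite K] (hn : 1 ≤ n) {L : (Fin (n + 1) → K) →ₗ[K] A} {x : ℕ → A}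
    (hspan : Submodule.span K (Set.range fun j : Fin (n + 1) => x j) = LinearMap.range L)
    (hind : LinearIndependent K (fun j : Fin (n + 1) => x j))
    (hx : ∀ i < n, ∀ j < n, x i * x (j + 1) = x (i + 1) * x j) :
    ∃ J : Ideal (MvPolynomial (Fin (n + 1)) K), IsRNC n J ∧
      ∀ F ∈ J, aeval (fun k => L (Pi.single k 1)) F = 0 := by
  let B := Module.Basis.span hind
  let L' : (Fin (n + 1) → K) →ₗ[K] Submodule.span K (Set.range fun j : Fin (n + 1) => x j) :=
    L.codRestrict _ fun v => hspan ▸ LinearMap.mem_range_self L v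
  have hL' : LinearMap.range L' = ⊤ := by
    rw [LinearMap.range_codRestrict, ← hspan, Submodule.comap_subtype_self]
  let Θ := B.constr K fun j : Fin (n + 1) => binaryMonomial K n j
  have hp : Submodule.span K (Set.range fun k => Θ (L' (Pi.single k 1))) =
      homogeneousSubmodule (Fin 2) K n := by
    have h1 : (Set.range fun k : Fin (n + 1) => Θ (L' (Pi.single k 1))) =
        (Θ ∘ₗ L') '' Set.range (Pi.basisFun K (Fin (n + 1))) := by
      rw [← Set.range_comp]
      congr 1
      ext k
      simp
    rw [h1, Submodule.span_image, (Pi.basisFun K (Fin (n + 1))).span_eq, Submodule.map_comp,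
      ← LinearMap.range_eq_map, hL', ← LinearMap.range_eq_map, Module.Basis.constr_range,
      span_binaryMonomial]
  refine ⟨_, ⟨fun k => Θ (L' (Pi.single k 1)), fun k => ?_, hp, rfl⟩, fun F hF => ?_⟩
  · exact (mem_homogeneousSubmodule n _).1 (hp.le (Submodule.subset_span ⟨k, rfl⟩))
  · rw [mem_iInf_ker_eval] at hF
    let σ : Fin (n + 1) → MvPolynomial (Fin (n + 1)) K := fun k =>
      ∑ j, C (B.repr (L' (Pi.single k 1)) j) * X j
    have h1 : ∀ k, aeval (fun j : Fin (n + 1) => binaryMonomial K n j) (σ k) =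
        Θ (L' (Pi.single k 1)) := by
      intro k
      simp only [σ, map_sum, map_mul, aeval_X, algHom_C, Θ, Module.Basis.constr_apply_fintype,
        Algebra.smul_def]
      rfl
    have h2 : ∀ k, aeval (fun j : Fin (n + 1) => x j) (σ k) = L (Pi.single k 1) := by
      intro k
      have := congrArg Subtype.val (B.sum_repr (L' (Pi.single k 1)))
      simp only [σ, map_sum, map_mul, aeval_X, algHom_C, ← Algebra.smul_def]
      simpa [B, Module.Basis.span_apply, L'] using this
    have h3 := aeval_eq_zero_of_quadrics (F := aeval σ F) hn hx (by
      rw [comp_aeval_apply]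
      simpa only [h1] using hF)
    rw [comp_aeval_apply] at h3
    simpa only [h2] using h3

end RationalNormalCurve

section Geometry

theorem finrank_map_le {K E F G : Type*} [Field K] [AddCommGroup E] [Module K E] [AddCommGroup F]
    [Module K F] [AddCommGroup G] [Module K G] {W : Submodule K E} [FiniteDimensional K W]
    {f : E →ₗ[K] F} {g : E →ₗ[K] G} (h : ∀ w ∈ W, g w = 0 → f w = 0) :
    Module.finrank K (W.map f) ≤ Module.finrank K (W.map g) := by
  rw [← LinearMap.range_domRestrict, ← LinearMap.range_domRestrict]
  have hf := (f.domRestrict W).finrank_range_add_finrank_ker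
  have hg := (g.domRestrict W).finrank_range_add_finrank_ker
  have : LinearMap.ker (g.domRestrict W) ≤ LinearMap.ker (f.domRestrict W) := fun w hw =>
    h w w.2 hw
  have := Submodule.finrank_mono this
  omega

variable {K : Type} [Field K] {n : ℕ}

instance finiteDimensional_homogeneousSubmodule (m : ℕ) :
    FiniteDimensional K (homogeneousSubmodule (Fin (n + 1)) K m) :=
  Module.Finite.iff_fg.2 (homogeneousSubmodule_fg _ _ m)

variable {I J : Ideal (MvPolynomial (Fin (n + 1)) K)}

theorem hilbF_le_of_le (h : I ≤ J) (m : ℕ) : hilbF J m ≤ hilbF I m :=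
  finrank_map_le fun f _ hf => by
    simp only [AlgHom.toLinearMap_apply, Ideal.Quotient.mkₐ_eq_mk,
      Ideal.Quotient.eq_zero_iff_mem] at hf ⊢
    exact h hf

theorem schemeDeg_eq {d : ℕ} (h : ∀ᶠ m : ℕ in atTop, hilbF I m = d) : schemeDeg I = d := by
  have hex : ∃ d : ℕ, ∀ᶠ m : ℕ in atTop, hilbF I m = d := ⟨d, h⟩
  rw [schemeDeg, dif_pos hex]
  obtain ⟨m, h1, h2⟩ := (hex.choose_spec.and h).exists
  exact h1.symm.trans h2

theorem mem_saturate {f : MvPolynomial (Fin (n + 1)) K} :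
    f ∈ saturate I ↔ ∃ k : ℕ, ∀ g ∈ irrelevantIdeal K n ^ k, f * g ∈ I := by
  rw [saturate, Submodule.mem_iSup_of_directed]
  · simp only [Submodule.mem_colon, SetLike.mem_coe, smul_eq_mul]
  · refine Monotone.directed_le fun i j hij => ?_
    exact Submodule.colon_mono le_rfl (SetLike.coe_subset_coe.2 (Ideal.pow_le_pow_right hij))

theorem le_saturate : I ≤ saturate I := fun _ hf =>
  mem_saturate.2 ⟨0, fun g _ => I.mul_mem_right g hf⟩

theorem exists_linear_form [Infinite K] (hI : saturate I = I) :
    ∃ ℓ ∈ homogeneousSubmodule (Fin (n + 1)) K 1, ∀ f, ℓ * f ∈ I → f ∈ I := by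
  let R := MvPolynomial (Fin (n + 1)) K
  have hfin := associatedPrimes.finite R (R ⧸ I)
  let S : Finset (Subspace K (homogeneousSubmodule (Fin (n + 1)) K 1)) :=
    hfin.toFinset.image fun 𝔭 => (𝔭.restrictScalars K).comap (Submodule.subtype _)
  have hS : ⊤ ∉ S := by
    intro htop
    obtain ⟨𝔭, h𝔭, htop⟩ := Finset.mem_image.1 htop
    rw [Set.Finite.mem_toFinset, AssociatedPrimes.mem_iff, isAssociatedPrime_iff] at h𝔭
    obtain ⟨hprime, y, hy⟩ := h𝔭
    obtain ⟨y, rfl⟩ := Ideal.Quotient.mk_surjective y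
    have hmem : ∀ g, g ∈ 𝔭 ↔ g * y ∈ I := by
      intro g
      rw [hy, Submodule.mem_colon_singleton, Submodule.mem_bot]
      exact Ideal.Quotient.eq_zero_iff_mem (I := I) (a := g * y)
    have hirr : irrelevantIdeal K n ≤ 𝔭 := by
      rw [irrelevantIdeal, Ideal.span_le]
      rintro _ ⟨i, rfl⟩
      have : (⟨X i, isHomogeneous_X K i⟩ : homogeneousSubmodule (Fin (n + 1)) K 1) ∈
          (𝔭.restrictScalars K).comap (Submodule.subtype _) := by rw [htop]; trivial
      exact this
    have hyI : y ∈ I := by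
      rw [← hI, mem_saturate]
      refine ⟨1, fun g hg => ?_⟩
      rw [pow_one] at hg
      rw [mul_comm]
      exact (hmem g).1 (hirr hg)
    exact hprime.ne_top ((Ideal.eq_top_iff_one _).2 ((hmem 1).2 (by rwa [one_mul])))
  obtain ⟨ℓ, hℓ⟩ := (Set.ne_univ_iff_exists_notMem _).1 (Subspace.biUnion_ne_univ_of_top_notMem hS)
  refine ⟨ℓ, ℓ.2, fun f hf => ?_⟩
  by_contra hfI
  have h1 : (ℓ : R) ∈ ⋃ 𝔭 ∈ associatedPrimes R (R ⧸ I), (𝔭 : Set R) := by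
    rw [biUnion_associatedPrimes_eq_zero_divisors]
    refine ⟨Ideal.Quotient.mk I f, by rwa [Ne, Ideal.Quotient.eq_zero_iff_mem], ?_⟩
    exact Ideal.Quotient.eq_zero_iff_mem.2 hf
  obtain ⟨𝔭, h𝔭, hℓ𝔭⟩ := Set.mem_iUnion₂.1 h1
  exact hℓ (Set.mem_iUnion₂.2 ⟨_, Finset.mem_image.2 ⟨𝔭, hfin.mem_toFinset.2 h𝔭, rfl⟩, hℓ𝔭⟩)

/-- A linear form `ℓ` whose hyperplane misses the saturated scheme with homogeneous ideal `I`. -/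
structure IsChart (I : Ideal (MvPolynomial (Fin (n + 1)) K)) (ℓ : MvPolynomial (Fin (n + 1)) K) :
    Prop where
  homog : Ideal.IsHomogeneous (homogeneousSubmodule (Fin (n + 1)) K) I
  mem : ℓ ∈ homogeneousSubmodule (Fin (n + 1)) K 1
  mem_of_mul_mem : ∀ f, ℓ * f ∈ I → f ∈ I

/-- The ideal of the affine chart `ℓ = 1` of the scheme with ideal `I`. -/
noncomputable def chartIdeal (I : Ideal (MvPolynomial (Fin (n + 1)) K)) (ℓ : MvPolynomial (Fin (n + 1)) K) :
    Ideal (MvPolynomial (Fin (n + 1)) K) :=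
  I ⊔ Ideal.span {ℓ - 1}

/-- The coordinate ring of the affine chart `ℓ = 1`. -/
abbrev ChartRing (I : Ideal (MvPolynomial (Fin (n + 1)) K)) (ℓ : MvPolynomial (Fin (n + 1)) K) :
    Type :=
  MvPolynomial (Fin (n + 1)) K ⧸ chartIdeal I ℓ

/-- Linear forms restricted to the affine chart `ℓ = 1`. -/
noncomputable def chartMap (I : Ideal (MvPolynomial (Fin (n + 1)) K)) (ℓ : MvPolynomial (Fin (n + 1)) K) :
    (Fin (n + 1) → K) →ₗ[K] ChartRing I ℓ :=
  (Ideal.Quotient.mkₐ K (chartIdeal I ℓ)).toLinearMap ∘ₗ Fintype.linearCombination K X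

theorem range_linearCombination_X :
    LinearMap.range (Fintype.linearCombination K (X : Fin (n + 1) → MvPolynomial (Fin (n + 1)) K)) =
      homogeneousSubmodule (Fin (n + 1)) K 1 := by
  rw [homogeneousSubmodule_one_eq_span_X, Fintype.range_linearCombination]

theorem linearCombination_X_injective :
    Function.Injective
      (Fintype.linearCombination K (X : Fin (n + 1) → MvPolynomial (Fin (n + 1)) K)) :=
  linearIndependent_iff_injective_fintypeLinearCombination.1 (linearIndependent_X _ _)

theorem range_chartMap_pow {ℓ : MvPolynomial (Fin (n + 1)) K} (m : ℕ) :
    LinearMap.range (chartMap I ℓ) ^ m =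
      (homogeneousSubmodule (Fin (n + 1)) K m).map
        (Ideal.Quotient.mkₐ K (chartIdeal I ℓ)).toLinearMap := by
  rw [chartMap, LinearMap.range_comp, range_linearCombination_X, ← Submodule.map_pow,
    homogeneousSubmodule_one_pow]

open DirectSum in
theorem sum_decompose_mul {ℓ : MvPolynomial (Fin (n + 1)) K}
    (hℓ : ℓ ∈ homogeneousSubmodule (Fin (n + 1)) K 1) (b : MvPolynomial (Fin (n + 1)) K) (N : ℕ) :
    ∑ i ∈ Finset.range (N + 1), ℓ ^ (N - i) *
        (decompose (homogeneousSubmodule (Fin (n + 1)) K) ((ℓ - 1) * b) i :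
          MvPolynomial (Fin (n + 1)) K) =
      -(decompose (homogeneousSubmodule (Fin (n + 1)) K) b N : MvPolynomial (Fin (n + 1)) K) := by
  have hsub : ∀ i, (decompose (homogeneousSubmodule (Fin (n + 1)) K) ((ℓ - 1) * b) i :
        MvPolynomial (Fin (n + 1)) K) =
      (decompose (homogeneousSubmodule (Fin (n + 1)) K) (ℓ * b) i :
        MvPolynomial (Fin (n + 1)) K) -
      (decompose (homogeneousSubmodule (Fin (n + 1)) K) b i : MvPolynomial (Fin (n + 1)) K) := by
    intro i
    rw [sub_mul, one_mul, decompose_sub, DirectSum.sub_apply, AddSubgroupClass.coe_sub]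
  induction N with
  | zero =>
    rw [Finset.sum_range_one, hsub, coe_decompose_mul_of_left_mem_of_not_le _ hℓ (by omega)]
    simp
  | succ N ih =>
    have h1 : ∀ i ∈ Finset.range (N + 1), ℓ ^ (N + 1 - i) *
        (decompose (homogeneousSubmodule (Fin (n + 1)) K) ((ℓ - 1) * b) i :
          MvPolynomial (Fin (n + 1)) K) = ℓ * (ℓ ^ (N - i) *
        (decompose (homogeneousSubmodule (Fin (n + 1)) K) ((ℓ - 1) * b) i :
          MvPolynomial (Fin (n + 1)) K)) := by
      intro i hi
      rw [Nat.sub_add_comm (by simpa [Nat.lt_succ_iff] using hi), pow_succ']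
      ring
    rw [Finset.sum_range_succ, Finset.sum_congr rfl h1, ← Finset.mul_sum, ih, hsub,
      coe_decompose_mul_of_left_mem_of_le _ hℓ (by omega), Nat.add_sub_cancel, Nat.sub_self]
    ring

namespace IsChart

variable {ℓ : MvPolynomial (Fin (n + 1)) K}

theorem mem_of_pow_mul_mem (h : IsChart I ℓ) {f : MvPolynomial (Fin (n + 1)) K} {k : ℕ}
    (hf : ℓ ^ k * f ∈ I) : f ∈ I := by
  induction k with
  | zero => simpa using hf
  | succ k ih => exact ih (h.mem_of_mul_mem _ (by rwa [← mul_assoc, ← pow_succ']))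

open DirectSum in
theorem mem_of_mem_chartIdeal (h : IsChart I ℓ) {m : ℕ} {f : MvPolynomial (Fin (n + 1)) K}
    (hf : f ∈ homogeneousSubmodule (Fin (n + 1)) K m) (hfI : f ∈ chartIdeal I ℓ) : f ∈ I := by
  obtain ⟨a, ha, b', hb', rfl⟩ := Submodule.mem_sup.1 hfI
  obtain ⟨b, rfl⟩ := Ideal.mem_span_singleton.1 hb'
  let N := m + b.totalDegree + 1
  refine h.mem_of_pow_mul_mem (k := N - m) ?_
  have hb : (decompose (homogeneousSubmodule (Fin (n + 1)) K) b N :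
      MvPolynomial (Fin (n + 1)) K) = 0 :=
    (decomposition.decompose'_apply b N).trans (homogeneousComponent_eq_zero _ _ (by omega))
  have h1 := sum_decompose_mul h.mem b N
  rw [hb, neg_zero] at h1
  have h2 : ∑ i ∈ Finset.range (N + 1), ℓ ^ (N - i) *
      (decompose (homogeneousSubmodule (Fin (n + 1)) K) (a + (ℓ - 1) * b) i :
          MvPolynomial (Fin (n + 1)) K) = ℓ ^ (N - m) * (a + (ℓ - 1) * b) := by
    rw [Finset.sum_eq_single m, decompose_of_mem_same _ hf]
    · intro i _ hi
      rw [decompose_of_mem_ne _ hf (Ne.symm hi), mul_zero]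
    · intro hm
      exact absurd (Finset.mem_range.2 (by omega)) hm
  rw [← h2]
  have h3 : ∀ i, (decompose (homogeneousSubmodule (Fin (n + 1)) K) (a + (ℓ - 1) * b) i :
          MvPolynomial (Fin (n + 1)) K) =
      (decompose (homogeneousSubmodule (Fin (n + 1)) K) a i : MvPolynomial (Fin (n + 1)) K) +
      (decompose (homogeneousSubmodule (Fin (n + 1)) K) ((ℓ - 1) * b) i :
          MvPolynomial (Fin (n + 1)) K) := by
    intro i
    rw [decompose_add, DirectSum.add_apply, AddMemClass.coe_add]
  simp only [h3, mul_add, Finset.sum_add_distrib]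
  rw [h1, add_zero]
  exact Submodule.sum_mem _ fun i _ => I.mul_mem_left _ (h.homog i ha)

theorem finrank_range_chartMap_pow (h : IsChart I ℓ) (m : ℕ) :
    Module.finrank K ↥(LinearMap.range (chartMap I ℓ) ^ m) = hilbF I m := by
  rw [range_chartMap_pow]
  apply le_antisymm <;> refine finrank_map_le fun f hf hf0 => ?_ <;>
    simp only [AlgHom.toLinearMap_apply, Ideal.Quotient.mkₐ_eq_mk,
      Ideal.Quotient.eq_zero_iff_mem] at hf0 ⊢
  · exact Ideal.mem_sup_left hf0
  · exact h.mem_of_mem_chartIdeal hf hf0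

theorem one_mem_range (h : IsChart I ℓ) : 1 ∈ LinearMap.range (chartMap I ℓ) := by
  rw [← pow_one (LinearMap.range (chartMap I ℓ)), range_chartMap_pow]
  refine ⟨ℓ, h.mem, ?_⟩
  rw [AlgHom.toLinearMap_apply, ← map_one (Ideal.Quotient.mkₐ K (chartIdeal I ℓ)), ← sub_eq_zero,
    ← map_sub, Ideal.Quotient.mkₐ_eq_mk, Ideal.Quotient.eq_zero_iff_mem]
  exact Ideal.mem_sup_right (Ideal.mem_span_singleton_self _)

theorem pow_eq_top_of_le (h : IsChart I ℓ) {i j : ℕ} (hij : i ≤ j)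
    (hi : LinearMap.range (chartMap I ℓ) ^ i = ⊤) : LinearMap.range (chartMap I ℓ) ^ j = ⊤ :=
  top_le_iff.1 (hi ▸ pow_le_pow_of_one_mem h.one_mem_range hij)

theorem exists_range_pow_eq_top (h : IsChart I ℓ) {d : ℕ}
    (hfin : ∀ᶠ m : ℕ in atTop, hilbF I m = d) :
    ∃ m, LinearMap.range (chartMap I ℓ) ^ m = ⊤ := by
  obtain ⟨M, hM⟩ := eventually_atTop.1 hfin
  have hstab : ∀ m ≥ M,
      LinearMap.range (chartMap I ℓ) ^ M = LinearMap.range (chartMap I ℓ) ^ m := by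
    intro m hm
    have : FiniteDimensional K ↥(LinearMap.range (chartMap I ℓ) ^ m) := by
      rw [range_chartMap_pow]
      infer_instance
    refine Submodule.eq_of_le_of_finrank_eq (pow_le_pow_of_one_mem h.one_mem_range hm) ?_
    rw [h.finrank_range_chartMap_pow, h.finrank_range_chartMap_pow, hM M le_rfl, hM m hm]
  refine ⟨M, Submodule.eq_top_iff'.2 fun y => ?_⟩
  obtain ⟨F, rfl⟩ := Ideal.Quotient.mkₐ_surjective K (chartIdeal I ℓ) y
  rw [← sum_homogeneousComponent F, map_sum]
  refine Submodule.sum_mem _ fun i _ => ?_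
  rw [hstab (max i M) (le_max_right _ _)]
  refine pow_le_pow_of_one_mem h.one_mem_range (le_max_left _ _) ?_
  rw [range_chartMap_pow]
  exact ⟨_, homogeneousComponent_mem i F, rfl⟩

theorem finiteDimensional {m : ℕ} (hm : LinearMap.range (chartMap I ℓ) ^ m = ⊤) :
    FiniteDimensional K (ChartRing I ℓ) := by
  rw [range_chartMap_pow] at hm
  have : FiniteDimensional K (⊤ : Submodule K (ChartRing I ℓ)) := hm ▸ inferInstance
  exact Module.Finite.equiv Submodule.topEquiv

theorem hilbF_eq_finrank (h : IsChart I ℓ) {m : ℕ}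
    (hm : LinearMap.range (chartMap I ℓ) ^ m = ⊤) :
    hilbF I m = Module.finrank K (ChartRing I ℓ) := by
  rw [← h.finrank_range_chartMap_pow, hm, finrank_top]

theorem pow_eq_top_iff [FiniteDimensional K (ChartRing I ℓ)] (h : IsChart I ℓ) {m : ℕ} :
    LinearMap.range (chartMap I ℓ) ^ m = ⊤ ↔ hilbF I m = Module.finrank K (ChartRing I ℓ) :=
  ⟨h.hilbF_eq_finrank, fun hm => Submodule.eq_top_of_finrank_eq
    ((h.finrank_range_chartMap_pow m).trans hm)⟩

theorem exists_sub_mem {m : ℕ} (hm : LinearMap.range (chartMap I ℓ) ^ m = ⊤)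
    (F : MvPolynomial (Fin (n + 1)) K) :
    ∃ G ∈ homogeneousSubmodule (Fin (n + 1)) K m, F - G ∈ chartIdeal I ℓ := by
  rw [range_chartMap_pow] at hm
  obtain ⟨G, hG, hGF⟩ : Ideal.Quotient.mkₐ K (chartIdeal I ℓ) F ∈
    (homogeneousSubmodule (Fin (n + 1)) K m).map
        (Ideal.Quotient.mkₐ K (chartIdeal I ℓ)).toLinearMap := by rw [hm]; trivial
  refine ⟨G, hG, ?_⟩
  rw [← Ideal.Quotient.eq_zero_iff_mem, map_sub, sub_eq_zero]
  exact hGF.symm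

theorem hilbF_succ_le (h : IsChart I ℓ) {m : ℕ} (hm : LinearMap.range (chartMap I ℓ) ^ m = ⊤)
    (hIJ : I ≤ J) : hilbF J (m + 1) ≤ hilbF J m := by
  refine le_trans (Submodule.finrank_mono ?_) (Submodule.finrank_map_le
    (LinearMap.mulLeft K (Ideal.Quotient.mkₐ K J ℓ)) _)
  rintro _ ⟨F, hF, rfl⟩
  obtain ⟨G, hG, hFG⟩ := exists_sub_mem hm F
  refine ⟨Ideal.Quotient.mkₐ K J G, ⟨G, hG, rfl⟩, ?_⟩
  have hℓG : ℓ * G ∈ homogeneousSubmodule (Fin (n + 1)) K (m + 1) := by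
    rw [mul_comm]
    exact IsHomogeneous.mul hG h.mem
  have hmem : F - ℓ * G ∈ chartIdeal I ℓ := by
    have h1 : (ℓ - 1) * G ∈ chartIdeal I ℓ :=
      Ideal.mul_mem_right _ _ (Ideal.mem_sup_right (Ideal.mem_span_singleton_self _))
    convert sub_mem hFG h1 using 1
    ring
  have h2 := hIJ (h.mem_of_mem_chartIdeal (sub_mem hF hℓG) hmem)
  rw [LinearMap.mulLeft_apply, ← map_mul, AlgHom.toLinearMap_apply, eq_comm, ← sub_eq_zero,
    ← map_sub]
  exact Ideal.Quotient.eq_zero_iff_mem.2 h2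

theorem hilbF_le_hilbF (h : IsChart I ℓ) {m m' : ℕ}
    (hm : LinearMap.range (chartMap I ℓ) ^ m = ⊤) (hIJ : I ≤ J) (hmm : m ≤ m') :
    hilbF J m' ≤ hilbF J m := by
  induction m', hmm using Nat.le_induction with
  | base => rfl
  | succ k hk ih => exact (h.hilbF_succ_le (h.pow_eq_top_of_le hk hm) hIJ).trans ih

theorem eventually_hilbF_eq (h : IsChart I ℓ) {m : ℕ}
    (hm : LinearMap.range (chartMap I ℓ) ^ m = ⊤) (hIJ : I ≤ J) :
    ∀ᶠ k : ℕ in atTop, hilbF J k = schemeDeg J := by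
  have hex : ∃ e, ∃ k ≥ m, hilbF J k = e := ⟨_, m, le_rfl, rfl⟩
  obtain ⟨k, hk, hke⟩ := Nat.find_spec hex
  have hev : ∀ᶠ i : ℕ in atTop, hilbF J i = Nat.find hex := by
    filter_upwards [eventually_ge_atTop k] with i hi
    apply le_antisymm
    · rw [← hke]
      exact h.hilbF_le_hilbF (h.pow_eq_top_of_le hk hm) hIJ hi
    · exact Nat.find_min' hex ⟨i, hk.le.trans hi, rfl⟩
  rwa [schemeDeg_eq hev]

theorem schemeDeg_interIdeal_le (h : IsChart I ℓ) {m : ℕ}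
    (hm : LinearMap.range (chartMap I ℓ) ^ m = ⊤) :
    schemeDeg (interIdeal I J) ≤ hilbF (I ⊔ J) m := by
  have hI : I ≤ interIdeal I J := le_sup_left.trans le_saturate
  obtain ⟨k, hk, hmk⟩ :=
    ((h.eventually_hilbF_eq hm hI).and (eventually_ge_atTop m)).exists
  rw [← hk]
  exact (h.hilbF_le_hilbF hm hI hmk).trans (hilbF_le_of_le le_saturate m)

theorem finrank_le_schemeDeg_interIdeal (h : IsChart I ℓ) {m : ℕ}
    (hm : LinearMap.range (chartMap I ℓ) ^ m = ⊤) {B : Type*} [CommRing B] [Algebra K B]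
    (f : MvPolynomial (Fin (n + 1)) K →ₐ[K] B) (hf : Function.Surjective f)
    (hfI : ∀ F ∈ chartIdeal I ℓ, f F = 0) (hfJ : ∀ F ∈ J, f F = 0) :
    Module.finrank K B ≤ schemeDeg (interIdeal I J) := by
  have hI : I ≤ interIdeal I J := le_sup_left.trans le_saturate
  obtain ⟨k, hk, hmk⟩ :=
    ((h.eventually_hilbF_eq hm hI).and (eventually_ge_atTop m)).exists
  rw [← hk]
  have htop : (homogeneousSubmodule (Fin (n + 1)) K k).map f.toLinearMap = ⊤ := by
    refine Submodule.eq_top_iff'.2 fun b => ?_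
    obtain ⟨F, rfl⟩ := hf b
    obtain ⟨G, hG, hFG⟩ := exists_sub_mem (h.pow_eq_top_of_le hmk hm) F
    refine ⟨G, hG, ?_⟩
    rw [AlgHom.toLinearMap_apply, eq_comm, ← sub_eq_zero, ← map_sub, hfI _ hFG]
  have hker : I ⊔ J ≤ RingHom.ker f :=
    sup_le (fun F hF => hfI F (Ideal.mem_sup_left hF)) fun F hF => hfJ F hF
  have hfℓ : f ℓ = 1 := by
    rw [← sub_eq_zero, ← map_one f, ← map_sub]
    exact hfI _ (Ideal.mem_sup_right (Ideal.mem_span_singleton_self _))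
  have hℓ : ℓ ∈ irrelevantIdeal K n := by
    have := h.mem
    rw [homogeneousSubmodule_one_eq_span_X] at this
    exact Submodule.span_le_restrictScalars K _ _ this
  rw [← finrank_top K B, ← htop]
  refine finrank_map_le fun F _ hF => ?_
  obtain ⟨j, hj⟩ := mem_saturate.1 (Ideal.Quotient.eq_zero_iff_mem.1 hF)
  have := hker (hj _ (Ideal.pow_mem_pow hℓ j))
  rwa [RingHom.mem_ker, map_mul, map_pow, hfℓ, one_pow, mul_one] at this

/-- The restriction of polynomials to a closed subscheme of the affine chart. -/
noncomputable def quotientMap (𝔞 : Ideal (ChartRing I ℓ)) :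
    MvPolynomial (Fin (n + 1)) K →ₐ[K] ChartRing I ℓ ⧸ 𝔞 :=
  (Ideal.Quotient.mkₐ K 𝔞).comp (Ideal.Quotient.mkₐ K (chartIdeal I ℓ))

theorem quotientMap_surjective (𝔞 : Ideal (ChartRing I ℓ)) :
    Function.Surjective (quotientMap 𝔞) :=
  (Ideal.Quotient.mkₐ_surjective K _).comp (Ideal.Quotient.mkₐ_surjective K _)

theorem quotientMap_eq_zero (𝔞 : Ideal (ChartRing I ℓ)) {F : MvPolynomial (Fin (n + 1)) K}
    (hF : F ∈ chartIdeal I ℓ) : quotientMap 𝔞 F = 0 := by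
  rw [quotientMap, AlgHom.comp_apply, Ideal.Quotient.mkₐ_eq_mk K (chartIdeal I ℓ),
    Ideal.Quotient.eq_zero_iff_mem.2 hF, map_zero]

theorem finrank_quotient_le_schemeDeg_interIdeal (h : IsChart I ℓ) {m : ℕ}
    (hm : LinearMap.range (chartMap I ℓ) ^ m = ⊤) (𝔞 : Ideal (ChartRing I ℓ))
    (hJ : J ≤ RingHom.ker (quotientMap 𝔞)) :
    Module.finrank K (ChartRing I ℓ ⧸ 𝔞) ≤ schemeDeg (interIdeal I J) :=
  h.finrank_le_schemeDeg_interIdeal (B := ChartRing I ℓ ⧸ 𝔞) hm (quotientMap 𝔞)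
    (quotientMap_surjective 𝔞) (fun _ hF => quotientMap_eq_zero 𝔞 hF) fun _ hF => hJ hF

theorem span_map_le_ker_quotientMap (W : Submodule K (Fin (n + 1) → K)) :
    Ideal.span (W.map (Fintype.linearCombination K
      (X : Fin (n + 1) → MvPolynomial (Fin (n + 1)) K)) : Set (MvPolynomial (Fin (n + 1)) K)) ≤
      RingHom.ker (quotientMap (Ideal.span (W.map (chartMap I ℓ) : Set (ChartRing I ℓ)))) := by
  rw [Ideal.span_le]
  rintro _ ⟨w, hw, rfl⟩
  rw [SetLike.mem_coe, RingHom.mem_ker, quotientMap, AlgHom.comp_apply, Ideal.Quotient.mkₐ_eq_mk K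
    (Ideal.span _), Ideal.Quotient.eq_zero_iff_mem]
  exact Ideal.subset_span ⟨w, hw, rfl⟩

theorem schemeDeg_interIdeal_span_le (hlgp : InLinGenPos I)
    {W : Submodule K (MvPolynomial (Fin (n + 1)) K)}
    (hW : W ≤ homogeneousSubmodule (Fin (n + 1)) K 1) {t : ℕ}
    (ht : Module.finrank K W + t = n) (htn : t < n) :
    schemeDeg (interIdeal I (Ideal.span (W : Set (MvPolynomial (Fin (n + 1)) K)))) ≤ t + 1 := by
  have hnot : ¬ HasSecantPlane I t := Nat.notMem_of_lt_sInf (s := {t | HasSecantPlane I t})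
    (htn.trans_eq hlgp.symm)
  by_contra hcon
  exact hnot ⟨_, ⟨W, hW, ht, rfl⟩, by omega⟩

theorem isLGPMap (h : IsChart I ℓ) {m : ℕ} (hm : LinearMap.range (chartMap I ℓ) ^ m = ⊤)
    (hlgp : InLinGenPos I) : IsLGPMap (chartMap I ℓ) where
  one_mem := h.one_mem_range
  colength_le W hW := by
    have hpos : 0 < Module.finrank K W := by
      have := Submodule.one_le_finrank_iff.2 hW
      omega
    have hle : Module.finrank K W ≤ n + 1 := (Submodule.finrank_le W).trans (by simp)
    rcases hle.lt_or_eq with hlt | heq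
    · have hdeg := schemeDeg_interIdeal_span_le hlgp
        (W := W.map (Fintype.linearCombination K
          (X : Fin (n + 1) → MvPolynomial (Fin (n + 1)) K)))
        (t := n - Module.finrank K W)
        (by rw [← range_linearCombination_X]; exact LinearMap.map_le_range)
        (by
          rw [finrank_map_eq fun w _ hw =>
            (map_eq_zero_iff _ linearCombination_X_injective).1 hw]
          omega) (by omega)
      have := h.finrank_quotient_le_schemeDeg_interIdeal hm _ (span_map_le_ker_quotientMap W)
      omega
    · have hWtop : W = ⊤ := Submodule.eq_top_of_finrank_eq (by rw [heq]; simp)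
      have hspan : Ideal.span (W.map (chartMap I ℓ) : Set (ChartRing I ℓ)) = ⊤ := by
        refine (Ideal.eq_top_iff_one _).2 (Ideal.subset_span ?_)
        rw [hWtop, Submodule.map_top]
        exact h.one_mem_range
      have : Subsingleton (ChartRing I ℓ ⧸
          Ideal.span (W.map (chartMap I ℓ) : Set (ChartRing I ℓ))) :=
        Ideal.Quotient.subsingleton_iff.2 hspan
      rw [Module.finrank_zero_of_subsingleton]
      omega

end IsChart

theorem hilbF_le_of_isRNC [Infinite K] {t : ℕ} (hJ : IsRNC t J) (m : ℕ) :
    hilbF J m ≤ t * m + 1 := by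
  obtain ⟨p, hp, -, rfl⟩ := hJ
  calc _ ≤ Module.finrank K
        ((homogeneousSubmodule (Fin (n + 1)) K m).map (aeval (R := K) p).toLinearMap) :=
        finrank_map_le fun F _ hF => Ideal.Quotient.eq_zero_iff_mem.2 (mem_iInf_ker_eval.2 hF)
    _ ≤ Module.finrank K (homogeneousSubmodule (Fin 2) K (t * m)) := by
        refine Submodule.finrank_mono ?_
        rintro _ ⟨F, hF, rfl⟩
        exact IsHomogeneous.aeval hF p hp
    _ ≤ t * m + 1 := finrank_homogeneousSubmodule_le _

theorem IsFiniteSubscheme.exists_isChart [Infinite K] (hI : IsFiniteSubscheme I) :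
    ∃ ℓ m, IsChart I ℓ ∧ LinearMap.range (chartMap I ℓ) ^ m = ⊤ ∧
      Module.finrank K (ChartRing I ℓ) = schemeDeg I := by
  obtain ⟨ℓ, hℓ, hℓI⟩ := exists_linear_form hI.saturated
  have h : IsChart I ℓ := ⟨hI.homog, hℓ, hℓI⟩
  obtain ⟨d, -, hd⟩ := hI.finite
  obtain ⟨m, hm⟩ := h.exists_range_pow_eq_top hd
  refine ⟨ℓ, m, h, hm, (schemeDeg_eq ?_).symm⟩
  filter_upwards [eventually_ge_atTop m] with k hk
  exact h.hilbF_eq_finrank (h.pow_eq_top_of_le hk hm)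

namespace IsChart

variable {ℓ : MvPolynomial (Fin (n + 1)) K}

theorem schemeReg_eq_iff [FiniteDimensional K (ChartRing I ℓ)] (h : IsChart I ℓ)
    (hd : Module.finrank K (ChartRing I ℓ) = schemeDeg I) {q : ℕ}
    (hq : LinearMap.range (chartMap I ℓ) ^ (q + 1) = ⊤) :
    schemeReg I = q + 2 ↔ LinearMap.range (chartMap I ℓ) ^ q ≠ ⊤ := by
  have hmem : ∀ {k}, LinearMap.range (chartMap I ℓ) ^ k = ⊤ →
      k + 1 ∈ {p : ℕ | 1 ≤ p ∧ ∀ m : ℕ, p - 1 ≤ m → hilbF I m = schemeDeg I} := fun hk =>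
    ⟨by omega, fun m hm => (h.hilbF_eq_finrank (h.pow_eq_top_of_le hm hk)).trans hd⟩
  rw [schemeReg]
  constructor
  · intro hreg htop
    have := Nat.sInf_le (hmem htop)
    omega
  · intro hne
    refine le_antisymm (Nat.sInf_le (hmem hq)) (le_csInf ⟨_, hmem hq⟩ ?_)
    rintro p ⟨-, hp⟩
    by_contra hlt
    exact hne (h.pow_eq_top_iff.2 ((hp q (by omega)).trans hd.symm))

theorem bddAbove_degree_inter_RNC (h : IsChart I ℓ) {m : ℕ}
    (hm : LinearMap.range (chartMap I ℓ) ^ m = ⊤) :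
    BddAbove {e : ℕ | ∃ J : Ideal (MvPolynomial (Fin (n + 1)) K),
      IsRNC n J ∧ e = schemeDeg (interIdeal I J)} := by
  refine ⟨hilbF I m, ?_⟩
  rintro _ ⟨J, -, rfl⟩
  exact (h.schemeDeg_interIdeal_le hm).trans (hilbF_le_of_le le_sup_left m)

theorem rhoInv_le [Infinite K] (h : IsChart I ℓ) {q : ℕ}
    (hq : LinearMap.range (chartMap I ℓ) ^ q = ⊤) : rhoInv I ≤ n * q + 1 := by
  rcases Set.eq_empty_or_nonempty {e : ℕ | ∃ J : Ideal (MvPolynomial (Fin (n + 1)) K),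
      IsRNC n J ∧ e = schemeDeg (interIdeal I J)} with hS | hS
  · rw [rhoInv, hS, csSup_empty]
    exact Nat.zero_le _
  · obtain ⟨J, hJ, he⟩ := Nat.sSup_mem hS (h.bddAbove_degree_inter_RNC hq)
    rw [rhoInv, he]
    exact ((h.schemeDeg_interIdeal_le hq).trans (hilbF_le_of_le le_sup_right q)).trans
      (hilbF_le_of_isRNC hJ q)

theorem le_rhoInv [IsAlgClosed K] [FiniteDimensional K (ChartRing I ℓ)] (h : IsChart I ℓ) {m : ℕ}
    (hm : LinearMap.range (chartMap I ℓ) ^ m = ⊤) (hlgp : InLinGenPos I) (hn : 1 ≤ n) {q : ℕ}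
    (hq : 2 * n + 2 ≤ q) (hO : n < Module.finrank K (ChartRing I ℓ))
    (hd : Module.finrank K (ChartRing I ℓ) ≤ n * q + n + 1)
    (hne : LinearMap.range (chartMap I ℓ) ^ q ≠ ⊤) : n * q + 2 ≤ rhoInv I := by
  obtain ⟨𝔞, h𝔞, x, hspan, hind, hx⟩ :=
    (h.isLGPMap hm hlgp).exists_quotient_quadrics hn hq hd hO hne
  have : Infinite K := IsAlgClosed.instInfinite
  obtain ⟨J, hJ, hJ0⟩ := exists_isRNC hn hspan hind hx
  have hmap : aeval (fun k => ((Ideal.Quotient.mkₐ K 𝔞).toLinearMap.comp (chartMap I ℓ))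
      (Pi.single k 1)) = quotientMap 𝔞 := by
    ext k
    simp [chartMap, quotientMap]
  refine h𝔞.trans ((h.finrank_quotient_le_schemeDeg_interIdeal hm 𝔞 fun F hF => ?_).trans
    (le_csSup (h.bddAbove_degree_inter_RNC hm) ⟨J, hJ, rfl⟩))
  rw [RingHom.mem_ker, ← hmap, hJ0 F hF]

end IsChart

end Geometry

end FiniteScheme

/-- Corollary 1.5. -/
theorem stmt3 (K : Type) [Field K] [IsAlgClosed K] [CharZero K] (n d q r : ℕ) (hn : 2 ≤ n)
    (I : Ideal (MvPolynomial (Fin (n+1)) K))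
    (hfin : IsFiniteSubscheme I) (hlgp : InLinGenPos I) (hdeg : schemeDeg I = d)
    (hd : 4*n^2 + 6*n + 1 ≤ d)
    (hdqr : d = n*q + r + 2) (hr : r ≤ n - 1) :
    (schemeReg I : ℤ) = ⌈((d : ℚ) - 1) / (n : ℚ)⌉ + 1 ↔ d - r ≤ rhoInv I := by
  obtain ⟨ℓ, m, h, hm, hO⟩ := FiniteScheme.IsFiniteSubscheme.exists_isChart hfin
  have := FiniteScheme.IsChart.finiteDimensional hm
  have hq : 2 * n + 2 ≤ q := by
    have h1 : n * (4 * n + 5) ≤ n * q := by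
      zify [show 1 ≤ n by omega] at *
      nlinarith
    have := Nat.le_of_mul_le_mul_left h1 (by omega)
    omega
  have hnd : n < Module.finrank K (FiniteScheme.ChartRing I ℓ) := by
    rw [hO, hdeg]
    nlinarith
  have htop := (h.isLGPMap hm hlgp).range_pow_eq_top hnd (m := q + 1) (by
    rw [hO, hdeg, Nat.mul_succ]
    omega)
  have hceil : ⌈((d : ℚ) - 1) / (n : ℚ)⌉ = q + 1 := by
    have hn0 : (0 : ℚ) < n := by exact_mod_cast (show 0 < n by omega)
    have hr' : (r : ℚ) + 1 ≤ n := by exact_mod_cast (show r + 1 ≤ n by omega)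
    have hr0 : (0 : ℚ) ≤ r := r.cast_nonneg
    rw [Int.ceil_eq_iff, lt_div_iff₀ hn0, div_le_iff₀ hn0, hdqr]
    push_cast
    constructor <;> linarith
  have hreg : (schemeReg I : ℤ) = ⌈((d : ℚ) - 1) / (n : ℚ)⌉ + 1 ↔ schemeReg I = q + 2 := by
    rw [hceil]
    omega
  rw [hreg, h.schemeReg_eq_iff hO htop, show d - r = n * q + 2 by omega]
  constructor
  · refine h.le_rhoInv hm hlgp (by omega) hq hnd ?_
    rw [hO, hdeg]
    omega
  · intro hrho hqtop
    have := h.rhoInv_le hqtop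
    omega
end
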